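/- arXiv:1407.0559 — 2 statements merged into one kernel-verified Lean document; each statement's English description precedes it below -/
import Mathlib

section
/- Let R be a commutative Noetherian ring, a an ideal of R, M a finitely generated R-module, n a non-negative integer, and set t = f_a^n(M). Then: the R-modules Ext_R^j(R/a, H^i_a(M)) are in dimension < n for all i = 0, 1, ..., t-1 and all integers j ≥ 0; moreover, the R-modules Hom_R(R/a, H^t_a(M)) and Ext_R^1(R/a, H^t_a(M)) are in dimension < n. -/
open CategoryTheory

noncomputable section

/-- An `R`-module `M` is *in dimension `< n`* if there exists a finitely generated
submodule `N ⊆ M` such that `dim Supp (M/N) < n`. -/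
def InDimLT (R : Type) [CommRing R] (M : Type) [AddCommGroup M] [Module R M] (n : ℕ) : Prop :=
  ∃ N : Submodule R M, N.FG ∧ Order.krullDim (Module.support R (M ⧸ N)) < (n : WithBot ℕ∞)

/-- The `i`-th local cohomology module of `M` with support in the ideal `a`. -/
def locCoh (R : Type) [CommRing R] (a : Ideal R) (i : ℕ)
    (M : Type) [AddCommGroup M] [Module R M] : ModuleCat R :=
  (localCohomology a i).obj (ModuleCat.of R M)

/-- The finiteness dimension `f_a(M)`:  the least `i` such that `H^i_a(M)` is not
finitely generated (`∞` if there is no such `i`). -/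
def finDim (R : Type) [CommRing R] (a : Ideal R)
    (M : Type) [AddCommGroup M] [Module R M] : ℕ∞ :=
  sInf (Nat.cast '' {i : ℕ | ¬ Module.Finite R ↥(locCoh R a i M)})

/-- The `n`-th finiteness dimension `f_a^n(M)`. -/
def finDimN (R : Type) [CommRing R] (a : Ideal R) (n : ℕ)
    (M : Type) [AddCommGroup M] [Module R M] : ℕ∞ :=
  sInf {d : ℕ∞ | ∃ p : PrimeSpectrum R,
    p ∈ Module.support R (M ⧸ (a • ⊤ : Submodule R M)) ∧
    (n : WithBot ℕ∞) ≤ ringKrullDim (R ⧸ p.asIdeal) ∧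
    d = finDim (Localization.AtPrime p.asIdeal)
      (a.map (algebraMap R (Localization.AtPrime p.asIdeal)))
      (LocalizedModule p.asIdeal.primeCompl M)}

/-- `h_a^n(M)`: the least `i` such that `H^i_a(M)` is not in dimension `< n`. -/
def hDimN (R : Type) [CommRing R] (a : Ideal R) (n : ℕ)
    (M : Type) [AddCommGroup M] [Module R M] : ℕ∞ :=
  sInf (Nat.cast '' {i : ℕ | ¬ InDimLT R ↥(locCoh R a i M) n})

namespace CategoryTheory

open Limits

section

variable {C D : Type*} [Category* C] [Category* D] [Abelian C] [HasProjectiveResolutions C]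
  [Abelian D]

/-- `ProjectiveResolution.isoLeftDerivedObj`, with target spelled out as a homology object. -/
def ProjectiveResolution.isoLeftDerivedHomology {X : C} (P : ProjectiveResolution X)
    (F : C ⥤ D) [F.Additive] (n : ℕ) :
    (F.leftDerived n).obj X ≅ ((F.mapHomologicalComplex _).obj P.complex).homology n :=
  P.isoLeftDerivedObj F n

lemma ProjectiveResolution.isoLeftDerivedHomology_hom_naturality
    {X Y : C} (f : X ⟶ Y) (P : ProjectiveResolution X) (Q : ProjectiveResolution Y)
    (φ : P.complex ⟶ Q.complex) (comm : φ.f 0 ≫ Q.π.f 0 = P.π.f 0 ≫ f)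
    (F : C ⥤ D) [F.Additive] (n : ℕ) :
    (F.leftDerived n).map f ≫ (Q.isoLeftDerivedHomology F n).hom =
      (P.isoLeftDerivedHomology F n).hom ≫
        HomologicalComplex.homologyMap ((F.mapHomologicalComplex _).map φ) n :=
  P.isoLeftDerivedObj_hom_naturality f Q φ comm F n

lemma ProjectiveResolution.isoLeftDerivedHomology_inv_naturality
    {X Y : C} (f : X ⟶ Y) (P : ProjectiveResolution X) (Q : ProjectiveResolution Y)
    (φ : P.complex ⟶ Q.complex) (comm : φ.f 0 ≫ Q.π.f 0 = P.π.f 0 ≫ f)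
    (F : C ⥤ D) [F.Additive] (n : ℕ) :
    (P.isoLeftDerivedHomology F n).inv ≫ (F.leftDerived n).map f =
      HomologicalComplex.homologyMap ((F.mapHomologicalComplex _).map φ) n ≫
        (Q.isoLeftDerivedHomology F n).inv :=
  P.isoLeftDerivedObj_inv_naturality f Q φ comm F n

lemma ProjectiveResolution.isoLeftDerivedHomology_inv_app
    {F G : C ⥤ D} [F.Additive] [G.Additive] (α : F ⟶ G) {X : C} (P : ProjectiveResolution X)
    (n : ℕ) : (P.isoLeftDerivedHomology F n).inv ≫ (NatTrans.leftDerived α n).app X =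
      HomologicalComplex.homologyMap ((NatTrans.mapHomologicalComplex α _).app P.complex) n ≫
        (P.isoLeftDerivedHomology G n).inv :=
  (Iso.inv_comp_eq _).2 (P.leftDerived_app_eq α n)

end

lemma ShortComplex.exact_mk_of_iso {D : Type*} [Category* D] [Abelian D] (S : ShortComplex D)
    (hS : S.Exact) {Y₁ Y₂ Y₃ : D} (e₁ : S.X₁ ≅ Y₁) (e₂ : S.X₂ ≅ Y₂) (e₃ : S.X₃ ≅ Y₃)
    (f : Y₁ ⟶ Y₂) (g : Y₂ ⟶ Y₃) (hf : e₁.hom ≫ f = S.f ≫ e₂.hom)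
    (hg : e₂.hom ≫ g = S.g ≫ e₃.hom) : ∃ w, (ShortComplex.mk f g w).Exact := by
  have w : f ≫ g = 0 := by
    rw [← cancel_epi e₁.hom, ← Category.assoc, hf, Category.assoc, hg, ← Category.assoc, S.zero,
      zero_comp, comp_zero]
  exact ⟨w, (ShortComplex.exact_iff_of_iso (ShortComplex.isoMk e₁ e₂ e₃ hf hg)).1 hS⟩

end CategoryTheory

namespace CategoryTheory.ShortComplex

open Limits

variable {C D : Type*} [Category* C] [Category* D] [Abelian C]
  [Abelian D] (S : ShortComplex (C ⥤ D)) [S.X₁.Additive] [S.X₂.Additive] [S.X₃.Additive]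

/-- A short complex of additive functors applied to a chain complex. -/
abbrev mapChainComplex (K : ChainComplex C ℕ) : ShortComplex (ChainComplex D ℕ) where
  X₁ := (S.X₁.mapHomologicalComplex _).obj K
  X₂ := (S.X₂.mapHomologicalComplex _).obj K
  X₃ := (S.X₃.mapHomologicalComplex _).obj K
  f := (NatTrans.mapHomologicalComplex S.f _).app K
  g := (NatTrans.mapHomologicalComplex S.g _).app K
  zero := by
    ext i
    exact congr_app S.zero (K.X i)

/-- Functoriality of `mapChainComplex` in the chain complex. -/
abbrev mapChainComplexMap {K L : ChainComplex C ℕ} (φ : K ⟶ L) :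
    S.mapChainComplex K ⟶ S.mapChainComplex L where
  τ₁ := (S.X₁.mapHomologicalComplex _).map φ
  τ₂ := (S.X₂.mapHomologicalComplex _).map φ
  τ₃ := (S.X₃.mapHomologicalComplex _).map φ
  comm₁₂ := (NatTrans.mapHomologicalComplex S.f _).naturality φ
  comm₂₃ := (NatTrans.mapHomologicalComplex S.g _).naturality φ

variable {S} (hS : ∀ (P : C) [Projective P], (S.map ((evaluation C D).obj P)).ShortExact)

include hS

lemma mapChainComplex_shortExact {X : C} (P : ProjectiveResolution X) :
    (S.mapChainComplex P.complex).ShortExact :=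
  HomologicalComplex.shortExact_of_degreewise_shortExact _ fun i => hS (P.complex.X i)

variable [HasProjectiveResolutions C]

/-- The connecting morphism of left derived functors attached to a short complex of functors
that is short exact on projective objects. -/
def leftDerivedδ (n : ℕ) : S.X₃.leftDerived (n + 1) ⟶ S.X₁.leftDerived n where
  app X := ((projectiveResolution X).isoLeftDerivedHomology S.X₃ (n + 1)).hom ≫
    (mapChainComplex_shortExact hS (projectiveResolution X)).δ (n + 1) n rfl ≫
      ((projectiveResolution X).isoLeftDerivedHomology S.X₁ n).inv
  naturality X Y f := by
    let φ := ProjectiveResolution.lift f (projectiveResolution X) (projectiveResolution Y)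
    have comm : φ.f 0 ≫ (projectiveResolution Y).π.f 0 =
      (projectiveResolution X).π.f 0 ≫ f := ProjectiveResolution.lift_commutes_zero f _ _
    have h := HomologicalComplex.HomologySequence.δ_naturality (S.mapChainComplexMap φ)
      (mapChainComplex_shortExact hS (projectiveResolution X))
      (mapChainComplex_shortExact hS (projectiveResolution Y)) (n + 1) n rfl
    rw [← Category.assoc,
      ProjectiveResolution.isoLeftDerivedHomology_hom_naturality f _ _ φ comm, Category.assoc]
    simp only [Category.assoc]
    rw [ProjectiveResolution.isoLeftDerivedHomology_inv_naturality f _ _ φ comm,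
      reassoc_of% h]

lemma leftDerived_exact₂ (n : ℕ) (X : C) :
    ∃ w, (ShortComplex.mk ((NatTrans.leftDerived S.f n).app X)
      ((NatTrans.leftDerived S.g n).app X) w).Exact := by
  let P := projectiveResolution X
  exact exact_mk_of_iso _ ((mapChainComplex_shortExact hS P).homology_exact₂ n)
    (P.isoLeftDerivedHomology S.X₁ n).symm (P.isoLeftDerivedHomology S.X₂ n).symm
    (P.isoLeftDerivedHomology S.X₃ n).symm _ _ (P.isoLeftDerivedHomology_inv_app _ _)
    (P.isoLeftDerivedHomology_inv_app _ _)

lemma leftDerived_exact₃ (n : ℕ) (X : C) :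
    ∃ w, (ShortComplex.mk ((NatTrans.leftDerived S.g (n + 1)).app X)
      ((leftDerivedδ hS n).app X) w).Exact := by
  let P := projectiveResolution X
  exact exact_mk_of_iso _ ((mapChainComplex_shortExact hS P).homology_exact₃ (n + 1) n rfl)
    (P.isoLeftDerivedHomology S.X₂ (n + 1)).symm
    (P.isoLeftDerivedHomology S.X₃ (n + 1)).symm (P.isoLeftDerivedHomology S.X₁ n).symm
    _ _ (P.isoLeftDerivedHomology_inv_app _ _) (Iso.inv_hom_id_assoc _ _)

lemma leftDerived_exact₁ (n : ℕ) (X : C) :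
    ∃ w, (ShortComplex.mk ((leftDerivedδ hS n).app X)
      ((NatTrans.leftDerived S.f n).app X) w).Exact := by
  let P := projectiveResolution X
  exact exact_mk_of_iso _ ((mapChainComplex_shortExact hS P).homology_exact₁ (n + 1) n rfl)
    (P.isoLeftDerivedHomology S.X₃ (n + 1)).symm
    (P.isoLeftDerivedHomology S.X₁ n).symm (P.isoLeftDerivedHomology S.X₂ n).symm
    _ _ (Iso.inv_hom_id_assoc _ _) (P.isoLeftDerivedHomology_inv_app _ _)

end CategoryTheory.ShortComplex

namespace CategoryTheory

open Limits

section

variable {C D : Type*} [Category* C] [Category* D] [Abelian C] [HasProjectiveResolutions C]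
  [Abelian D]

lemma Functor.isZero_leftDerived_succ_of_preservesHomology (F : C ⥤ D) [F.Additive]
    [F.PreservesHomology] (n : ℕ) (X : C) : IsZero ((F.leftDerived (n + 1)).obj X) := by
  let P := projectiveResolution X
  refine IsZero.of_iso ?_ (P.isoLeftDerivedHomology F (n + 1))
  rw [← HomologicalComplex.exactAt_iff_isZero_homology]
  exact (P.complex_exactAt_succ n).map F

lemma NatTrans.leftDerived_app_fromLeftDerivedZero {F G : C ⥤ D} [F.Additive] [G.Additive]
    (α : F ⟶ G) (X : C) : (NatTrans.leftDerived α 0).app X ≫ G.fromLeftDerivedZero.app X =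
      F.fromLeftDerivedZero.app X ≫ α.app X := by
  let P := projectiveResolution X
  have h (F : C ⥤ D) [F.Additive] : (P.isoLeftDerivedHomology F 0).inv ≫
      F.fromLeftDerivedZero.app X = HomologicalComplex.homologyι _ 0 ≫
        P.fromLeftDerivedZero' F :=
    (Iso.inv_comp_eq _).2 (P.fromLeftDerivedZero_eq F)
  have h' : HomologicalComplex.opcyclesMap ((NatTrans.mapHomologicalComplex α _).app P.complex) 0
      ≫ P.fromLeftDerivedZero' G = P.fromLeftDerivedZero' F ≫ α.app X := by
    rw [← cancel_epi (HomologicalComplex.pOpcycles _ _),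
      HomologicalComplex.p_opcyclesMap_assoc,
      ProjectiveResolution.pOpcycles_comp_fromLeftDerivedZero',
      ProjectiveResolution.pOpcycles_comp_fromLeftDerivedZero'_assoc]
    exact (α.naturality _).symm
  rw [← cancel_epi (P.isoLeftDerivedHomology F 0).inv,
    reassoc_of% P.isoLeftDerivedHomology_inv_app α 0, h G, reassoc_of% h F,
    HomologicalComplex.homologyι_naturality_assoc, h']

end

end CategoryTheory

namespace ModuleCat

open Opposite Limits

variable {R : Type} [CommRing R]

/-- The contravariant functor `Hom(-, Y)`, viewed as a functor to the opposite category. -/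
abbrev homTo (Y : ModuleCat.{0} R) : ModuleCat.{0} R ⥤ (ModuleCat.{0} R)ᵒᵖ :=
  ((linearYoneda R (ModuleCat.{0} R)).obj Y).rightOp

/-- The short complex `Hom(-, X₃) ⟶ Hom(-, X₂) ⟶ Hom(-, X₁)` in the opposite category. -/
abbrev homToShortComplex (S : ShortComplex (ModuleCat.{0} R)) :
    ShortComplex (ModuleCat.{0} R ⥤ (ModuleCat.{0} R)ᵒᵖ) where
  X₁ := homTo S.X₃
  X₂ := homTo S.X₂
  X₃ := homTo S.X₁
  f := NatTrans.rightOp ((linearYoneda R (ModuleCat.{0} R)).map S.g)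
  g := NatTrans.rightOp ((linearYoneda R (ModuleCat.{0} R)).map S.f)
  zero := by
    ext X
    apply Quiver.Hom.unop_inj
    refine ModuleCat.hom_ext (LinearMap.ext fun (φ : X ⟶ S.X₁) => ?_)
    exact (Category.assoc φ S.f S.g).trans (by rw [S.zero, comp_zero]; rfl)

lemma homToShortComplex_shortExact {S : ShortComplex (ModuleCat.{0} R)} (hS : S.ShortExact)
    (P : ModuleCat.{0} R) [Projective P] :
    ((homToShortComplex S).map ((evaluation _ _).obj P)).ShortExact := by
  let T : ShortComplex (ModuleCat.{0} R) :=
    ShortComplex.mk (((linearYoneda R (ModuleCat.{0} R)).map S.f).app (op P))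
      (((linearYoneda R (ModuleCat.{0} R)).map S.g).app (op P))
      (congrArg Quiver.Hom.unop (congr_app (homToShortComplex S).zero P))
  have := hS.mono_f
  have := hS.epi_g
  have hT : T.ShortExact :=
    { exact := (ShortComplex.ShortExact.moduleCat_exact_iff_function_exact _).2
        fun (φ : P ⟶ S.X₂) => ⟨fun (h : φ ≫ S.g = 0) =>
          ⟨hS.fIsKernel.lift (KernelFork.ofι φ h), hS.fIsKernel.fac _ WalkingParallelPair.zero⟩, by
          rintro ⟨ψ : P ⟶ S.X₁, rfl⟩
          exact (Category.assoc ψ S.f S.g).trans (by rw [S.zero, comp_zero]; rfl)⟩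
      mono_f := (ModuleCat.mono_iff_injective _).2
        fun (φ ψ : P ⟶ S.X₁) (h : φ ≫ S.f = ψ ≫ S.f) => (cancel_mono S.f).1 h
      epi_g := (ModuleCat.epi_iff_surjective _).2
        fun (φ : P ⟶ S.X₃) => ⟨Projective.factorThru φ S.g, Projective.factorThru_comp φ S.g⟩ }
  exact hT.op

instance (Y : ModuleCat.{0} R) : PreservesFiniteColimits (homTo Y) := by
  have : PreservesLimits ((linearYoneda R (ModuleCat.{0} R)).obj Y ⋙
      forget₂ (ModuleCat.{0} R) AddCommGrpCat.{0}) :=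
    inferInstanceAs (PreservesLimits (preadditiveYoneda.obj Y))
  have : PreservesLimits ((linearYoneda R (ModuleCat.{0} R)).obj Y) :=
    preservesLimits_of_reflects_of_preserves _ (forget₂ (ModuleCat.{0} R) AddCommGrpCat.{0})
  exact preservesFiniteColimits_rightOp _

instance (Y : ModuleCat.{0} R) [Injective Y] : (homTo Y).PreservesHomology := by
  have : PreservesFiniteColimits ((linearYoneda R (ModuleCat.{0} R)).obj Y ⋙
      forget₂ (ModuleCat.{0} R) AddCommGrpCat.{0}) :=
    inferInstanceAs (PreservesFiniteColimits (preadditiveYonedaObj Y ⋙ forget₂ _ _))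
  have : PreservesFiniteColimits ((linearYoneda R (ModuleCat.{0} R)).obj Y) :=
    ⟨fun J _ _ => preservesColimitsOfShape_of_reflects_of_preserves _
      (forget₂ (ModuleCat.{0} R) AddCommGrpCat.{0})⟩
  have := preservesFiniteLimits_rightOp ((linearYoneda R (ModuleCat.{0} R)).obj Y)
  infer_instance

/-- The connecting morphism for `Ext` in the second variable, natural in the first variable. -/
def extδ {S : ShortComplex (ModuleCat.{0} R)} (hS : S.ShortExact) (n : ℕ) :
    (Ext R (ModuleCat.{0} R) n).flip.obj S.X₃ ⟶ (Ext R (ModuleCat.{0} R) (n + 1)).flip.obj S.X₁ :=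
  NatTrans.leftOp (ShortComplex.leftDerivedδ (homToShortComplex_shortExact hS) n)

lemma ext_exact₂ {S : ShortComplex (ModuleCat.{0} R)} (hS : S.ShortExact) (n : ℕ)
    (X : (ModuleCat.{0} R)ᵒᵖ) :
    Function.Exact ((((Ext R (ModuleCat.{0} R) n).flip.map S.f).app X).hom)
      (((Ext R (ModuleCat.{0} R) n).flip.map S.g).app X).hom := by
  obtain ⟨w, h⟩ := ShortComplex.leftDerived_exact₂ (homToShortComplex_shortExact hS) n X.unop
  exact (ShortComplex.ShortExact.moduleCat_exact_iff_function_exact _).1 h.unop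

lemma ext_exact₃ {S : ShortComplex (ModuleCat.{0} R)} (hS : S.ShortExact) (n : ℕ)
    (X : (ModuleCat.{0} R)ᵒᵖ) :
    Function.Exact ((((Ext R (ModuleCat.{0} R) n).flip.map S.g).app X).hom)
      ((extδ hS n).app X).hom := by
  obtain ⟨w, h⟩ := ShortComplex.leftDerived_exact₁ (homToShortComplex_shortExact hS) n X.unop
  exact (ShortComplex.ShortExact.moduleCat_exact_iff_function_exact _).1 h.unop

lemma ext_exact₁ {S : ShortComplex (ModuleCat.{0} R)} (hS : S.ShortExact) (n : ℕ)
    (X : (ModuleCat.{0} R)ᵒᵖ) :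
    Function.Exact ((extδ hS n).app X).hom
      ((((Ext R (ModuleCat.{0} R) (n + 1)).flip.map S.f).app X).hom) := by
  obtain ⟨w, h⟩ := ShortComplex.leftDerived_exact₃ (homToShortComplex_shortExact hS) n X.unop
  exact (ShortComplex.ShortExact.moduleCat_exact_iff_function_exact _).1 h.unop

lemma isZero_ext_succ_of_injective (X : (ModuleCat.{0} R)ᵒᵖ) (Y : ModuleCat.{0} R) [Injective Y]
    (n : ℕ) : IsZero (((Ext R (ModuleCat.{0} R) (n + 1)).obj X).obj Y) :=
  ((homTo Y).isZero_leftDerived_succ_of_preservesHomology n X.unop).unop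

/-- `Ext⁰` is `Hom`. -/
def extZeroIso (Y : ModuleCat.{0} R) :
    (linearYoneda R (ModuleCat.{0} R)).obj Y ≅ (Ext R (ModuleCat.{0} R) 0).flip.obj Y :=
  NatIso.ofComponents (fun X => ((homTo Y).leftDerivedZeroIsoSelf.app X.unop).unop)
    fun f => Quiver.Hom.op_inj ((homTo Y).leftDerivedZeroIsoSelf.hom.naturality f.unop).symm

lemma extZeroIso_naturality {Y Y' : ModuleCat.{0} R} (f : Y ⟶ Y') (X : (ModuleCat.{0} R)ᵒᵖ) :
    (extZeroIso Y).hom.app X ≫ ((Ext R (ModuleCat.{0} R) 0).flip.map f).app X =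
      ((linearYoneda R (ModuleCat.{0} R)).map f).app X ≫ (extZeroIso Y').hom.app X :=
  Quiver.Hom.op_inj (NatTrans.leftDerived_app_fromLeftDerivedZero
    (NatTrans.rightOp ((linearYoneda R (ModuleCat.{0} R)).map f)) X.unop)

lemma extZeroIso_inv_naturality {Y Y' : ModuleCat.{0} R} (f : Y ⟶ Y') (X : (ModuleCat.{0} R)ᵒᵖ) :
    ((Ext R (ModuleCat.{0} R) 0).flip.map f).app X ≫ (extZeroIso Y').inv.app X =
      (extZeroIso Y).inv.app X ≫ ((linearYoneda R (ModuleCat.{0} R)).map f).app X := by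
  rw [← cancel_epi ((extZeroIso Y).hom.app X), reassoc_of% extZeroIso_naturality f X,
    Iso.hom_inv_id_app, Iso.hom_inv_id_app_assoc, Category.comp_id]

end ModuleCat

section

open Limits

lemma ModuleCat.exact_of_isColimit {R : Type} [CommRing R] {J : Type} [SmallCategory J]
    [IsFiltered J] {F G H : J ⥤ ModuleCat.{0} R} (α : F ⟶ G) (β : G ⟶ H)
    (h : ∀ j, Function.Exact (α.app j).hom (β.app j).hom)
    {cF : Cocone F} {cG : Cocone G} {cH : Cocone H} (hF : IsColimit cF) (hG : IsColimit cG)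
    (hH : IsColimit cH) (u : cF.pt ⟶ cG.pt) (v : cG.pt ⟶ cH.pt)
    (hu : ∀ j, cF.ι.app j ≫ u = α.app j ≫ cG.ι.app j)
    (hv : ∀ j, cG.ι.app j ≫ v = β.app j ≫ cH.ι.app j) :
    Function.Exact u.hom v.hom := by
  have hu' (j) (x : F.obj j) : u.hom ((cF.ι.app j).hom x) = (cG.ι.app j).hom ((α.app j).hom x) :=
    DFunLike.congr_fun (congrArg ModuleCat.Hom.hom (hu j)) x
  have hv' (j) (x : G.obj j) : v.hom ((cG.ι.app j).hom x) = (cH.ι.app j).hom ((β.app j).hom x) :=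
    DFunLike.congr_fun (congrArg ModuleCat.Hom.hom (hv j)) x
  intro y
  constructor
  · intro hy
    obtain ⟨j, y, rfl⟩ := Concrete.isColimit_exists_rep G hG y
    obtain ⟨k, f, g, hk⟩ := Concrete.isColimit_exists_of_rep_eq H hH ((β.app j).hom y) 0
      (((hv' j y).symm.trans hy).trans (map_zero (cH.ι.app j).hom).symm)
    have h0 : (β.app k).hom ((G.map f).hom y) = 0 := by
      have := DFunLike.congr_fun (congrArg ModuleCat.Hom.hom (β.naturality f)) y
      exact this.trans (hk.trans (map_zero (H.map g).hom))
    obtain ⟨x, hx⟩ := (h k _).1 h0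
    refine ⟨(cF.ι.app k).hom x, ?_⟩
    rw [hu', hx]
    exact DFunLike.congr_fun (congrArg ModuleCat.Hom.hom (cG.w f)) y
  · rintro ⟨x, rfl⟩
    obtain ⟨j, x, rfl⟩ := Concrete.isColimit_exists_rep F hF x
    change v.hom (u.hom ((cF.ι.app j).hom x)) = 0
    rw [hu', hv', (h j _).2 ⟨x, rfl⟩, map_zero]

end

namespace localCohomology

open Limits Opposite

variable {R : Type} [CommRing R] (a : Ideal R)

/-- The direct system of the modules `Extⁱ(R / aᵏ, M)`. -/
abbrev extSystem (i : ℕ) (M : ModuleCat.{0} R) : (ℕᵒᵖ)ᵒᵖ ⥤ ModuleCat.{0} R :=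
  (ringModIdeals (idealPowersDiagram a)).op ⋙ (Ext R (ModuleCat.{0} R) i).flip.obj M

/-- Local cohomology as a cocone over `Extⁱ(R / aᵏ, M)`. -/
def extCocone (i : ℕ) (M : ModuleCat.{0} R) : Cocone (extSystem a i M) where
  pt := (localCohomology a i).obj M
  ι :=
    { app k := (colimit.ι (diagram (idealPowersDiagram a) i) k).app M
      naturality _ _ f := (congr_app (colimit.w (diagram (idealPowersDiagram a) i) f) M).trans
        (Category.comp_id _).symm }

/-- `extCocone` is a colimit cocone. -/
def isColimitExtCocone (i : ℕ) (M : ModuleCat.{0} R) : IsColimit (extCocone a i M) :=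
  isColimitOfPreserves ((evaluation _ _).obj M)
    (colimit.isColimit (diagram (idealPowersDiagram a) i))

lemma extCocone_naturality (i : ℕ) {M N : ModuleCat.{0} R} (f : M ⟶ N) (k : (ℕᵒᵖ)ᵒᵖ) :
    (extCocone a i M).ι.app k ≫ (localCohomology a i).map f =
      (Functor.whiskerLeft (ringModIdeals (idealPowersDiagram a)).op
        ((Ext R (ModuleCat.{0} R) i).flip.map f)).app k ≫ (extCocone a i N).ι.app k :=
  ((colimit.ι (diagram (idealPowersDiagram a) i) k).naturality f).symm

variable {S : ShortComplex (ModuleCat.{0} R)} (hS : S.ShortExact)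

/-- The connecting morphism of local cohomology. -/
def δ (i : ℕ) : (localCohomology a i).obj S.X₃ ⟶ (localCohomology a (i + 1)).obj S.X₁ :=
  (isColimitExtCocone a i S.X₃).desc ((Cocone.precompose
    (Functor.whiskerLeft (ringModIdeals (idealPowersDiagram a)).op (ModuleCat.extδ hS i))).obj
      (extCocone a (i + 1) S.X₁))

lemma ι_δ (i : ℕ) (k : (ℕᵒᵖ)ᵒᵖ) : (extCocone a i S.X₃).ι.app k ≫ δ a hS i =
    (Functor.whiskerLeft (ringModIdeals (idealPowersDiagram a)).op (ModuleCat.extδ hS i)).app k ≫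
      (extCocone a (i + 1) S.X₁).ι.app k :=
  (isColimitExtCocone a i S.X₃).fac _ k

include hS in
lemma exact₂ (i : ℕ) : Function.Exact ((localCohomology a i).map S.f).hom
    ((localCohomology a i).map S.g).hom :=
  ModuleCat.exact_of_isColimit _ _ (fun _ => ModuleCat.ext_exact₂ hS i _)
    (isColimitExtCocone a i _) (isColimitExtCocone a i _) (isColimitExtCocone a i _)
    _ _ (extCocone_naturality a i S.f) (extCocone_naturality a i S.g)

lemma exact₃ (i : ℕ) : Function.Exact ((localCohomology a i).map S.g).hom (δ a hS i).hom :=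
  ModuleCat.exact_of_isColimit _ _ (fun _ => ModuleCat.ext_exact₃ hS i _)
    (isColimitExtCocone a i _) (isColimitExtCocone a i _) (isColimitExtCocone a (i + 1) _)
    _ _ (extCocone_naturality a i S.g) (ι_δ a hS i)

lemma exact₁ (i : ℕ) :
    Function.Exact (δ a hS i).hom ((localCohomology a (i + 1)).map S.f).hom :=
  ModuleCat.exact_of_isColimit _ _ (fun _ => ModuleCat.ext_exact₁ hS i _)
    (isColimitExtCocone a i _) (isColimitExtCocone a (i + 1) _) (isColimitExtCocone a (i + 1) _)
    _ _ (ι_δ a hS i) (extCocone_naturality a (i + 1) S.f)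

lemma subsingleton_of_injective (M : ModuleCat.{0} R) [Injective M] (i : ℕ) :
    Subsingleton ((localCohomology a (i + 1)).obj M) := by
  refine subsingleton_of_forall_eq 0 fun x => ?_
  obtain ⟨k, x, rfl⟩ := Concrete.isColimit_exists_rep _ (isColimitExtCocone a (i + 1) M) x
  have h : x = 0 := (ModuleCat.subsingleton_of_isZero
    (ModuleCat.isZero_ext_succ_of_injective
      ((ringModIdeals (idealPowersDiagram a)).op.obj k) M i)).elim x 0
  rw [h]
  exact map_zero ((extCocone a (i + 1) M).ι.app k).hom

/-- The evaluation at `1`, from `Ext⁰(R / aᵏ, M)` to `M`. -/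
def extZeroEval (M : ModuleCat.{0} R) (k : (ℕᵒᵖ)ᵒᵖ) : (extSystem a 0 M).obj k ⟶ M :=
  (ModuleCat.extZeroIso M).inv.app _ ≫
    ModuleCat.ofHom (Y := M)
      { toFun := fun φ : (ringModIdeals (idealPowersDiagram a)).obj k.unop ⟶ M =>
          φ.hom (1 : R ⧸ _)
        map_add' := fun _ _ => rfl
        map_smul' := fun _ _ => rfl }

lemma extZeroEval_injective (M : ModuleCat.{0} R) (k : (ℕᵒᵖ)ᵒᵖ) :
    Function.Injective (extZeroEval a M k).hom := by
  refine Function.Injective.comp (g := fun φ : (ringModIdeals (idealPowersDiagram a)).obj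
    k.unop ⟶ M => φ.hom (1 : R ⧸ _)) (fun φ ψ h => ModuleCat.hom_ext ?_)
    ((ModuleCat.mono_iff_injective ((ModuleCat.extZeroIso M).inv.app _)).1 inferInstance)
  exact Submodule.linearMap_qext _ (LinearMap.ext_ring h)

lemma exists_extZeroEval_eq_iff (M : ModuleCat.{0} R) (k : ℕ) (x : M) :
    (∃ y, (extZeroEval a M (op (op k))).hom y = x) ↔ ∀ r ∈ a ^ k, r • x = 0 := by
  constructor
  · rintro ⟨y, rfl⟩ r hr
    set φ : (ringModIdeals (idealPowersDiagram a)).obj (op k) ⟶ M :=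
      ((ModuleCat.extZeroIso M).inv.app _).hom y
    change r • φ.hom (1 : R ⧸ a ^ k) = 0
    refine (map_smul φ.hom r _).symm.trans ?_
    have h : r • (1 : R ⧸ a ^ k) = 0 := by
      rw [Algebra.smul_def, mul_one]
      exact Ideal.Quotient.eq_zero_iff_mem.2 hr
    exact (congrArg φ.hom h).trans (map_zero φ.hom)
  · intro h
    let φ : (ringModIdeals (idealPowersDiagram a)).obj (op k) ⟶ M :=
      ModuleCat.ofHom ((a ^ k).liftQ (LinearMap.toSpanSingleton R M x)
        fun r hr => h r hr)
    refine ⟨((ModuleCat.extZeroIso M).hom.app _).hom φ, ?_⟩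
    have : ((ModuleCat.extZeroIso M).inv.app _).hom (((ModuleCat.extZeroIso M).hom.app _).hom φ) =
      φ := DFunLike.congr_fun (congrArg ModuleCat.Hom.hom
        ((ModuleCat.extZeroIso M).hom_inv_id_app
          (op ((ringModIdeals (idealPowersDiagram a)).obj (op k))))) φ
    refine (congrArg (fun ψ : (ringModIdeals (idealPowersDiagram a)).obj (op k) ⟶ M =>
      ψ.hom (1 : R ⧸ a ^ k)) this).trans ?_
    exact one_smul R x

lemma map_comp_extZeroEval (M : ModuleCat.{0} R) {k l : (ℕᵒᵖ)ᵒᵖ} (f : k ⟶ l) :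
    (extSystem a 0 M).map f ≫ extZeroEval a M l = extZeroEval a M k := by
  dsimp only [extZeroEval]
  have h := (ModuleCat.extZeroIso M).inv.naturality
    ((ringModIdeals (idealPowersDiagram a)).op.map f)
  refine (Category.assoc _ _ _).symm.trans ((congrArg (· ≫ _) h).trans ?_)
  rfl

lemma extZeroEval_naturality {M N : ModuleCat.{0} R} (f : M ⟶ N) (k : (ℕᵒᵖ)ᵒᵖ) :
    (Functor.whiskerLeft (ringModIdeals (idealPowersDiagram a)).op
        ((Ext R (ModuleCat.{0} R) 0).flip.map f)).app k ≫ extZeroEval a N k =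
      extZeroEval a M k ≫ f := by
  dsimp only [extZeroEval]
  have h := ModuleCat.extZeroIso_inv_naturality f
    ((ringModIdeals (idealPowersDiagram a)).op.obj k)
  exact (Category.assoc _ _ _).symm.trans (congrArg (· ≫ _) h)

/-- The canonical map from `H⁰ₐ(M)` to `M`. -/
def zeroEval (M : ModuleCat.{0} R) : (localCohomology a 0).obj M ⟶ M :=
  (isColimitExtCocone a 0 M).desc
    { pt := M
      ι :=
        { app := extZeroEval a M
          naturality _ _ f := (map_comp_extZeroEval a M f).trans (Category.comp_id _).symm } }

lemma ι_zeroEval (M : ModuleCat.{0} R) (k : (ℕᵒᵖ)ᵒᵖ) :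
    (extCocone a 0 M).ι.app k ≫ zeroEval a M = extZeroEval a M k :=
  (isColimitExtCocone a 0 M).fac _ k

lemma ι_zeroEval_apply (M : ModuleCat.{0} R) (k : (ℕᵒᵖ)ᵒᵖ) (x) :
    (zeroEval a M).hom (((extCocone a 0 M).ι.app k).hom x) = (extZeroEval a M k).hom x :=
  DFunLike.congr_fun (congrArg ModuleCat.Hom.hom (ι_zeroEval a M k)) x

lemma zeroEval_naturality {M N : ModuleCat.{0} R} (f : M ⟶ N) :
    (localCohomology a 0).map f ≫ zeroEval a N = zeroEval a M ≫ f := by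
  refine (isColimitExtCocone a 0 M).hom_ext fun k => ?_
  calc (extCocone a 0 M).ι.app k ≫ (localCohomology a 0).map f ≫ zeroEval a N
      = _ ≫ (extCocone a 0 N).ι.app k ≫ zeroEval a N :=
        (Category.assoc _ _ _).symm.trans ((congrArg (· ≫ zeroEval a N)
          (extCocone_naturality a 0 f k)).trans (Category.assoc _ _ _))
    _ = _ ≫ extZeroEval a N k := congrArg (_ ≫ ·) (ι_zeroEval a N k)
    _ = extZeroEval a M k ≫ f := extZeroEval_naturality a f k
    _ = ((extCocone a 0 M).ι.app k ≫ zeroEval a M) ≫ f :=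
      congrArg (· ≫ f) (ι_zeroEval a M k).symm
    _ = _ := Category.assoc _ _ _

lemma zeroEval_injective (M : ModuleCat.{0} R) : Function.Injective (zeroEval a M).hom := by
  refine (injective_iff_map_eq_zero _).2 fun x hx => ?_
  obtain ⟨k, x, rfl⟩ := Concrete.isColimit_exists_rep _ (isColimitExtCocone a 0 M) x
  have h : x = 0 := extZeroEval_injective a M k
    ((ι_zeroEval_apply a M k x).symm.trans (hx.trans (map_zero _).symm))
  rw [h]
  exact map_zero ((extCocone a 0 M).ι.app k).hom

lemma exists_zeroEval_eq_iff (M : ModuleCat.{0} R) (x : M) :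
    (∃ y, (zeroEval a M).hom y = x) ↔ ∃ k, ∀ r ∈ a ^ k, r • x = 0 := by
  constructor
  · rintro ⟨y, rfl⟩
    obtain ⟨k, y, rfl⟩ := Concrete.isColimit_exists_rep _ (isColimitExtCocone a 0 M) y
    exact ⟨k.unop.unop, (exists_extZeroEval_eq_iff a M _ _).1 ⟨y, (ι_zeroEval_apply a M k y).symm⟩⟩
  · rintro ⟨k, h⟩
    obtain ⟨y, hy⟩ := (exists_extZeroEval_eq_iff a M k x).2 h
    exact ⟨_, (ι_zeroEval_apply a M _ y).trans hy⟩

end localCohomology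

section

variable {R : Type} [CommRing R]

/-- A sequence of functors with long exact sequences that vanish in positive degrees on injective
modules. -/
structure IsCohomological (T : ℕ → ModuleCat.{0} R ⥤ ModuleCat.{0} R) : Prop where
  exact {S : ShortComplex (ModuleCat.{0} R)} (hS : S.ShortExact) (i : ℕ) :
    Function.Exact ((T i).map S.f).hom ((T i).map S.g).hom
  exists_connecting {S : ShortComplex (ModuleCat.{0} R)} (hS : S.ShortExact) (i : ℕ) :
    ∃ δ : (T i).obj S.X₃ →ₗ[R] (T (i + 1)).obj S.X₁,
      Function.Exact ((T i).map S.g).hom δ ∧ Function.Exact δ ((T (i + 1)).map S.f).hom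
  subsingleton_of_injective (M : ModuleCat.{0} R) [Injective M] (i : ℕ) :
    Subsingleton ((T (i + 1)).obj M)

lemma isCohomological_localCohomology (a : Ideal R) :
    IsCohomological (fun i => localCohomology a i) where
  exact hS i := localCohomology.exact₂ a hS i
  exists_connecting hS i := ⟨(localCohomology.δ a hS i).hom, localCohomology.exact₃ a hS i,
    localCohomology.exact₁ a hS i⟩
  subsingleton_of_injective M _ i := localCohomology.subsingleton_of_injective a M i

lemma isCohomological_ext (X : (ModuleCat.{0} R)ᵒᵖ) :
    IsCohomological (fun i => (Ext R (ModuleCat.{0} R) i).obj X) where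
  exact hS i := ModuleCat.ext_exact₂ hS i X
  exists_connecting hS i := ⟨((ModuleCat.extδ hS i).app X).hom, ModuleCat.ext_exact₃ hS i X,
    ModuleCat.ext_exact₁ hS i X⟩
  subsingleton_of_injective M _ i :=
    ModuleCat.subsingleton_of_isZero (ModuleCat.isZero_ext_succ_of_injective X M i)

namespace IsCohomological

variable {T : ℕ → ModuleCat.{0} R ⥤ ModuleCat.{0} R} (hT : IsCohomological T)

variable {M E L : Type} [AddCommGroup M] [Module R M] [AddCommGroup E] [Module R E]
  [AddCommGroup L] [Module R L]

/-- The map induced by a linear map. -/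
abbrev map (_ : IsCohomological T) (i : ℕ) (f : M →ₗ[R] E) :
    (T i).obj (ModuleCat.of R M) →ₗ[R] (T i).obj (ModuleCat.of R E) :=
  ((T i).map (ModuleCat.ofHom f)).hom

/-- The isomorphism induced by a linear equivalence. -/
def mapEquiv (_ : IsCohomological T) (i : ℕ) (e : M ≃ₗ[R] E) :
    (T i).obj (ModuleCat.of R M) ≃ₗ[R] (T i).obj (ModuleCat.of R E) :=
  ((T i).mapIso e.toModuleIso).toLinearEquiv

lemma _root_.shortExact_moduleCatMk {f : M →ₗ[R] E} {g : E →ₗ[R] L}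
    (hf : Function.Injective f) (hfg : Function.Exact f g) (hg : Function.Surjective g) :
    (ShortComplex.mk (ModuleCat.ofHom f) (ModuleCat.ofHom g)
      (ModuleCat.hom_ext hfg.linearMap_comp_eq_zero)).ShortExact where
  exact := (ShortComplex.ShortExact.moduleCat_exact_iff_function_exact _).2 hfg
  mono_f := (ModuleCat.mono_iff_injective _).2 hf
  epi_g := (ModuleCat.epi_iff_surjective _).2 hg

include hT

lemma exact_map {f : M →ₗ[R] E} {g : E →ₗ[R] L} (hf : Function.Injective f)
    (hfg : Function.Exact f g) (hg : Function.Surjective g) (i : ℕ) :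
    Function.Exact (hT.map i f) (hT.map i g) :=
  hT.exact (shortExact_moduleCatMk hf hfg hg) i

lemma exists_connecting_map {f : M →ₗ[R] E} {g : E →ₗ[R] L} (hf : Function.Injective f)
    (hfg : Function.Exact f g) (hg : Function.Surjective g) (i : ℕ) :
    ∃ δ : (T i).obj (ModuleCat.of R L) →ₗ[R] (T (i + 1)).obj (ModuleCat.of R M),
      Function.Exact (hT.map i g) δ ∧ Function.Exact δ (hT.map (i + 1) f) :=
  hT.exists_connecting (shortExact_moduleCatMk hf hfg hg) i

lemma subsingleton_of_moduleInjective [Module.Injective R E] (i : ℕ) :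
    Subsingleton ((T (i + 1)).obj (ModuleCat.of R E)) :=
  have := Module.injective_object_of_injective_module R E
  hT.subsingleton_of_injective _ i

lemma exists_connecting_surjective {f : M →ₗ[R] E} {g : E →ₗ[R] L} (hf : Function.Injective f)
    (hfg : Function.Exact f g) (hg : Function.Surjective g) (i : ℕ)
    (hE : Subsingleton ((T (i + 1)).obj (ModuleCat.of R E))) :
    ∃ δ : (T i).obj (ModuleCat.of R L) →ₗ[R] (T (i + 1)).obj (ModuleCat.of R M),
      Function.Exact (hT.map i g) δ ∧ Function.Surjective δ := by
  obtain ⟨δ, h, h'⟩ := hT.exists_connecting_map hf hfg hg i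
  exact ⟨δ, h, fun y => (h' y).1 (hE.elim _ _)⟩

lemma nonempty_equiv {f : M →ₗ[R] E} {g : E →ₗ[R] L} (hf : Function.Injective f)
    (hfg : Function.Exact f g) (hg : Function.Surjective g) (i : ℕ)
    (hE : Subsingleton ((T i).obj (ModuleCat.of R E)))
    (hE' : Subsingleton ((T (i + 1)).obj (ModuleCat.of R E))) :
    Nonempty ((T i).obj (ModuleCat.of R L) ≃ₗ[R] (T (i + 1)).obj (ModuleCat.of R M)) := by
  obtain ⟨δ, h, h'⟩ := hT.exists_connecting_surjective hf hfg hg i hE'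
  refine ⟨LinearEquiv.ofBijective δ ⟨(injective_iff_map_eq_zero _).2 fun x hx => ?_, h'⟩⟩
  obtain ⟨y, rfl⟩ := (h x).1 hx
  rw [hE.elim y 0, map_zero]

end IsCohomological

variable (R) in
lemma Module.exists_injective_embedding (M : Type) [AddCommGroup M] [Module R M] :
    ∃ (E : Type) (_ : AddCommGroup E) (_ : Module R E) (f : M →ₗ[R] E),
      Module.Injective R E ∧ Function.Injective f := by
  let E := Injective.under (ModuleCat.of R M)
  refine ⟨E, inferInstance, inferInstance, (Injective.ι (ModuleCat.of R M)).hom, ?_,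
    (ModuleCat.mono_iff_injective _).1 inferInstance⟩
  exact (Module.injective_iff_injective_object R E).2 (inferInstanceAs (CategoryTheory.Injective E))

/-- The submodule of elements annihilated by a power of `a`. -/
def Ideal.torsion (a : Ideal R) (M : Type) [AddCommGroup M] [Module R M] : Submodule R M where
  carrier := {x | ∃ k, ∀ r ∈ a ^ k, r • x = 0}
  zero_mem' := ⟨0, fun r _ => smul_zero r⟩
  add_mem' := by
    rintro x y ⟨k, hk⟩ ⟨l, hl⟩
    refine ⟨max k l, fun r hr => ?_⟩
    rw [smul_add, hk r (Ideal.pow_le_pow_right (le_max_left k l) hr),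
      hl r (Ideal.pow_le_pow_right (le_max_right k l) hr), add_zero]
  smul_mem' := by
    rintro s x ⟨k, hk⟩
    exact ⟨k, fun r hr => by rw [smul_comm, hk r hr, smul_zero]⟩

variable (a : Ideal R) {M N E L : Type} [AddCommGroup M] [Module R M]
  [AddCommGroup N] [Module R N] [AddCommGroup E] [Module R E] [AddCommGroup L] [Module R L]

/-- The restriction of a linear map to `a`-torsion. -/
def Ideal.torsionMap (f : M →ₗ[R] N) : a.torsion M →ₗ[R] a.torsion N :=
  f.restrict fun x ⟨k, hk⟩ => ⟨k, fun r hr => by rw [← map_smul, hk r hr, map_zero]⟩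

variable (M) in
/-- Local cohomology in degree zero is torsion. -/
def localCohomology.zeroEquiv :
    (localCohomology a 0).obj (ModuleCat.of R M) ≃ₗ[R] a.torsion M :=
  LinearEquiv.ofBijective
    ((localCohomology.zeroEval a (ModuleCat.of R M)).hom.codRestrict (a.torsion M)
      fun y => (localCohomology.exists_zeroEval_eq_iff a _ _).1 ⟨y, rfl⟩)
    ⟨fun _ _ h => localCohomology.zeroEval_injective a _ (congrArg Subtype.val h),
      fun ⟨x, hx⟩ => ((localCohomology.exists_zeroEval_eq_iff a (ModuleCat.of R M) x).2 hx).imp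
        fun _ hy => Subtype.ext hy⟩

lemma localCohomology.zeroEquiv_naturality (f : M →ₗ[R] N) (x) :
    localCohomology.zeroEquiv a N (((localCohomology a 0).map (ModuleCat.ofHom f)).hom x) =
      a.torsionMap f (localCohomology.zeroEquiv a M x) :=
  Subtype.ext (DFunLike.congr_fun (congrArg ModuleCat.Hom.hom
    (localCohomology.zeroEval_naturality a (ModuleCat.ofHom f))) x)

/-- `Ext` in degree zero is `Hom`. -/
def ModuleCat.extZeroEquiv (X M : Type) [AddCommGroup X] [Module R X] [AddCommGroup M]
    [Module R M] :
    ((Ext R (ModuleCat.{0} R) 0).obj (Opposite.op (ModuleCat.of R X))).obj (ModuleCat.of R M) ≃ₗ[R]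
      (X →ₗ[R] M) :=
  (((ModuleCat.extZeroIso (ModuleCat.of R M)).app
    (Opposite.op (ModuleCat.of R X))).toLinearEquiv).symm ≪≫ₗ
      ModuleCat.homLinearEquiv (S := R)

lemma ModuleCat.extZeroEquiv_naturality (X : Type) [AddCommGroup X] [Module R X]
    (f : M →ₗ[R] N) (x) :
    ModuleCat.extZeroEquiv X N ((((Ext R (ModuleCat.{0} R) 0).obj
      (Opposite.op (ModuleCat.of R X))).map (ModuleCat.ofHom f)).hom x) =
      f ∘ₗ ModuleCat.extZeroEquiv X M x :=
  congrArg ModuleCat.Hom.hom (DFunLike.congr_fun (congrArg ModuleCat.Hom.hom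
    (ModuleCat.extZeroIso_inv_naturality (ModuleCat.ofHom f) (Opposite.op (ModuleCat.of R X)))) x)

end

section

variable {R : Type} [CommRing R] (a : Ideal R) {M N E L : Type} [AddCommGroup M] [Module R M]
  [AddCommGroup N] [Module R N] [AddCommGroup E] [Module R E] [AddCommGroup L] [Module R L]

lemma Submodule.FG.exists_pow_smul_eq_zero {a : Ideal R} {S : Submodule R M} (hS : S.FG)
    (h : S ≤ a.torsion M) : ∃ k, ∀ r ∈ a ^ k, ∀ x ∈ S, r • x = 0 := by
  obtain ⟨s, rfl⟩ := hS
  have h' : ∀ x ∈ s, ∃ k, ∀ r ∈ a ^ k, r • x = 0 := fun x hx => h (Submodule.subset_span hx)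
  choose! k hk using h'
  refine ⟨s.sup k, fun r hr x hx => ?_⟩
  induction hx using Submodule.span_induction with
  | mem x hx => exact hk x hx r (Ideal.pow_le_pow_right (Finset.le_sup (f := k) hx) hr)
  | zero => exact smul_zero r
  | add x y _ _ hx hy => rw [smul_add, hx, hy, add_zero]
  | smul c x _ hx => rw [smul_comm, hx, smul_zero]

variable {a} in
lemma Ideal.torsion_eq_top_of_surjective {f : M →ₗ[R] N} (hf : Function.Surjective f)
    (h : a.torsion M = ⊤) : a.torsion N = ⊤ := by
  refine eq_top_iff.2 fun y _ => ?_
  obtain ⟨x, rfl⟩ := hf y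
  obtain ⟨k, hk⟩ : x ∈ a.torsion M := h ▸ Submodule.mem_top
  exact ⟨k, fun r hr => by rw [← map_smul, hk r hr, map_zero]⟩

variable {a} in
lemma Ideal.torsion_eq_top_of_injective {f : M →ₗ[R] N} (hf : Function.Injective f)
    (h : a.torsion N = ⊤) : a.torsion M = ⊤ := by
  refine eq_top_iff.2 fun x _ => ?_
  obtain ⟨k, hk⟩ : f x ∈ a.torsion N := h ▸ Submodule.mem_top
  exact ⟨k, fun r hr => hf (by rw [map_smul, hk r hr, map_zero])⟩

lemma Ideal.torsion_torsion : a.torsion (a.torsion M) = ⊤ :=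
  eq_top_iff.2 fun ⟨_, k, hk⟩ _ => ⟨k, fun r hr => Subtype.ext (hk r hr)⟩

lemma localCohomology.torsion_eq_top (M : Type) [AddCommGroup M] [Module R M] (i : ℕ) :
    a.torsion ((localCohomology a i).obj (ModuleCat.of R M)) = ⊤ := by
  induction i generalizing M with
  | zero =>
    exact Ideal.torsion_eq_top_of_injective (localCohomology.zeroEquiv a M).injective
      a.torsion_torsion
  | succ i ih =>
    obtain ⟨E, _, _, f, hE, hf⟩ := Module.exists_injective_embedding R M
    have hT := isCohomological_localCohomology a
    obtain ⟨δ, -, hδ⟩ := hT.exists_connecting_surjective hf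
      (LinearMap.exact_map_mkQ_range f) (Submodule.mkQ_surjective _) i
      (hT.subsingleton_of_moduleInjective i)
    exact Ideal.torsion_eq_top_of_surjective hδ (ih _)

variable [IsNoetherianRing R]

variable (M) in
lemma Ideal.torsion_quotient_torsion : a.torsion (M ⧸ a.torsion M) = ⊥ := by
  refine eq_bot_iff.2 fun x hx => ?_
  obtain ⟨x, rfl⟩ := Submodule.mkQ_surjective _ x
  obtain ⟨k, hk⟩ := hx
  have hle : Submodule.map (LinearMap.toSpanSingleton R M x) (a ^ k) ≤ a.torsion M := by
    rintro _ ⟨r, hr, rfl⟩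
    exact (Submodule.Quotient.mk_eq_zero _).1 (hk r hr)
  obtain ⟨l, hl⟩ := (Submodule.FG.map (LinearMap.toSpanSingleton R M x)
    ((isNoetherianRing_iff_ideal_fg R).1 inferInstance (a ^ k))).exists_pow_smul_eq_zero hle
  refine (Submodule.Quotient.mk_eq_zero _).2 ⟨l + k, fun r hr => ?_⟩
  rw [pow_add] at hr
  induction hr using Submodule.mul_induction_on' with
  | mem_mul_mem r hr s hs =>
    rw [mul_smul]
    exact hl r hr _ ⟨s, hs, rfl⟩
  | add r _ s _ hr hs => rw [add_smul, hr, hs, add_zero]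

instance Ideal.injective_torsion [Module.Injective R E] : Module.Injective R (a.torsion E) := by
  refine Module.Baer.injective fun I g => ?_
  have hfg : g.range.FG := by
    rw [LinearMap.range_eq_map]
    exact (Module.Finite.fg_top (R := R) (M := I)).map g
  have hfg' := hfg.map (a.torsion E).subtype
  obtain ⟨k, hk⟩ := hfg'.exists_pow_smul_eq_zero (a := a) (by
    rintro _ ⟨x, -, rfl⟩; exact x.2)
  obtain ⟨c, hc⟩ := a.exists_pow_inf_eq_pow_smul I
  let φ : I →ₗ[R] R ⧸ a ^ (k + c) := (a ^ (k + c)).mkQ ∘ₗ I.subtype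
  have hφ : φ.ker ≤ ((a.torsion E).subtype ∘ₗ g).ker := by
    intro x hx
    have hx' : (x : R) ∈ a ^ (k + c) := (Submodule.Quotient.mk_eq_zero _).1 hx
    have hle : a ^ k • I ≤ ((a.torsion E).subtype ∘ₗ g).ker.map I.subtype :=
      Submodule.smul_le.2 fun r hr s hs => ⟨r • ⟨s, hs⟩, by
        rw [SetLike.mem_coe, LinearMap.mem_ker, map_smul]
        exact hk r hr _ ⟨g ⟨s, hs⟩, ⟨_, rfl⟩, rfl⟩, rfl⟩
    have hmem : (x : R) ∈ a ^ (k + c) • (⊤ : Ideal R) ⊓ I := by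
      rw [smul_eq_mul, Ideal.mul_top]
      exact ⟨hx', x.2⟩
    rw [hc _ (Nat.le_add_left c k), Nat.add_sub_cancel] at hmem
    obtain ⟨y, hy, hyx⟩ := hle (Submodule.smul_mono le_rfl inf_le_right hmem)
    rwa [Subtype.ext hyx] at hy
  obtain ⟨h, hh⟩ := Module.Injective.out (Q := E) (φ.ker.liftQ φ le_rfl)
    (LinearMap.ker_eq_bot.1 (Submodule.ker_liftQ_eq_bot _ _ _ le_rfl)) (φ.ker.liftQ _ hφ)
  refine ⟨((h ∘ₗ (a ^ (k + c)).mkQ).codRestrict (a.torsion E) fun r => ⟨k + c, fun s hs => ?_⟩),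
    fun x hx => Subtype.ext (hh (φ.ker.mkQ ⟨x, hx⟩))⟩
  rw [← map_smul]
  refine (congrArg h ?_).trans h.map_zero
  exact (Submodule.Quotient.mk_eq_zero _).2 (Ideal.mul_mem_right _ _ hs)

omit [IsNoetherianRing R] in
lemma Module.Injective.of_retract [Module.Injective R E] (s : N →ₗ[R] E) (p : E →ₗ[R] N)
    (h : ∀ x, p (s x) = x) : Module.Injective R N where
  out X Y _ _ _ _ f hf g := by
    obtain ⟨k, hk⟩ := Module.Injective.out (Q := E) f hf (s ∘ₗ g)
    exact ⟨p ∘ₗ k, fun x => (congrArg p (hk x)).trans (h _)⟩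

instance Ideal.injective_quotient_torsion [Module.Injective R E] :
    Module.Injective R (E ⧸ a.torsion E) := by
  obtain ⟨ρ, hρ⟩ := Module.Injective.out (Q := a.torsion E) (a.torsion E).subtype
    Subtype.val_injective LinearMap.id
  refine .of_retract ((a.torsion E).liftQ (LinearMap.id - (a.torsion E).subtype ∘ₗ ρ)
    fun x hx => ?_) (a.torsion E).mkQ fun x => ?_
  · exact sub_eq_zero.2 (congrArg Subtype.val (hρ ⟨x, hx⟩)).symm
  · obtain ⟨x, rfl⟩ := Submodule.mkQ_surjective _ x
    refine (Submodule.Quotient.eq _).2 ?_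
    change x - ((ρ x : a.torsion E) : E) - x ∈ a.torsion E
    rw [sub_sub_cancel_left]
    exact neg_mem (ρ x).2

variable {a} in
lemma Ideal.exists_injective_embedding_of_torsion_eq_top (hM : a.torsion M = ⊤) :
    ∃ (E : Type) (_ : AddCommGroup E) (_ : Module R E) (f : M →ₗ[R] E),
      Module.Injective R E ∧ Function.Injective f ∧ a.torsion E = ⊤ := by
  obtain ⟨E, _, _, f, hE, hf⟩ := Module.exists_injective_embedding R M
  refine ⟨a.torsion E, inferInstance, inferInstance, f.codRestrict _ fun x => ?_, inferInstance,
    fun x y h => hf (congrArg Subtype.val h), a.torsion_torsion⟩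
  obtain ⟨k, hk⟩ : x ∈ a.torsion M := hM ▸ Submodule.mem_top
  exact ⟨k, fun r hr => by rw [← map_smul, hk r hr, map_zero]⟩

variable {a} in
lemma localCohomology.subsingleton_of_torsion_eq_top (hM : a.torsion M = ⊤) (i : ℕ) :
    Subsingleton ((localCohomology a (i + 1)).obj (ModuleCat.of R M)) := by
  have hT := isCohomological_localCohomology a
  induction i generalizing M with
  | zero =>
    obtain ⟨E, _, _, f, hE, hf, hE'⟩ := Ideal.exists_injective_embedding_of_torsion_eq_top hM
    obtain ⟨δ, hδ, hδ'⟩ := hT.exists_connecting_surjective hf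
      (LinearMap.exact_map_mkQ_range f) (Submodule.mkQ_surjective _) 0
      (hT.subsingleton_of_moduleInjective 0)
    refine subsingleton_of_forall_eq 0 fun x => ?_
    obtain ⟨y, rfl⟩ := hδ' x
    refine (hδ y).2 ?_
    obtain ⟨z, hz⟩ := Submodule.mkQ_surjective _ (zeroEquiv a _ y).1
    have hz' : z ∈ a.torsion E := hE' ▸ Submodule.mem_top
    refine ⟨(zeroEquiv a _).symm ⟨z, hz'⟩, (zeroEquiv a _).injective ?_⟩
    rw [zeroEquiv_naturality, LinearEquiv.apply_symm_apply]
    exact Subtype.ext hz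
  | succ i ih =>
    obtain ⟨E, _, _, f, hE, hf, hE'⟩ := Ideal.exists_injective_embedding_of_torsion_eq_top hM
    have := ih (Ideal.torsion_eq_top_of_surjective
      (Submodule.mkQ_surjective (LinearMap.range f)) hE')
    obtain ⟨e⟩ := hT.nonempty_equiv hf
      (LinearMap.exact_map_mkQ_range f) (Submodule.mkQ_surjective _) (i + 1)
      (hT.subsingleton_of_moduleInjective i) (hT.subsingleton_of_moduleInjective (i + 1))
    exact e.symm.subsingleton

variable {a} in
lemma Ideal.exists_injective_embedding_of_torsion_eq_bot (hM : a.torsion M = ⊥) :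
    ∃ (E : Type) (_ : AddCommGroup E) (_ : Module R E) (f : M →ₗ[R] E),
      Module.Injective R E ∧ Function.Injective f ∧ a.torsion E = ⊥ := by
  obtain ⟨E, _, _, f, hE, hf⟩ := Module.exists_injective_embedding R M
  refine ⟨E ⧸ a.torsion E, inferInstance, inferInstance, (a.torsion E).mkQ ∘ₗ f, inferInstance,
    (injective_iff_map_eq_zero _).2 fun x hx => ?_, a.torsion_quotient_torsion E⟩
  obtain ⟨k, hk⟩ : f x ∈ a.torsion E := (Submodule.Quotient.mk_eq_zero _).1 hx
  have : x ∈ a.torsion M := ⟨k, fun r hr => hf (by rw [map_smul, hk r hr, map_zero])⟩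
  rwa [hM] at this

end

section

variable {R : Type} [CommRing R] {n : ℕ} {M N L : Type} [AddCommGroup M] [Module R M]
  [AddCommGroup N] [Module R N] [AddCommGroup L] [Module R L]

lemma krullDim_support_lt_iff : Order.krullDim (Module.support R M) < (n : WithBot ℕ∞) ↔
    ∀ p : PrimeSpectrum R, (n : WithBot ℕ∞) ≤ ringKrullDim (R ⧸ p.asIdeal) →
      ∀ x : M, ∃ s ∉ p.asIdeal, s • x = 0 := by
  constructor
  · intro h p hp
    by_contra! hx
    obtain ⟨x, hx⟩ := hx
    have hps : p ∈ Module.support R M := Module.mem_support_iff_exists_annihilator.2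
      ⟨x, fun s hs => by_contra fun hsp =>
        hx s hsp ((Submodule.mem_annihilator_span_singleton x s).1 hs)⟩
    refine (hp.trans ?_).not_gt h
    rw [ringKrullDim_quotient]
    refine Order.krullDim_le_of_strictMono
      (fun q => ⟨q.1, Module.mem_support_mono (show p ≤ q.1 from q.2) hps⟩) fun q q' h => h
  · intro h
    by_contra! hn
    obtain ⟨s, hs⟩ := Order.le_krullDim_iff.1 hn
    have hp : (n : WithBot ℕ∞) ≤ ringKrullDim (R ⧸ s.head.1.asIdeal) := by
      rw [ringKrullDim_quotient]
      refine Order.le_krullDim_iff.2 ⟨⟨s.length, fun i => ⟨(s i).1, ?_⟩, fun i => s.step i⟩, hs⟩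
      exact s.head_le i
    obtain ⟨x, hx⟩ := Module.mem_support_iff_exists_annihilator.1 s.head.2
    obtain ⟨c, hc, hcx⟩ := h _ hp x
    exact hc (hx ((Submodule.mem_annihilator_span_singleton x c).2 hcx))

lemma inDimLT_iff : InDimLT R M n ↔ ∃ N : Submodule R M, N.FG ∧
    ∀ p : PrimeSpectrum R, (n : WithBot ℕ∞) ≤ ringKrullDim (R ⧸ p.asIdeal) →
      ∀ x : M, ∃ s ∉ p.asIdeal, s • x ∈ N := by
  refine exists_congr fun N => and_congr_right fun _ => krullDim_support_lt_iff.trans ?_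
  refine forall₂_congr fun p hp => ⟨fun h x => ?_, fun h x => ?_⟩
  · obtain ⟨s, hs, hx⟩ := h (N.mkQ x)
    exact ⟨s, hs, (Submodule.Quotient.mk_eq_zero N).1 hx⟩
  · obtain ⟨x, rfl⟩ := N.mkQ_surjective x
    obtain ⟨s, hs, hx⟩ := h x
    exact ⟨s, hs, (Submodule.Quotient.mk_eq_zero N).2 hx⟩

namespace InDimLT

lemma of_finite [Module.Finite R M] : InDimLT R M n :=
  inDimLT_iff.2 ⟨⊤, Module.Finite.fg_top, fun p _ _ =>
    ⟨1, p.asIdeal.one_notMem, Submodule.mem_top⟩⟩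

lemma of_subsingleton [Subsingleton M] : InDimLT R M n := of_finite

lemma of_surjective (h : InDimLT R M n) (f : M →ₗ[R] N) (hf : Function.Surjective f) :
    InDimLT R N n := by
  obtain ⟨K, hK, h⟩ := inDimLT_iff.1 h
  refine inDimLT_iff.2 ⟨K.map f, hK.map f, fun p hp y => ?_⟩
  obtain ⟨x, rfl⟩ := hf y
  obtain ⟨s, hs, hx⟩ := h p hp x
  exact ⟨s, hs, s • x, hx, map_smul f s x⟩

lemma equiv (h : InDimLT R M n) (e : M ≃ₗ[R] N) : InDimLT R N n :=
  h.of_surjective e.toLinearMap e.surjective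

variable [IsNoetherianRing R]

lemma of_injective (h : InDimLT R N n) (f : M →ₗ[R] N) (hf : Function.Injective f) :
    InDimLT R M n := by
  obtain ⟨K, hK, h⟩ := inDimLT_iff.1 h
  refine inDimLT_iff.2 ⟨K.comap f, ?_, fun p hp y => ?_⟩
  · exact Submodule.fg_of_fg_map_injective f hf (hK.of_le (Submodule.map_comap_le f K))
  · obtain ⟨s, hs, hx⟩ := h p hp (f y)
    exact ⟨s, hs, by rwa [Submodule.mem_comap, map_smul]⟩

lemma of_exact (hM : InDimLT R M n) (hL : InDimLT R L n) (f : M →ₗ[R] N) (g : N →ₗ[R] L)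
    (hfg : Function.Exact f g) : InDimLT R N n := by
  obtain ⟨A, hA, hA'⟩ := inDimLT_iff.1 hM
  obtain ⟨C, hC, hC'⟩ := inDimLT_iff.1 hL
  obtain ⟨t, ht⟩ := hC.of_le (inf_le_left : C ⊓ g.range ≤ C)
  have h' : ∀ z ∈ t, ∃ y, g y = z := fun z hz =>
    (ht ▸ Submodule.subset_span hz : z ∈ C ⊓ g.range).2
  choose! u hu using h'
  refine inDimLT_iff.2 ⟨A.map f ⊔ Submodule.span R (u '' t),
    (hA.map f).sup (Submodule.fg_span (t.finite_toSet.image u)), fun p hp y => ?_⟩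
  obtain ⟨s, hs, hsy⟩ := hC' p hp (g y)
  have hmap : (Submodule.span R (u '' t)).map g = C ⊓ g.range := by
    rw [Submodule.map_span, Set.image_image, Set.image_congr hu, Set.image_id', ht]
  obtain ⟨z, hz, hzy⟩ : s • g y ∈ (Submodule.span R (u '' t)).map g :=
    hmap ▸ ⟨hsy, s • y, map_smul g s y⟩
  obtain ⟨x, hx⟩ := (hfg (s • y - z)).1 (by rw [map_sub, map_smul, hzy, sub_self])
  obtain ⟨s', hs', hx'⟩ := hA' p hp x
  refine ⟨s' * s, fun h => (p.isPrime.mem_or_mem h).elim hs' hs, ?_⟩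
  rw [mul_smul, ← sub_add_cancel (s • y) z, smul_add, ← hx, ← map_smul]
  exact add_mem (Submodule.mem_sup_left ⟨_, hx', rfl⟩)
    (Submodule.mem_sup_right (Submodule.smul_mem _ _ hz))

lemma pi (h : InDimLT R M n) (r : ℕ) : InDimLT R (Fin r → M) n := by
  induction r with
  | zero => exact of_subsingleton
  | succ r ih =>
    refine of_exact h ih (LinearMap.single R (fun _ => M) 0)
      (LinearMap.funLeft R M Fin.succ) fun x => ⟨fun hx => ⟨x 0, ?_⟩, ?_⟩
    · refine funext fun i => Fin.cases (by simp) (fun i => ?_) i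
      simpa using (congrFun hx i).symm
    · rintro ⟨y, rfl⟩
      ext i
      simp [LinearMap.funLeft_apply]

lemma hom (h : InDimLT R M n) (X : Type) [AddCommGroup X] [Module R X] [Module.Finite R X] :
    InDimLT R (X →ₗ[R] M) n := by
  obtain ⟨r, f, hf⟩ := Module.Finite.exists_fin' R X
  refine of_injective (h.pi r) (((Pi.basisFun R (Fin r)).constr R).symm.toLinearMap ∘ₗ
    LinearMap.lcomp R M f) ?_
  refine ((Pi.basisFun R (Fin r)).constr R).symm.injective.comp fun φ ψ h =>
    LinearMap.ext fun x => ?_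
  obtain ⟨y, rfl⟩ := hf x
  exact LinearMap.congr_fun h y

end InDimLT

end

section

open Opposite

variable {R : Type} [CommRing R]

/-- The module `Extʲ(X, M)`. -/
abbrev ModuleCat.extOf (R : Type) [CommRing R] (j : ℕ) (X M : Type) [AddCommGroup X] [Module R X]
    [AddCommGroup M] [Module R M] : ModuleCat.{0} R :=
  ((Ext R (ModuleCat.{0} R) j).obj (op (ModuleCat.of R X))).obj (ModuleCat.of R M)

open ModuleCat

lemma LinearMap.exists_comp_eq_of_surjective {A B C : Type} [AddCommGroup A] [Module R A]
    [AddCommGroup B] [Module R B] [AddCommGroup C] [Module R C] (f : A →ₗ[R] B)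
    (hf : Function.Surjective f) (g : A →ₗ[R] C) (h : f.ker ≤ g.ker) :
    ∃ k : B →ₗ[R] C, ∀ x, k (f x) = g x := by
  refine ⟨f.ker.liftQ g h ∘ₗ (f.quotKerEquivOfSurjective hf).symm.toLinearMap, fun x => ?_⟩
  have : (f.quotKerEquivOfSurjective hf).symm (f x) = f.ker.mkQ x :=
    (LinearEquiv.symm_apply_eq _).2 rfl
  simp [this]

variable {X F N E : Type} [AddCommGroup X] [Module R X] [AddCommGroup F] [Module R F]
  [AddCommGroup N] [Module R N] [AddCommGroup E] [Module R E]

lemma ModuleCat.exists_ext_connecting [Module.Injective R E] {f : N →ₗ[R] E}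
    (hf : Function.Injective f) (X : Type) [AddCommGroup X] [Module R X] :
    ∃ δ : (X →ₗ[R] E ⧸ LinearMap.range f) →ₗ[R] extOf R 1 X N, Function.Surjective δ ∧
      ∀ φ, δ φ = 0 ↔ ∃ ψ : X →ₗ[R] E, (LinearMap.range f).mkQ ∘ₗ ψ = φ := by
  have hT := isCohomological_ext (op (ModuleCat.of R X))
  obtain ⟨δ, hδ, hδ'⟩ := hT.exists_connecting_surjective hf
      (LinearMap.exact_map_mkQ_range f) (Submodule.mkQ_surjective _) 0
      (hT.subsingleton_of_moduleInjective 0)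
  refine ⟨δ ∘ₗ (extZeroEquiv X _).symm.toLinearMap, hδ'.comp (LinearEquiv.surjective _),
    fun φ => (hδ _).trans ⟨?_, ?_⟩⟩
  · rintro ⟨y, hy⟩
    refine ⟨extZeroEquiv X _ y, ?_⟩
    rw [← extZeroEquiv_naturality]
    exact (LinearEquiv.eq_symm_apply _).1 hy
  · rintro ⟨ψ, rfl⟩
    refine ⟨(extZeroEquiv X _).symm ψ, (LinearEquiv.eq_symm_apply _).2 ?_⟩
    refine (extZeroEquiv_naturality X _ _).trans ?_
    rw [LinearEquiv.apply_symm_apply]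

lemma ModuleCat.nonempty_ext_equiv [Module.Injective R E] {f : N →ₗ[R] E}
    (hf : Function.Injective f) (X : Type) [AddCommGroup X] [Module R X] (j : ℕ) :
    Nonempty (extOf R (j + 1) X (E ⧸ LinearMap.range f) ≃ₗ[R] extOf R (j + 2) X N) := by
  have hT := isCohomological_ext (op (ModuleCat.of R X))
  exact hT.nonempty_equiv hf (LinearMap.exact_map_mkQ_range f) (Submodule.mkQ_surjective _) _
    (hT.subsingleton_of_moduleInjective _) (hT.subsingleton_of_moduleInjective _)

lemma ModuleCat.exists_hom_ker_to_ext [Module.Projective R F] {π : F →ₗ[R] X}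
    (hπ : Function.Surjective π) (N : Type) [AddCommGroup N] [Module R N] :
    ∃ ε : (π.ker →ₗ[R] N) →ₗ[R] extOf R 1 X N, Function.Surjective ε ∧
      ∀ h : F →ₗ[R] N, ε (h ∘ₗ π.ker.subtype) = 0 := by
  obtain ⟨E, _, _, f, hE, hf⟩ := Module.exists_injective_embedding R N
  obtain ⟨δ, hδ, hδ'⟩ := exists_ext_connecting hf X
  let q := (LinearMap.range f).mkQ
  let W : Submodule R ((F →ₗ[R] E) × (π.ker →ₗ[R] N) × (X →ₗ[R] E ⧸ LinearMap.range f)) :=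
    { carrier := {w | w.1 ∘ₗ π.ker.subtype = f ∘ₗ w.2.1 ∧ w.2.2 ∘ₗ π = q ∘ₗ w.1}
      zero_mem' := by simp
      add_mem' := by
        rintro w w' ⟨h, h'⟩ ⟨k, k'⟩
        simp [LinearMap.add_comp, LinearMap.comp_add, h, h', k, k']
      smul_mem' := by
        rintro r w ⟨h, h'⟩
        simp [LinearMap.smul_comp, LinearMap.comp_smul, h, h'] }
  let p : W →ₗ[R] (π.ker →ₗ[R] N) := LinearMap.fst R _ _ ∘ₗ LinearMap.snd R _ _ ∘ₗ W.subtype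
  let p' : W →ₗ[R] (X →ₗ[R] E ⧸ LinearMap.range f) :=
    LinearMap.snd R _ _ ∘ₗ LinearMap.snd R _ _ ∘ₗ W.subtype
  have hlift (φ : X →ₗ[R] E ⧸ LinearMap.range f) : ∃ w : W, p' w = φ := by
    obtain ⟨h, hh⟩ := Module.projective_lifting_property q (φ ∘ₗ π) (Submodule.mkQ_surjective _)
    have hk : ∀ x : π.ker, h x ∈ LinearMap.range f := fun x => by
      refine (Submodule.Quotient.mk_eq_zero _).1 ((LinearMap.congr_fun hh x).trans ?_)
      rw [LinearMap.comp_apply, LinearMap.mem_ker.1 x.2, map_zero]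
    refine ⟨⟨(h, (LinearEquiv.ofInjective f hf).symm.toLinearMap ∘ₗ
      (h ∘ₗ π.ker.subtype).codRestrict _ hk, φ), LinearMap.ext fun x => ?_, hh.symm⟩, rfl⟩
    exact (congrArg Subtype.val ((LinearEquiv.ofInjective f hf).apply_symm_apply
      ⟨h x, hk x⟩)).symm
  have hext (k : π.ker →ₗ[R] N) : ∃ w : W, p w = k := by
    obtain ⟨h, hh⟩ := Module.Injective.out (Q := E) π.ker.subtype Subtype.val_injective (f ∘ₗ k)
    obtain ⟨φ, hφ⟩ := π.exists_comp_eq_of_surjective hπ (q ∘ₗ h) fun x hx =>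
      (Submodule.Quotient.mk_eq_zero _).2 ⟨k ⟨x, hx⟩, (hh ⟨x, hx⟩).symm⟩
    exact ⟨⟨(h, k, φ), LinearMap.ext hh, LinearMap.ext hφ⟩, rfl⟩
  have key := LinearMap.exists_comp_eq_of_surjective (R := R) (A := W) (B := π.ker →ₗ[R] N)
    (C := extOf R 1 X N)
  obtain ⟨ε, hε⟩ := key p hext (δ ∘ₗ p') fun w hw => by
    obtain ⟨⟨h, k, φ⟩, h₁, h₂⟩ := w
    obtain rfl : k = 0 := hw
    obtain ⟨ψ, hψ⟩ := π.exists_comp_eq_of_surjective hπ h fun x hx =>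
      LinearMap.congr_fun (h₁.trans (LinearMap.comp_zero f)) ⟨x, hx⟩
    refine (hδ' φ).2 ⟨ψ, LinearMap.ext fun x => ?_⟩
    obtain ⟨x, rfl⟩ := hπ x
    exact (congrArg q (hψ x)).trans (LinearMap.congr_fun h₂ x).symm
  refine ⟨ε, fun y => ?_, fun h => ?_⟩
  · obtain ⟨φ, rfl⟩ := hδ y
    obtain ⟨w, rfl⟩ := hlift φ
    exact ⟨p w, hε w⟩
  · refine (hε ⟨(f ∘ₗ h, h ∘ₗ π.ker.subtype, 0), rfl, ?_⟩).trans (map_zero δ)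
    rw [LinearMap.zero_comp, ← LinearMap.comp_assoc, LinearMap.range_mkQ_comp,
      LinearMap.zero_comp]

lemma ModuleCat.exists_ext_ker_to_ext [Module.Projective R F] {π : F →ₗ[R] X}
    (hπ : Function.Surjective π) (N : Type) [AddCommGroup N] [Module R N] (j : ℕ) :
    ∃ ε : extOf R (j + 1) π.ker N →ₗ[R] extOf R (j + 2) X N, Function.Surjective ε := by
  induction j generalizing N with
  | zero =>
    obtain ⟨E, _, _, f, hE, hf⟩ := Module.exists_injective_embedding R N
    obtain ⟨δ, hδ, hδ'⟩ := exists_ext_connecting hf π.ker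
    obtain ⟨ε, hε, hε'⟩ := exists_hom_ker_to_ext hπ (E ⧸ LinearMap.range f)
    obtain ⟨κ, hκ⟩ := δ.exists_comp_eq_of_surjective hδ ε fun φ hφ => by
      obtain ⟨ψ, rfl⟩ := (hδ' φ).1 hφ
      obtain ⟨h, hh⟩ := Module.Injective.out (Q := E) π.ker.subtype Subtype.val_injective ψ
      rw [← (LinearMap.ext hh : h ∘ₗ π.ker.subtype = ψ), ← LinearMap.comp_assoc]
      exact hε' _
    obtain ⟨e⟩ := nonempty_ext_equiv hf X 0
    refine ⟨e.toLinearMap ∘ₗ κ, e.surjective.comp fun y => ?_⟩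
    obtain ⟨φ, rfl⟩ := hε y
    exact ⟨δ φ, hκ φ⟩
  | succ j ih =>
    obtain ⟨E, _, _, f, hE, hf⟩ := Module.exists_injective_embedding R N
    obtain ⟨e⟩ := nonempty_ext_equiv hf X (j + 1)
    obtain ⟨e'⟩ := nonempty_ext_equiv hf π.ker j
    obtain ⟨ε, hε⟩ := ih (E ⧸ LinearMap.range f)
    exact ⟨e.toLinearMap ∘ₗ ε ∘ₗ e'.symm.toLinearMap,
      e.surjective.comp (hε.comp e'.symm.surjective)⟩

lemma InDimLT.ext [IsNoetherianRing R] {n : ℕ} (hN : InDimLT R N n) (j : ℕ) (X : Type)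
    [AddCommGroup X] [Module R X] [Module.Finite R X] : InDimLT R (extOf R j X N) n := by
  induction j using Nat.twoStepInduction generalizing X with
  | zero => exact (hN.hom X).equiv (extZeroEquiv X N).symm
  | one =>
    obtain ⟨r, π, hπ⟩ := Module.Finite.exists_fin' R X
    obtain ⟨ε, hε, -⟩ := exists_hom_ker_to_ext hπ N
    exact (hN.hom _).of_surjective ε hε
  | more j _ ih =>
    obtain ⟨r, π, hπ⟩ := Module.Finite.exists_fin' R X
    obtain ⟨ε, hε⟩ := exists_ext_ker_to_ext hπ N j
    exact (ih π.ker).of_surjective ε hε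

end

section

open Opposite ModuleCat

variable {R : Type} [CommRing R] (a : Ideal R)

/-- The local cohomology module `Hⁱₐ(M)`. -/
abbrev localCohomology.of (i : ℕ) (M : Type) [AddCommGroup M] [Module R M] : ModuleCat.{0} R :=
  (localCohomology a i).obj (ModuleCat.of R M)

variable {M N : Type} [AddCommGroup M] [Module R M] [AddCommGroup N] [Module R N]

lemma ModuleCat.nonempty_ext_congr {j : ℕ} {X : Type} [AddCommGroup X] [Module R X]
    (e : M ≃ₗ[R] N) : Nonempty (extOf R j X M ≃ₗ[R] extOf R j X N) :=
  ⟨(isCohomological_ext (op (ModuleCat.of R X))).mapEquiv j e⟩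

variable {a} in
lemma Ideal.subsingleton_ext_zero_of_torsion_eq_bot (hM : a.torsion M = ⊥) :
    Subsingleton (extOf R 0 (R ⧸ a) M) := by
  refine (extZeroEquiv (R ⧸ a) M).toEquiv.subsingleton_congr.2
    (subsingleton_of_forall_eq 0 fun φ => ?_)
  have h : φ 1 ∈ a.torsion M := ⟨1, fun r hr => by
    rw [← map_smul, Algebra.smul_def, mul_one, Ideal.Quotient.algebraMap_eq,
      Ideal.Quotient.eq_zero_iff_mem.2 (pow_one a ▸ hr), map_zero]⟩
  rw [hM, Submodule.mem_bot] at h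
  exact Submodule.linearMap_qext _ (LinearMap.ext_ring h)

variable [IsNoetherianRing R]

variable {a} in
lemma localCohomology.nonempty_equiv_quotient_torsion (i : ℕ) :
    Nonempty (localCohomology.of a (i + 1) M ≃ₗ[R]
      localCohomology.of a (i + 1) (M ⧸ a.torsion M)) := by
  have hT := isCohomological_localCohomology a
  have h := hT.exact_map Subtype.val_injective (LinearMap.exact_subtype_mkQ (a.torsion M))
    (Submodule.mkQ_surjective _) (i + 1)
  obtain ⟨δ, hδ, -⟩ := hT.exists_connecting_map Subtype.val_injective
    (LinearMap.exact_subtype_mkQ (a.torsion M)) (Submodule.mkQ_surjective _) (i + 1)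
  have h₁ := localCohomology.subsingleton_of_torsion_eq_top (a.torsion_torsion (M := M)) i
  have h₂ := localCohomology.subsingleton_of_torsion_eq_top (a.torsion_torsion (M := M)) (i + 1)
  refine ⟨LinearEquiv.ofBijective _ ⟨(injective_iff_map_eq_zero _).2 fun x hx => ?_,
    fun y => (hδ y).1 (h₂.elim _ _)⟩⟩
  obtain ⟨y, rfl⟩ := (h x).1 hx
  rw [h₁.elim y 0, map_zero]

variable {a} in
lemma InDimLT.ext_localCohomology {n t : ℕ}
    (hExt : ∀ j ≤ t + 1, InDimLT R (extOf R j (R ⧸ a) M) n)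
    (hH : ∀ i < t, InDimLT R (localCohomology.of a i M) n) :
    InDimLT R (extOf R 0 (R ⧸ a) (localCohomology.of a t M)) n ∧
      InDimLT R (extOf R 1 (R ⧸ a) (localCohomology.of a t M)) n := by
  have hX := isCohomological_ext (op (ModuleCat.of R (R ⧸ a)))
  have hT := isCohomological_localCohomology a
  induction t generalizing M with
  | zero =>
    obtain ⟨e₀⟩ := nonempty_ext_congr (j := 0) (X := R ⧸ a) (localCohomology.zeroEquiv a M).symm
    obtain ⟨e₁⟩ := nonempty_ext_congr (j := 1) (X := R ⧸ a) (localCohomology.zeroEquiv a M).symm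
    constructor
    · refine InDimLT.equiv ?_ e₀
      have hinj : Function.Injective
          (LinearMap.compRight R (a.torsion M).subtype : ((R ⧸ a) →ₗ[R] a.torsion M) →ₗ[R] _) :=
        fun φ ψ h => LinearMap.ext fun x => Subtype.ext (LinearMap.congr_fun h x)
      exact (((hExt 0 (Nat.zero_le _)).equiv (extZeroEquiv (R ⧸ a) M)).of_injective _ hinj).equiv
        (extZeroEquiv (R ⧸ a) (a.torsion M)).symm
    · refine InDimLT.equiv ?_ e₁
      obtain ⟨δ, -, hδ⟩ := hX.exists_connecting_map Subtype.val_injective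
        (LinearMap.exact_subtype_mkQ (a.torsion M)) (Submodule.mkQ_surjective _) 0
      have := Ideal.subsingleton_ext_zero_of_torsion_eq_bot (a.torsion_quotient_torsion M)
      exact InDimLT.of_exact .of_subsingleton (hExt 1 le_rfl) _ _ hδ
  | succ t ih =>
    have hΓ : InDimLT R (a.torsion M) n :=
      (hH 0 t.succ_pos).equiv (localCohomology.zeroEquiv a M)
    obtain ⟨E, _, _, f, hE, hf, hE'⟩ := Ideal.exists_injective_embedding_of_torsion_eq_bot
      (a.torsion_quotient_torsion M)
    have hExt' (j) (hj : j ≤ t + 2) : InDimLT R (extOf R j (R ⧸ a) (M ⧸ a.torsion M)) n := by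
      obtain ⟨δ, hδ, -⟩ := hX.exists_connecting_map Subtype.val_injective
        (LinearMap.exact_subtype_mkQ (a.torsion M)) (Submodule.mkQ_surjective _) j
      exact (hExt j hj).of_exact (hΓ.ext _ _) _ _ hδ
    have hEE (j) : Subsingleton (extOf R j (R ⧸ a) E) := by
      cases j with
      | zero => exact Ideal.subsingleton_ext_zero_of_torsion_eq_bot hE'
      | succ j => exact hX.subsingleton_of_moduleInjective j
    have hEH (i) : Subsingleton (localCohomology.of a i E) := by
      cases i with
      | zero =>
        have := (Submodule.subsingleton_iff_eq_bot.2 hE')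
        exact (localCohomology.zeroEquiv a E).toEquiv.subsingleton
      | succ j => exact hT.subsingleton_of_moduleInjective j
    have hL (i) : Nonempty (localCohomology.of a i (E ⧸ LinearMap.range f) ≃ₗ[R]
        localCohomology.of a (i + 1) M) := by
      obtain ⟨e⟩ := hT.nonempty_equiv hf (LinearMap.exact_map_mkQ_range f)
        (Submodule.mkQ_surjective _) i (hEH i) (hEH (i + 1))
      obtain ⟨e'⟩ := localCohomology.nonempty_equiv_quotient_torsion (a := a) (M := M) i
      exact ⟨e.trans e'.symm⟩
    obtain ⟨h₀, h₁⟩ := ih (M := E ⧸ LinearMap.range f) (fun j hj => by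
      obtain ⟨e⟩ := hX.nonempty_equiv hf (LinearMap.exact_map_mkQ_range f)
        (Submodule.mkQ_surjective _) j (hEE j) (hEE (j + 1))
      exact (hExt' (j + 1) (Nat.succ_le_succ hj)).equiv e.symm) fun i hi => by
      obtain ⟨e⟩ := hL i
      exact (hH (i + 1) (Nat.succ_lt_succ hi)).equiv e.symm
    obtain ⟨e⟩ := hL t
    obtain ⟨e₀⟩ := nonempty_ext_congr (j := 0) (X := R ⧸ a) e
    obtain ⟨e₁⟩ := nonempty_ext_congr (j := 1) (X := R ⧸ a) e
    exact ⟨h₀.equiv e₀, h₁.equiv e₁⟩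

end

section

variable {R : Type} [CommRing R] (a : Ideal R) (S : Submonoid R)

lemma Submodule.FG.exists_mem_smul_eq_zero {S : Submonoid R} {M : Type} [AddCommGroup M]
    [Module R M] {N : Submodule R M} (hN : N.FG) (h : ∀ x ∈ N, ∃ s ∈ S, s • x = 0) :
    ∃ s ∈ S, ∀ x ∈ N, s • x = 0 := by
  induction N, hN using Submodule.fg_induction with
  | singleton x =>
    obtain ⟨s, hs, hx⟩ := h x (Submodule.mem_span_singleton_self x)
    refine ⟨s, hs, fun y hy => ?_⟩
    obtain ⟨r, rfl⟩ := Submodule.mem_span_singleton.1 hy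
    rw [smul_comm, hx, smul_zero]
  | sup N₁ N₂ _ _ h₁ h₂ =>
    obtain ⟨s, hs, hs'⟩ := h₁ fun x hx => h x (Submodule.mem_sup_left hx)
    obtain ⟨u, hu, hu'⟩ := h₂ fun x hx => h x (Submodule.mem_sup_right hx)
    refine ⟨s * u, S.mul_mem hs hu, fun x hx => ?_⟩
    obtain ⟨y, hy, z, hz, rfl⟩ := Submodule.mem_sup.1 hx
    rw [smul_add, mul_comm, mul_smul, hs' y hy, mul_comm, mul_smul, hu' z hz, smul_zero,
      smul_zero, add_zero]

section Descend

variable {R' : Type} [CommRing R'] {σ : R →+* R'} {S : Submonoid R}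
  {A B C A' B' C' : Type} [AddCommGroup A] [AddCommGroup B] [AddCommGroup C]
  [AddCommGroup A'] [AddCommGroup B'] [AddCommGroup C'] [Module R' A'] [Module R' B']
  [Module R' C'] [Module R A] [Module R B] [Module R C]

/-- A semilinear map between cokernels has `S`-torsion kernel if the middle map has `S`-torsion
kernel and the left map has `S`-torsion cokernel. -/
lemma LinearMap.exists_semilinear_of_exact {u : A →ₗ[R] B} {v : B →ₗ[R] C} {u' : A' →ₗ[R'] B'}
    {v' : B' →ₗ[R'] C'} (huv : Function.Exact u v) (hv : Function.Surjective v)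
    (huv' : Function.Exact u' v') (φ : A →ₛₗ[σ] A') (ψ : B →ₛₗ[σ] B')
    (h : ∀ x, ψ (u x) = u' (φ x)) (hφ : ∀ y, ∃ s ∈ S, ∃ x, φ x = σ s • y)
    (hψ : ∀ x, ψ x = 0 → ∃ s ∈ S, s • x = 0) :
    ∃ χ : C →ₛₗ[σ] C', ∀ x, χ x = 0 → ∃ s ∈ S, s • x = 0 := by
  let e := v.quotKerEquivOfSurjective hv
  let χ : (B ⧸ LinearMap.ker v) →ₛₗ[σ] C' :=
    (LinearMap.ker v).liftQ (v'.comp ψ) fun x hx => by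
      obtain ⟨y, rfl⟩ := (huv x).1 hx
      rw [LinearMap.mem_ker, LinearMap.comp_apply, h, huv'.apply_apply_eq_zero]
  refine ⟨χ.comp e.symm.toLinearMap, fun x hx => ?_⟩
  obtain ⟨b, rfl⟩ := hv x
  have he : e.symm (v b) = Submodule.Quotient.mk b := by
    rw [LinearEquiv.symm_apply_eq]; rfl
  replace hx : v' (ψ b) = 0 := by
    rw [LinearMap.comp_apply, LinearEquiv.coe_coe, he] at hx
    exact hx
  obtain ⟨y, hy⟩ := (huv' _).1 hx
  obtain ⟨s, hs, z, hz⟩ := hφ y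
  obtain ⟨w, hw, hw'⟩ := hψ (s • b - u z) (by
    rw [map_sub, h, hz, ψ.map_smulₛₗ, map_smul, hy, sub_self])
  refine ⟨w * s, S.mul_mem hw hs, ?_⟩
  have := congrArg v hw'
  rwa [map_smul, map_sub, huv.apply_apply_eq_zero, sub_zero, map_zero, map_smul, ← mul_smul] at this

end Descend

variable {M N : Type} [AddCommGroup M] [Module R M] [AddCommGroup N] [Module R N]

variable (M) in
/-- The map from torsion to torsion of the localization. -/
def Ideal.torsionLocalization : a.torsion M →ₛₗ[algebraMap R (Localization S)]
    (a.map (algebraMap R (Localization S))).torsion (LocalizedModule S M) where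
  toFun x := ⟨LocalizedModule.mkLinearMap S M x, by
    obtain ⟨k, hk⟩ := x.2
    refine ⟨k, fun r hr => ?_⟩
    rw [← Ideal.map_pow] at hr
    have : Ideal.map (algebraMap R (Localization S)) (a ^ k) ≤
        LinearMap.ker (LinearMap.toSpanSingleton (Localization S) _
          (LocalizedModule.mkLinearMap S M x)) := Ideal.map_le_iff_le_comap.2 fun r hr => by
      rw [Ideal.mem_comap, LinearMap.mem_ker, LinearMap.toSpanSingleton_apply, algebraMap_smul,
        ← map_smul, hk r hr, map_zero]
    exact this hr⟩
  map_add' x y := Subtype.ext (map_add _ _ _)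
  map_smul' r x := Subtype.ext <|
    (map_smul (LocalizedModule.mkLinearMap S M) r (x : M)).trans (algebraMap_smul _ r _).symm

lemma Ideal.exists_smul_eq_zero_of_torsionLocalization_eq_zero (x : a.torsion M)
    (h : a.torsionLocalization S M x = 0) : ∃ s ∈ S, s • x = 0 := by
  obtain ⟨s, hs, h⟩ := LocalizedModule.mem_ker_mkLinearMap_iff.1
    (show (x : M) ∈ LinearMap.ker (LocalizedModule.mkLinearMap S M) from congrArg Subtype.val h)
  exact ⟨s, hs, Subtype.ext h⟩

lemma Ideal.exists_torsionLocalization_eq_smul [IsNoetherianRing R]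
    (y : (a.map (algebraMap R (Localization S))).torsion (LocalizedModule S M)) :
    ∃ s ∈ S, ∃ x, a.torsionLocalization S M x = algebraMap R (Localization S) s • y := by
  obtain ⟨y, k, hk⟩ := y
  obtain ⟨⟨m, s⟩, hm⟩ := IsLocalizedModule.surj S (LocalizedModule.mkLinearMap S M) y
  obtain ⟨u, hu, hu'⟩ := Submodule.FG.exists_mem_smul_eq_zero (S := S)
    (N := Submodule.map (LinearMap.toSpanSingleton R M m) (a ^ k))
    ((IsNoetherian.noetherian (a ^ k)).map _) (by
      rintro _ ⟨r, hr, rfl⟩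
      refine LocalizedModule.mem_ker_mkLinearMap_iff.1 ?_
      rw [LinearMap.mem_ker, LinearMap.toSpanSingleton_apply, map_smul, ← hm, smul_comm,
        ← algebraMap_smul (Localization S) r, hk _ (by
          rw [← Ideal.map_pow]; exact Ideal.mem_map_of_mem _ hr), smul_zero])
  refine ⟨u * s, S.mul_mem hu s.2, ⟨u • m, k, fun r hr => ?_⟩, Subtype.ext ?_⟩
  · rw [smul_comm]
    exact hu' _ ⟨r, hr, rfl⟩
  · change LocalizedModule.mkLinearMap S M (u • m) = algebraMap R (Localization S) (u * s) • y
    rw [map_smul, algebraMap_smul, mul_smul, ← hm]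
    rfl

variable (M) in
/-- The map from local cohomology to the local cohomology of the localization in degree zero. -/
def localCohomology.zeroLocalization : localCohomology.of a 0 M →ₛₗ[algebraMap R (Localization S)]
    localCohomology.of (a.map (algebraMap R (Localization S))) 0 (LocalizedModule S M) :=
  (zeroEquiv (a.map (algebraMap R (Localization S))) _).symm.toLinearMap.comp
    ((a.torsionLocalization S M).comp (zeroEquiv a M).toLinearMap)

lemma localCohomology.zeroEquiv_zeroLocalization (x : localCohomology.of a 0 M) :
    zeroEquiv _ _ (zeroLocalization a S M x) = a.torsionLocalization S M (zeroEquiv a M x) :=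
  LinearEquiv.apply_symm_apply _ _

lemma localCohomology.exists_smul_eq_zero_of_zeroLocalization_eq_zero
    (x : localCohomology.of a 0 M) (h : zeroLocalization a S M x = 0) : ∃ s ∈ S, s • x = 0 := by
  obtain ⟨s, hs, h⟩ := a.exists_smul_eq_zero_of_torsionLocalization_eq_zero S (zeroEquiv a M x) (by
    rw [← zeroEquiv_zeroLocalization, h, map_zero])
  exact ⟨s, hs, by rwa [← map_smul, LinearEquiv.map_eq_zero_iff] at h⟩

lemma localCohomology.zeroLocalization_naturality (f : M →ₗ[R] N) (x) :
    zeroLocalization a S N ((isCohomological_localCohomology a).map 0 f x) =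
      (isCohomological_localCohomology _).map 0 (LocalizedModule.map S f)
        (zeroLocalization a S M x) := by
  apply (zeroEquiv (a.map (algebraMap R (Localization S))) _).injective
  rw [zeroEquiv_zeroLocalization]
  refine Eq.trans ?_ (zeroEquiv_naturality _ _ _).symm
  rw [zeroEquiv_zeroLocalization]
  refine (congrArg (a.torsionLocalization S N) (zeroEquiv_naturality a f x)).trans ?_
  refine Subtype.ext ?_
  exact (IsLocalizedModule.map_apply S (LocalizedModule.mkLinearMap S M)
    (LocalizedModule.mkLinearMap S N) f _).symm

variable [IsNoetherianRing R]

lemma localCohomology.exists_zeroLocalization_eq_smul (y) :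
    ∃ s ∈ S, ∃ x, zeroLocalization a S M x = algebraMap R (Localization S) s • y := by
  obtain ⟨s, hs, x, hx⟩ := a.exists_torsionLocalization_eq_smul S (M := M) (zeroEquiv _ _ y)
  refine ⟨s, hs, (zeroEquiv a M).symm x, (zeroEquiv _ _).injective ?_⟩
  rw [zeroEquiv_zeroLocalization, LinearEquiv.apply_symm_apply, hx, map_smul]

/-- Local cohomology maps to the local cohomology of the localization, with `S`-torsion kernel. -/
lemma localCohomology.exists_localization (i : ℕ) (M : Type) [AddCommGroup M] [Module R M] :
    ∃ φ : localCohomology.of a i M →ₛₗ[algebraMap R (Localization S)]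
      localCohomology.of (a.map (algebraMap R (Localization S))) i (LocalizedModule S M),
      ∀ x, φ x = 0 → ∃ s ∈ S, s • x = 0 := by
  have hT := isCohomological_localCohomology a
  have hT' := isCohomological_localCohomology (a.map (algebraMap R (Localization S)))
  induction i generalizing M with
  | zero =>
    exact ⟨zeroLocalization a S M, exists_smul_eq_zero_of_zeroLocalization_eq_zero a S⟩
  | succ i ih =>
    obtain ⟨E, _, _, f, hE, hf⟩ := Module.exists_injective_embedding R M
    have hE' : Module.Injective (Localization S) (LocalizedModule S E) :=
      Module.injective_of_isLocalizedModule S (LocalizedModule.mkLinearMap S E)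
    obtain ⟨δ, hδ, hδ'⟩ := hT.exists_connecting_surjective hf (LinearMap.exact_map_mkQ_range f)
      (Submodule.mkQ_surjective _) i (hT.subsingleton_of_moduleInjective i)
    obtain ⟨δ', hδ₁, -⟩ := hT'.exists_connecting_map
      (f := LocalizedModule.map S f) (g := LocalizedModule.map S (LinearMap.range f).mkQ)
      (IsLocalizedModule.map_injective S (LocalizedModule.mkLinearMap S M)
        (LocalizedModule.mkLinearMap S E) f hf)
      (LocalizedModule.map_exact S _ _ (LinearMap.exact_map_mkQ_range f))
      (IsLocalizedModule.map_surjective S (LocalizedModule.mkLinearMap S E)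
        (LocalizedModule.mkLinearMap S _) _ (Submodule.mkQ_surjective _)) i
    cases i with
    | zero =>
      exact LinearMap.exists_semilinear_of_exact hδ hδ' hδ₁ (zeroLocalization a S E)
        (zeroLocalization a S _) (zeroLocalization_naturality a S _)
        (exists_zeroLocalization_eq_smul a S)
        (exists_smul_eq_zero_of_zeroLocalization_eq_zero a S)
    | succ i =>
      obtain ⟨ψ, hψ⟩ := ih (E ⧸ LinearMap.range f)
      have h₁ := hT.subsingleton_of_moduleInjective (E := E) i
      have h₂ := hT'.subsingleton_of_moduleInjective (E := LocalizedModule S E) i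
      exact LinearMap.exists_semilinear_of_exact hδ hδ' hδ₁ 0 ψ
        (fun x => by rw [h₁.elim x 0, map_zero, map_zero, LinearMap.zero_apply, map_zero])
        (fun y => ⟨1, S.one_mem, 0, h₂.elim _ _⟩) hψ

lemma localCohomology.exists_pow_smul_eq_zero_of_finite_localization (i : ℕ) (M : Type)
    [AddCommGroup M] [Module R M] (h : Module.Finite (Localization S)
      (localCohomology.of (a.map (algebraMap R (Localization S))) i (LocalizedModule S M))) :
    ∃ k, ∀ r ∈ a ^ k, ∀ x : localCohomology.of a i M, ∃ s ∈ S, s • r • x = 0 := by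
  obtain ⟨φ, hφ⟩ := localCohomology.exists_localization a S i M
  obtain ⟨k, hk⟩ := Submodule.FG.exists_pow_smul_eq_zero h.1
    (localCohomology.torsion_eq_top (a.map (algebraMap R (Localization S))) _ i).ge
  refine ⟨k, fun r hr x => hφ _ ?_⟩
  rw [φ.map_smulₛₗ]
  exact hk _ (by rw [← Ideal.map_pow]; exact Ideal.mem_map_of_mem _ hr) _ Submodule.mem_top

end

section

open Submodule

variable {R : Type} [CommRing R] {n : ℕ} {M : Type} [AddCommGroup M] [Module R M]

lemma isAssociatedPrime_iff_exists_smul_eq_zero_iff [IsNoetherianRing R] {p : Ideal R} :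
    IsAssociatedPrime p M ↔ p.IsPrime ∧ ∃ x : M, ∀ r : R, r • x = 0 ↔ r ∈ p := by
  rw [isAssociatedPrime_iff]
  refine and_congr_right fun _ => exists_congr fun x => ?_
  simp only [SetLike.ext_iff, mem_colon_singleton, mem_bot, iff_comm]

lemma exists_isPrime_smul_eq_zero_iff [IsNoetherianRing R] {p : Ideal R} [p.IsPrime] {x : M}
    (h : ∀ s ∉ p, s • x ≠ 0) :
    ∃ q ≤ p, q.IsPrime ∧ ∃ c : R, ∀ r : R, r • c • x = 0 ↔ r ∈ q := by
  obtain ⟨q, hq, hqp⟩ := Ideal.exists_minimalPrimes_le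
    (I := Module.annihilator R (span R {x})) (J := p) fun r hr => by
      by_contra hrp
      exact h r hrp (congrArg Subtype.val
        (Module.mem_annihilator.1 hr ⟨x, mem_span_singleton_self x⟩))
  obtain ⟨hq', ⟨y, hy⟩, hqy⟩ := isAssociatedPrime_iff_exists_smul_eq_zero_iff.1
    (Module.associatedPrimes.minimalPrimes_annihilator_subset_associatedPrimes R _ hq)
  obtain ⟨c, rfl⟩ := mem_span_singleton.1 hy
  exact ⟨q, hqp, hq', c, fun r => by rw [← hqy r, Subtype.ext_iff]; rfl⟩

variable [IsNoetherianRing R] {a : Ideal R}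

lemma InDimLT.of_smul_mem {P Q : Submodule R M} (h : ∀ r ∈ a, ∀ x ∈ P, r • x ∈ Q)
    (hQ : InDimLT R Q n) (ha : InDimLT R (torsionBySet R M (a : Set R)) n) : InDimLT R P n := by
  obtain ⟨m, g, hg⟩ := Submodule.fg_iff_exists_fin_generating_family.1 (IsNoetherian.noetherian a)
  have hga (i) : g i ∈ a := hg ▸ subset_span ⟨i, rfl⟩
  let F : P →ₗ[R] (Fin m → Q) := LinearMap.pi fun i =>
    (LinearMap.lsmul R M (g i)).restrict (h _ (hga i))
  refine InDimLT.of_exact (.of_injective ha ((P.subtype ∘ₗ (LinearMap.ker F).subtype).codRestrict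
    (torsionBySet R M (a : Set R)) ?_) ?_) (hQ.pi m) (LinearMap.ker F).subtype F
    (LinearMap.exact_subtype_ker_map F)
  · rintro ⟨x, hx⟩
    have key (r) (hr : r ∈ span R (Set.range g)) : r • (x : M) = 0 := by
      induction hr using span_induction with
      | mem r hr =>
        obtain ⟨i, rfl⟩ := hr
        exact congrArg Subtype.val (congrFun hx i)
      | zero => exact zero_smul _ _
      | add r s _ _ hr hs => rw [add_smul, hr, hs, add_zero]
      | smul c r _ hr => rw [smul_assoc, hr, smul_zero]
    exact (mem_torsionBySet_iff _ _).2 fun r => key r (hg.ge r.2)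
  · intro x y hxy
    have h : ((x : P) : M) = (y : P) :=
      congrArg (fun z : torsionBySet R M (a : Set R) => (z : M)) hxy
    exact Subtype.ext (Subtype.ext h)

lemma InDimLT.torsionBySet_pow (ha : InDimLT R (torsionBySet R M (a : Set R)) n) (k : ℕ) :
    InDimLT R (torsionBySet R M ((a ^ k : Ideal R) : Set R)) n := by
  induction k with
  | zero =>
    have : Subsingleton (torsionBySet R M ((a ^ 0 : Ideal R) : Set R)) := by
      rw [Submodule.subsingleton_iff_eq_bot, eq_bot_iff]
      exact fun x hx => by simpa using (mem_torsionBySet_iff _ _).1 hx ⟨1, by simp⟩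
    exact .of_subsingleton
  | succ k ih =>
    refine .of_smul_mem (fun r hr x hx => (mem_torsionBySet_iff _ _).2 fun ⟨s, hs⟩ => ?_) ih ha
    exact (mul_smul s r x).symm.trans
      ((mem_torsionBySet_iff _ _).1 hx ⟨s * r, pow_succ a k ▸ Ideal.mul_mem_mul hs hr⟩)

omit [IsNoetherianRing R] in
lemma InDimLT.torsionBySet_of_hom (h : InDimLT R ((R ⧸ a) →ₗ[R] M) n) :
    InDimLT R (torsionBySet R M (a : Set R)) n := by
  refine h.of_surjective ((LinearMap.applyₗ (1 : R ⧸ a)).codRestrict _ fun φ =>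
    (mem_torsionBySet_iff _ _).2 fun ⟨r, hr⟩ => ?_) fun ⟨x, hx⟩ => ⟨a.liftQ
      (LinearMap.toSpanSingleton R M x) fun r hr => (mem_torsionBySet_iff _ _).1 hx ⟨r, hr⟩,
      Subtype.ext (one_smul R x)⟩
  change r • φ 1 = 0
  rw [← map_smul, Algebra.smul_def, mul_one, Ideal.Quotient.algebraMap_eq,
    Ideal.Quotient.eq_zero_iff_mem.2 hr, map_zero]

lemma localCohomology.subsingleton_of_subsingleton (a : Ideal R) (M : Type) [AddCommGroup M]
    [Module R M] [Subsingleton M] (i : ℕ) : Subsingleton (localCohomology.of a i M) := by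
  have h : a.torsion M = ⊤ := Subsingleton.elim _ _
  cases i with
  | zero => exact (localCohomology.zeroEquiv a M).toEquiv.subsingleton
  | succ i => exact localCohomology.subsingleton_of_torsion_eq_top h i

/-- An `a`-torsion module is in dimension `< n` if its `a`-socle is, and if locally at primes of
dimension at least `n` it is annihilated by a power of `a`. -/
lemma InDimLT.of_torsionBySet (hM : a.torsion M = ⊤)
    (h : InDimLT R (torsionBySet R M (a : Set R)) n)
    (hk : ∀ p : PrimeSpectrum R, n ≤ ringKrullDim (R ⧸ p.asIdeal) →
      ∃ k, ∀ r ∈ a ^ k, ∀ x : M, ∃ s ∉ p.asIdeal, s • r • x = 0) : InDimLT R M n := by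
  obtain ⟨N, hN, hN'⟩ := inDimLT_iff.1 h
  have : Module.Finite R N := Module.Finite.iff_fg.2 hN
  choose! κ hκ using hk
  have hfin : {p : PrimeSpectrum R | p.asIdeal ∈ associatedPrimes R N}.Finite :=
    (associatedPrimes.finite R N).preimage fun p _ q _ => PrimeSpectrum.ext
  obtain ⟨k, hk⟩ := (hfin.image κ).bddAbove
  suffices hQ : InDimLT R (a ^ k • ⊤ : Submodule R M) n from
    (InDimLT.of_smul_mem (P := ⊤) (fun r hr x hx => smul_mem_smul hr hx) hQ
      (h.torsionBySet_pow k)).equiv topEquiv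
  refine inDimLT_iff.2 ⟨⊥, fg_bot, fun p hp ⟨x, hx⟩ => ?_⟩
  suffices ∃ s ∉ p.asIdeal, s • x = 0 by
    obtain ⟨s, hs, hs'⟩ := this
    exact ⟨s, hs, (mem_bot _).2 (Subtype.ext hs')⟩
  by_contra! hcon
  obtain ⟨q, hqp, hq, c, hc⟩ := exists_isPrime_smul_eq_zero_iff hcon
  have hqn : n ≤ ringKrullDim (R ⧸ q) := hp.trans
    (ringKrullDim_le_of_surjective (Ideal.Quotient.factor hqp)
      (Ideal.Quotient.factor_surjective hqp))
  have haq : a ≤ q := by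
    obtain ⟨j, hj⟩ := hM.ge (mem_top (x := c • x))
    exact Ideal.IsPrime.le_of_pow_le (n := j) fun r hr => (hc r).1 (hj r hr)
  have hcx : c • x ∈ torsionBySet R M (a : Set R) :=
    (mem_torsionBySet_iff _ _).2 fun r => (hc r).2 (haq r.2)
  obtain ⟨s, hs, hsN⟩ := hN' ⟨q, hq⟩ hqn ⟨c • x, hcx⟩
  have hqN : q ∈ associatedPrimes R N := isAssociatedPrime_iff_exists_smul_eq_zero_iff.2
    ⟨hq, ⟨_, hsN⟩, fun r => by
      rw [Subtype.ext_iff, Subtype.ext_iff]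
      change r • s • c • x = 0 ↔ _
      rw [← mul_smul, hc]
      exact ⟨fun h => (hq.mem_or_mem h).resolve_right hs, fun h => q.mul_mem_right _ h⟩⟩
  have hqk : κ ⟨q, hq⟩ ≤ k := hk ⟨⟨q, hq⟩, hqN, rfl⟩
  obtain ⟨u, hu, hux⟩ : ∃ u ∉ q, u • x = 0 := by
    refine smul_induction_on hx (fun r hr y _ => ?_) fun y z ⟨u, hu, hy⟩ ⟨v, hv, hz⟩ => ?_
    · exact hκ ⟨q, hq⟩ hqn r (Ideal.pow_le_pow_right hqk hr) y
    · refine ⟨u * v, fun h => (hq.mem_or_mem h).elim hu hv, ?_⟩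
      rw [smul_add, mul_smul u v z, hz, smul_zero, mul_comm, mul_smul, hy, smul_zero, add_zero]
  exact hu ((hc u).1 (by rw [smul_comm, hux, smul_zero]))

lemma InDimLT.localCohomology_of_lt [Module.Finite R M] {t i : ℕ} (ht : finDimN R a n M = t)
    (hi : i < t) : InDimLT R (localCohomology.of a i M) n := by
  induction i using Nat.strong_induction_on with
  | _ i ih =>
    have hExt (j) : InDimLT R (ModuleCat.extOf R j (R ⧸ a) M) n := InDimLT.of_finite.ext j _
    refine .of_torsionBySet (localCohomology.torsion_eq_top a M i)
      (((InDimLT.ext_localCohomology (t := i) (fun j _ => hExt j)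
        fun j hj => ih j hj (hj.trans hi)).1.equiv
          (ModuleCat.extZeroEquiv (R ⧸ a) _)).torsionBySet_of_hom) fun p hp => ?_
    by_cases hpa : a ≤ p.asIdeal
    · refine localCohomology.exists_pow_smul_eq_zero_of_finite_localization a
        p.asIdeal.primeCompl i M ?_
      by_cases hpM : p ∈ Module.support R M
      · by_contra hfin
        have h₁ : finDimN R a n M ≤ finDim (Localization.AtPrime p.asIdeal)
            (a.map (algebraMap R (Localization.AtPrime p.asIdeal)))
            (LocalizedModule p.asIdeal.primeCompl M) :=
          sInf_le ⟨p, by rw [Module.support_quotient]; exact ⟨hpM, hpa⟩, hp, rfl⟩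
        have h₂ : finDim (Localization.AtPrime p.asIdeal)
            (a.map (algebraMap R (Localization.AtPrime p.asIdeal)))
            (LocalizedModule p.asIdeal.primeCompl M) ≤ i := sInf_le ⟨i, hfin, rfl⟩
        exact hi.not_ge (Nat.cast_le.1 (ht.ge.trans (h₁.trans h₂)))
      · rw [Module.notMem_support_iff] at hpM
        have := localCohomology.subsingleton_of_subsingleton
          (a.map (algebraMap R (Localization p.asIdeal.primeCompl)))
          (LocalizedModule p.asIdeal.primeCompl M) i
        infer_instance
    · obtain ⟨s, hs, hsp⟩ := SetLike.not_le_iff_exists.1 hpa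
      refine ⟨0, fun r _ x => ?_⟩
      obtain ⟨k, hk⟩ := (localCohomology.torsion_eq_top a M i).ge (mem_top (x := x))
      refine ⟨s ^ k, fun h => hsp (p.2.mem_of_pow_mem k h), ?_⟩
      rw [smul_comm, hk _ (Ideal.pow_mem_pow hs k), smul_zero]

end

/-- If `t = f_a^n(M)` is finite, then `Ext_R^j(R/a, H^i_a(M))` is in dimension `< n` for all
`i < t` and all `j`, and moreover `Hom_R(R/a, H^t_a(M))` and `Ext_R^1(R/a, H^t_a(M))` are in
dimension `< n`. -/
theorem inDimLT_ext_locCoh (R : Type) [CommRing R] [IsNoetherianRing R] (a : Ideal R)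
    (M : Type) [AddCommGroup M] [Module R M] [Module.Finite R M]
    (n t : ℕ) (ht : finDimN R a n M = (t : ℕ∞)) :
    (∀ i < t, ∀ j : ℕ, InDimLT R
        ↥(((Ext R (ModuleCat R) j).obj
            (Opposite.op (ModuleCat.of R (R ⧸ a)))).obj (locCoh R a i M)) n) ∧
      InDimLT R ((R ⧸ a) →ₗ[R] ↥(locCoh R a t M)) n ∧
      InDimLT R
        ↥(((Ext R (ModuleCat R) 1).obj
            (Opposite.op (ModuleCat.of R (R ⧸ a)))).obj (locCoh R a t M)) n := by
  have hExt (j) : InDimLT R (ModuleCat.extOf R j (R ⧸ a) M) n := InDimLT.of_finite.ext j _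
  have hH (i) (hi : i < t) : InDimLT R (localCohomology.of a i M) n :=
    InDimLT.localCohomology_of_lt ht hi
  obtain ⟨h₀, h₁⟩ := InDimLT.ext_localCohomology (fun j _ => hExt j) hH
  exact ⟨fun i hi j => (hH i hi).ext j (R ⧸ a), h₀.equiv (ModuleCat.extZeroEquiv (R ⧸ a) _), h₁⟩
end
end

section
/- Let R be a commutative Noetherian ring, a an ideal of R, M a finitely generated R-module, n a non-negative integer, and set t = f_a^n(M). Then the set (Ass_R(H^t_a(M)))_{≥n} = { p ∈ Ass_R(H^t_a(M)) : dim R/p ≥ n } is finite. -/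
open CategoryTheory

noncomputable section

namespace CategoryTheory.ProjectiveResolution
variable {R : Type} [CommRing R]

def linearYonedaMap {K L : ChainComplex (ModuleCat.{0} R) ℕ} (φ : K ⟶ L) (Y : ModuleCat.{0} R) :
   L.linearYonedaObj R Y ⟶ K.linearYonedaObj R Y :=
  (HomologicalComplex.unopFunctor _ _).map
    ((((linearYoneda R (ModuleCat.{0} R)).obj Y).rightOp.mapHomologicalComplex _).map φ).op

lemma square_comp {D : Type*} [Category* D] {A A' B B' C C' : D} {l : A ⟶ A'} {m : B ⟶ B'}
    {r : C ⟶ C'} {i : A ⟶ B} {i' : A' ⟶ B'} {j : B ⟶ C} {j' : B' ⟶ C'}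
    (h : l ≫ i' = i ≫ m) (h' : j ≫ r = m ≫ j') : l ≫ (i' ≫ j') = (i ≫ j) ≫ r := by
  rw [reassoc_of% h, Category.assoc, h']

lemma square_unop {D : Type*} [Category* D] {A A' : Dᵒᵖ} {B B' : D} {m : A' ⟶ A}
    {g : B ⟶ B'} {e : A ≅ Opposite.op B} {e' : A' ≅ Opposite.op B'}
    (h : m ≫ e.hom = e'.hom ≫ g.op) : e.inv.unop ≫ g = m.unop ≫ e'.inv.unop := by
  apply Quiver.Hom.op_inj
  change g.op ≫ e.inv = e'.inv ≫ m
  rw [Iso.comp_inv_eq, Category.assoc, h, Iso.inv_hom_id_assoc]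

lemma isoExt_hom_naturality {X X' : ModuleCat.{0} R} (f : X' ⟶ X) (P : ProjectiveResolution X)
    (P' : ProjectiveResolution X') (φ : P'.complex ⟶ P.complex)
    (comm : φ.f 0 ≫ P.π.f 0 = P'.π.f 0 ≫ f) (n : ℕ) (Y : ModuleCat.{0} R) :
    ((Ext R (ModuleCat.{0} R) n).map f.op).app Y ≫ (P'.isoExt n Y).hom =
      (P.isoExt n Y).hom ≫ HomologicalComplex.homologyMap (linearYonedaMap φ Y) n :=
  square_comp
    (congrArg Quiver.Hom.unop (isoLeftDerivedObj_inv_naturality f P' P φ comm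
      ((linearYoneda R (ModuleCat.{0} R)).obj Y).rightOp n))
    (square_unop (HomologicalComplex.homologyOp_hom_naturality (linearYonedaMap φ Y) n))

/-- The submodule of `n`-cocycles. -/
def extCocycles {X : ModuleCat.{0} R} (P : ProjectiveResolution X) (n : ℕ) (Y : ModuleCat.{0} R) :
    Submodule R (P.complex.X n ⟶ Y) :=
  LinearMap.ker ((P.complex.linearYonedaObj R Y).d n (n + 1)).hom

lemma mem_extCocycles {X : ModuleCat.{0} R} (P : ProjectiveResolution X) (n : ℕ)
    (Y : ModuleCat.{0} R) (z : P.complex.X n ⟶ Y) :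
    z ∈ P.extCocycles n Y ↔ P.complex.d (n + 1) n ≫ z = 0 := Iff.rfl

def homologyClass (K : CochainComplex (ModuleCat.{0} R) ℕ) (n : ℕ) :
    ModuleCat.of R (LinearMap.ker (K.d n (n + 1)).hom) ⟶ K.homology n :=
  K.liftCycles (ModuleCat.ofHom (LinearMap.ker (K.d n (n + 1)).hom).subtype) (n + 1) (by simp)
    (by ext x; exact x.2) ≫ K.homologyπ n

lemma homologyClass_surjective (K : CochainComplex (ModuleCat.{0} R) ℕ) (n : ℕ) :
    Function.Surjective (homologyClass K n).hom := by
  intro y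
  obtain ⟨c, rfl⟩ := (ModuleCat.epi_iff_surjective (K.homologyπ n)).1 inferInstance y
  have hc : (K.d n (n + 1)).hom ((K.iCycles n).hom c) = 0 := by
    have := K.iCycles_d n (n + 1)
    exact congrArg (fun f => f.hom c) this
  refine ⟨⟨(K.iCycles n).hom c, hc⟩, ?_⟩
  have : (K.liftCycles (ModuleCat.ofHom (LinearMap.ker (K.d n (n + 1)).hom).subtype) (n + 1)
    (by simp) (by ext x; exact x.2)).hom ⟨(K.iCycles n).hom c, hc⟩ = c := by
    apply (ModuleCat.mono_iff_injective (K.iCycles n)).1 inferInstance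
    have := K.liftCycles_i (ModuleCat.ofHom (LinearMap.ker (K.d n (n + 1)).hom).subtype) (n + 1)
      (by simp) (by ext x; exact x.2)
    exact congrArg (fun f => f.hom ⟨(K.iCycles n).hom c, hc⟩) this
  simp only [homologyClass, ModuleCat.hom_comp, LinearMap.comp_apply]
  rw [this]

lemma homologyClass_eq_zero_iff (K : CochainComplex (ModuleCat.{0} R) ℕ) (n : ℕ)
    (z : LinearMap.ker (K.d n (n + 1)).hom) :
    (homologyClass K n).hom z = 0 ↔
      ∃ y, (K.d ((ComplexShape.up ℕ).prev n) n).hom y = z := by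
  have hi := K.liftCycles_i (ModuleCat.ofHom (LinearMap.ker (K.d n (n + 1)).hom).subtype) (n + 1)
      (by simp) (by ext x; exact x.2)
  have hi' := congrArg (fun f => f.hom z) hi
  have hT := K.toCycles_i ((ComplexShape.up ℕ).prev n) n
  have ex : (ShortComplex.mk (K.toCycles ((ComplexShape.up ℕ).prev n) n) (K.homologyπ n)
      (by simp)).Exact :=
    ShortComplex.exact_of_g_is_cokernel _ (K.homologyIsCokernel _ _ rfl)
  rw [ShortComplex.moduleCat_exact_iff] at ex
  have inj := (ModuleCat.mono_iff_injective (K.iCycles n)).1 inferInstance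
  constructor
  · intro h
    obtain ⟨y, hy⟩ := ex _ h
    refine ⟨y, ?_⟩
    rw [← hT]
    exact (congrArg (K.iCycles n).hom hy).trans hi'
  · rintro ⟨y, hy⟩
    have : (K.liftCycles (ModuleCat.ofHom (LinearMap.ker (K.d n (n + 1)).hom).subtype) (n + 1)
      (by simp) (by ext x; exact x.2)).hom z = (K.toCycles ((ComplexShape.up ℕ).prev n) n).hom y := by
      apply inj
      refine hi'.trans ?_
      rw [← hT] at hy
      exact hy.symm
    simp only [homologyClass, ModuleCat.hom_comp, LinearMap.comp_apply]
    rw [this]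
    exact congrArg (fun f => f.hom y) (K.toCycles_comp_homologyπ ((ComplexShape.up ℕ).prev n) n)

lemma homologyClass_naturality {K L : CochainComplex (ModuleCat.{0} R) ℕ} (ψ : K ⟶ L) (n : ℕ)
    (z : LinearMap.ker (K.d n (n + 1)).hom) (w : LinearMap.ker (L.d n (n + 1)).hom)
    (h : (ψ.f n).hom z = w) :
    (HomologicalComplex.homologyMap ψ n).hom ((homologyClass K n).hom z) =
      (homologyClass L n).hom w := by
  have inj := (ModuleCat.mono_iff_injective (L.iCycles n)).1 inferInstance
  have h1 := congrArg (fun f => f.hom z) <| K.liftCycles_i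
      (ModuleCat.ofHom (LinearMap.ker (K.d n (n + 1)).hom).subtype) (n + 1)
      (by simp) (by ext x; exact x.2)
  have h2 := congrArg (fun f => f.hom w) <| L.liftCycles_i
      (ModuleCat.ofHom (LinearMap.ker (L.d n (n + 1)).hom).subtype) (n + 1)
      (by simp) (by ext x; exact x.2)
  simp only [homologyClass, ModuleCat.hom_comp, LinearMap.comp_apply]
  refine (LinearMap.congr_fun (congrArg ModuleCat.Hom.hom
    (HomologicalComplex.homologyπ_naturality ψ n)) _).trans ?_
  change (L.homologyπ n).hom _ = _
  congr 1
  apply inj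
  refine Eq.trans ?_ h2.symm
  refine (LinearMap.congr_fun (congrArg ModuleCat.Hom.hom
    (HomologicalComplex.cyclesMap_i ψ n)) _).trans ?_
  exact (congrArg (ψ.f n).hom h1).trans h

/-- The `Ext` class of a cocycle. -/
def extClassOfCocycle {X : ModuleCat.{0} R} (P : ProjectiveResolution X) (n : ℕ)
    (Y : ModuleCat.{0} R) : P.extCocycles n Y →ₗ[R] Abelian.Ext.{0} X Y n where
  toFun z := P.extMk z.1 (n + 1) rfl z.2
  map_add' z w := (P.add_extMk _ _ _ _ _ _).symm
  map_smul' r z := by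
    have : P.extMk (r • z).1 (n + 1) rfl (r • z).2 =
      P.extMk (z.1 ≫ (r • 𝟙 Y)) (n + 1) rfl
        (by
          have h := (P.mem_extCocycles n Y _).1 (r • z).2
          rw [show z.1 ≫ (r • 𝟙 Y) = (r • z).1 by simp]
          exact h) := by
        congr 1
    rw [this, ← P.extMk_comp_mk₀ z.1 (n + 1) rfl z.2]
    simp [Abelian.Ext.mk₀_smul]

lemma extClassOfCocycle_surjective {X : ModuleCat.{0} R} (P : ProjectiveResolution X) (n : ℕ)
    (Y : ModuleCat.{0} R) : Function.Surjective (P.extClassOfCocycle n Y) := by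
  intro x
  obtain ⟨f, hf, rfl⟩ := P.extMk_surjective x (n + 1) rfl
  exact ⟨⟨f, hf⟩, rfl⟩

lemma extMk_zero_degree_eq_zero_iff {X Y : ModuleCat.{0} R} (P : ProjectiveResolution X)
    (f : P.complex.X 0 ⟶ Y) (hf : P.complex.d 1 0 ≫ f = 0) :
    (P.extMk f 1 rfl hf : Abelian.Ext.{0} X Y 0) = 0 ↔ f = 0 := by
  constructor
  · intro h
    rw [← P.extEquivCohomologyClass.apply_eq_iff_eq, extEquivCohomologyClass_extMk,
      extEquivCohomologyClass_zero, CochainComplex.HomComplex.CohomologyClass.mk_eq_zero_iff,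
      CochainComplex.HomComplex.Cocycle.toSingleMk_mem_coboundaries_iff _ _ _ _ _ 1 (by simp)] at h
    obtain ⟨g, hg⟩ := h
    have h0 : P.cochainComplex.d (-(0 : ℕ) : ℤ) 1 = 0 :=
      (CochainComplex.isZero_of_isStrictlyLE P.cochainComplex 0 1).eq_of_tgt _ _
    rw [h0, Limits.zero_comp] at hg
    rw [← cancel_epi (P.cochainComplexXIso (-(0 : ℕ) : ℤ) 0 rfl).hom, ← hg, Limits.comp_zero]
  · rintro rfl
    simp

lemma extClassOfCocycle_eq_zero_iff {X : ModuleCat.{0} R} (P : ProjectiveResolution X) (n : ℕ)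
    (Y : ModuleCat.{0} R) (z : P.extCocycles n Y) :
    P.extClassOfCocycle n Y z = 0 ↔
      ∃ y : P.complex.X ((ComplexShape.up ℕ).prev n) ⟶ Y,
        P.complex.d n ((ComplexShape.up ℕ).prev n) ≫ y = z := by
  cases n with
  | succ n =>
    have : (ComplexShape.up ℕ).prev (n + 1) = n := by simp
    rw [this]
    exact P.extMk_eq_zero_iff z.1 (n + 1 + 1) rfl z.2 n rfl
  | zero =>
    rw [show P.extClassOfCocycle 0 Y z = 0 ↔ z.1 = 0 from P.extMk_zero_degree_eq_zero_iff z.1 z.2]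
    have h2 : P.complex.d 0 ((ComplexShape.up ℕ).prev 0) = 0 := P.complex.shape _ _ (by simp)
    rw [h2]
    simp [eq_comm]

/-- The derived functor `Ext` class of a cocycle. -/
def derivedExtClassOfCocycle {X : ModuleCat.{0} R} (P : ProjectiveResolution X) (n : ℕ)
    (Y : ModuleCat.{0} R) :
    P.extCocycles n Y →ₗ[R] ((Ext R (ModuleCat.{0} R) n).obj (Opposite.op X)).obj Y :=
  (P.isoExt n Y).inv.hom ∘ₗ (homologyClass (P.complex.linearYonedaObj R Y) n).hom

lemma derivedExtClassOfCocycle_surjective {X : ModuleCat.{0} R} (P : ProjectiveResolution X)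
    (n : ℕ) (Y : ModuleCat.{0} R) : Function.Surjective (P.derivedExtClassOfCocycle n Y) :=
  ((P.isoExt n Y).toLinearEquiv.symm.surjective).comp (homologyClass_surjective _ _)

lemma derivedExtClassOfCocycle_eq_zero_iff {X : ModuleCat.{0} R} (P : ProjectiveResolution X)
    (n : ℕ) (Y : ModuleCat.{0} R) (z : P.extCocycles n Y) :
    P.derivedExtClassOfCocycle n Y z = 0 ↔
      ∃ y : P.complex.X ((ComplexShape.up ℕ).prev n) ⟶ Y,
        P.complex.d n ((ComplexShape.up ℕ).prev n) ≫ y = z :=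
  ((P.isoExt n Y).toLinearEquiv.symm.map_eq_zero_iff).trans
    (homologyClass_eq_zero_iff (P.complex.linearYonedaObj R Y) n z)

lemma ker_derivedExtClassOfCocycle {X : ModuleCat.{0} R} (P : ProjectiveResolution X)
    (n : ℕ) (Y : ModuleCat.{0} R) :
    LinearMap.ker (P.derivedExtClassOfCocycle n Y) = LinearMap.ker (P.extClassOfCocycle n Y) := by
  ext z
  exact (P.derivedExtClassOfCocycle_eq_zero_iff n Y z).trans
    (P.extClassOfCocycle_eq_zero_iff n Y z).symm

/-- Comparison of the two definitions of `Ext`. -/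
def derivedExtEquiv {X : ModuleCat.{0} R} (P : ProjectiveResolution X) (n : ℕ)
    (Y : ModuleCat.{0} R) :
    ((Ext R (ModuleCat.{0} R) n).obj (Opposite.op X)).obj Y ≃ₗ[R] Abelian.Ext.{0} X Y n :=
  (LinearMap.quotKerEquivOfSurjective _ (P.derivedExtClassOfCocycle_surjective n Y)).symm ≪≫ₗ
    Submodule.quotEquivOfEq _ _ (P.ker_derivedExtClassOfCocycle n Y) ≪≫ₗ
    LinearMap.quotKerEquivOfSurjective _ (P.extClassOfCocycle_surjective n Y)

lemma derivedExtEquiv_apply {X : ModuleCat.{0} R} (P : ProjectiveResolution X) (n : ℕ)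
    (Y : ModuleCat.{0} R) (z : P.extCocycles n Y) :
    P.derivedExtEquiv n Y (P.derivedExtClassOfCocycle n Y z) = P.extClassOfCocycle n Y z := by
  have : (LinearMap.quotKerEquivOfSurjective _ (P.derivedExtClassOfCocycle_surjective n Y)).symm
      (P.derivedExtClassOfCocycle n Y z) = Submodule.Quotient.mk z := by
    rw [LinearEquiv.symm_apply_eq]; rfl
  simp only [derivedExtEquiv, LinearEquiv.trans_apply, this]
  rfl

lemma derivedExtEquiv_naturality {X X' : ModuleCat.{0} R} (f : X' ⟶ X)
    (P : ProjectiveResolution X) (P' : ProjectiveResolution X') (n : ℕ) (Y : ModuleCat.{0} R)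
    (x : ((Ext R (ModuleCat.{0} R) n).obj (Opposite.op X)).obj Y) :
    P'.derivedExtEquiv n Y ((((Ext R (ModuleCat.{0} R) n).map f.op).app Y).hom x) =
      (Abelian.Ext.mk₀ f).comp (P.derivedExtEquiv n Y x) (zero_add n) := by
  obtain ⟨z, rfl⟩ := P.derivedExtClassOfCocycle_surjective n Y x
  let φ : Hom P' P f := ⟨lift f P' P, by
    have h := lift_commutes_zero f P' P
    simpa using h⟩
  have hw : φ.hom.f n ≫ z.1 ∈ P'.extCocycles n Y := by
    have := z.2
    rw [mem_extCocycles] at this ⊢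
    rw [← φ.hom.comm_assoc, this, Limits.comp_zero]
  have key : (((Ext R (ModuleCat.{0} R) n).map f.op).app Y).hom (P.derivedExtClassOfCocycle n Y z) =
      P'.derivedExtClassOfCocycle n Y ⟨_, hw⟩ := by
    apply (P'.isoExt n Y).toLinearEquiv.injective
    refine (LinearMap.congr_fun (congrArg ModuleCat.Hom.hom
      (isoExt_hom_naturality f P P' φ.hom (lift_commutes_zero f P' P) n Y)) _).trans ?_
    have e1 := (P.isoExt n Y).toLinearEquiv.apply_symm_apply
      ((homologyClass (P.complex.linearYonedaObj R Y) n).hom z)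
    have e2 := (P'.isoExt n Y).toLinearEquiv.apply_symm_apply
      ((homologyClass (P'.complex.linearYonedaObj R Y) n).hom ⟨_, hw⟩)
    refine Eq.trans ?_ e2.symm
    refine (congrArg (HomologicalComplex.homologyMap (linearYonedaMap φ.hom Y) n).hom e1).trans ?_
    exact homologyClass_naturality (linearYonedaMap φ.hom Y) n z ⟨_, hw⟩ rfl
  rw [key, derivedExtEquiv_apply, derivedExtEquiv_apply]
  exact (mk₀_comp_extMk (R := P) z.1 (n + 1) rfl z.2 φ).symm

end CategoryTheory.ProjectiveResolution

namespace LocCoh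
open Abelian
variable {R : Type} [CommRing R]

/-- The canonical surjection `R ⧸ J ⟶ R ⧸ I` for `J ≤ I`. -/
def quotMap {J I : Ideal R} (h : J ≤ I) : ModuleCat.of R (R ⧸ J) ⟶ ModuleCat.of R (R ⧸ I) :=
  ModuleCat.ofHom (Submodule.mapQ J I LinearMap.id h)

lemma quotMap_self (I : Ideal R) : quotMap (le_refl I) = 𝟙 _ := by
  ext; rfl

lemma quotMap_comp {J I K : Ideal R} (h : J ≤ I) (h' : I ≤ K) :
    quotMap h ≫ quotMap h' = quotMap (h.trans h') := by
  ext; rfl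

/-- Restriction of `Ext` classes along `R ⧸ J ⟶ R ⧸ I`. -/
def res {J I : Ideal R} (h : J ≤ I) (M : ModuleCat.{0} R) (i : ℕ) :
    Ext.{0} (ModuleCat.of R (R ⧸ I)) M i →ₗ[R] Ext.{0} (ModuleCat.of R (R ⧸ J)) M i :=
  (Ext.mk₀ (quotMap h)).precompOfLinear R M (zero_add i)

lemma res_apply {J I : Ideal R} (h : J ≤ I) (M : ModuleCat.{0} R) (i : ℕ)
    (x : Ext.{0} (ModuleCat.of R (R ⧸ I)) M i) :
    res h M i x = (Ext.mk₀ (quotMap h)).comp x (zero_add i) := rfl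

lemma res_self (I : Ideal R) (M : ModuleCat.{0} R) (i : ℕ)
    (x : Ext.{0} (ModuleCat.of R (R ⧸ I)) M i) : res (le_refl I) M i x = x := by
  rw [res_apply, quotMap_self, Ext.mk₀_id_comp]

lemma res_res {J I K : Ideal R} (h : J ≤ I) (h' : I ≤ K) (M : ModuleCat.{0} R) (i : ℕ)
    (x : Ext.{0} (ModuleCat.of R (R ⧸ K)) M i) :
    res h M i (res h' M i x) = res (h.trans h') M i x := by
  rw [res_apply, res_apply, res_apply, ← quotMap_comp h h', Ext.mk₀_comp_mk₀_assoc]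

/-- Restriction commutes with composition on the right. -/
lemma res_comp {J I : Ideal R} (h : J ≤ I) {M N : ModuleCat.{0} R} {i j k : ℕ}
    (x : Ext.{0} (ModuleCat.of R (R ⧸ I)) M i) (y : Ext.{0} M N j) (hij : i + j = k) :
    res h N k (x.comp y hij) = (res h M i x).comp y hij := by
  rw [res_apply, res_apply, Ext.comp_assoc]
  omega

abbrev powExt (a : Ideal R) (M : ModuleCat.{0} R) (i k : ℕ) : Type :=
  Ext.{0} (ModuleCat.of R (R ⧸ a ^ k)) M i

abbrev powRes (a : Ideal R) (M : ModuleCat.{0} R) (i k l : ℕ) (h : k ≤ l) :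
    powExt a M i k →ₗ[R] powExt a M i l :=
  res (Ideal.pow_le_pow_right h) M i

instance (a : Ideal R) (M : ModuleCat.{0} R) (i : ℕ) :
    DirectedSystem (powExt a M i) fun k l h => powRes a M i k l h where
  map_self _ x := res_self _ _ _ x
  map_map _ _ _ _ _ x := res_res _ _ _ _ x

/-- Local cohomology as a direct limit of `Ext` modules. -/
abbrev DL (a : Ideal R) (i : ℕ) (M : ModuleCat.{0} R) : Type :=
  Module.DirectLimit (powExt a M i) (powRes a M i)

/-- The structure maps. -/
abbrev DLof (a : Ideal R) (i : ℕ) (M : ModuleCat.{0} R) (k : ℕ) : powExt a M i k →ₗ[R] DL a i M :=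
  Module.DirectLimit.of R ℕ (powExt a M i) (powRes a M i) k

lemma DLof_res (a : Ideal R) (i : ℕ) (M : ModuleCat.{0} R) {k l : ℕ} (h : k ≤ l)
    (x : powExt a M i k) : DLof a i M l (powRes a M i k l h x) = DLof a i M k x :=
  Module.DirectLimit.of_f

lemma exists_DLof (a : Ideal R) (i : ℕ) (M : ModuleCat.{0} R) (z : DL a i M) :
    ∃ k x, DLof a i M k x = z := Module.DirectLimit.exists_of z

lemma DLof_eq_zero (a : Ideal R) (i : ℕ) (M : ModuleCat.{0} R) {k : ℕ} {x : powExt a M i k}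
    (h : DLof a i M k x = 0) : ∃ l, ∃ h : k ≤ l, powRes a M i k l h x = 0 :=
  Module.DirectLimit.of.zero_exact h

/-- Projective resolutions of the modules `R ⧸ a ^ k`. -/
def resol (a : Ideal R) (k : ℕ) : ProjectiveResolution (ModuleCat.of R (R ⧸ a ^ k)) :=
  projectiveResolution _

lemma derived_res (a : Ideal R) (M : ModuleCat.{0} R) (i : ℕ) {k l : ℕ} (h : k ≤ l)
    (x : ((Ext R (ModuleCat.{0} R) i).obj (Opposite.op (ModuleCat.of R (R ⧸ a ^ k)))).obj M) :
    (resol a l).derivedExtEquiv i M ((((Ext R (ModuleCat.{0} R) i).map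
      (quotMap (Ideal.pow_le_pow_right h)).op).app M).hom x) =
    powRes a M i k l h ((resol a k).derivedExtEquiv i M x) :=
  ProjectiveResolution.derivedExtEquiv_naturality _ _ _ _ _ _

def locCohCocone (a : Ideal R) (i : ℕ) (M : ModuleCat.{0} R) :
    Limits.Cocone (localCohomology.diagram (localCohomology.idealPowersDiagram a) i ⋙
      (evaluation _ _).obj M) :=
  ((evaluation _ _).obj M).mapCocone (Limits.colimit.cocone _)

def locCohCoconeIsColimit (a : Ideal R) (i : ℕ) (M : ModuleCat.{0} R) :
    Limits.IsColimit (locCohCocone a i M) :=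
  have := localCohomology.hasColimitDiagram.{0, 0} (localCohomology.idealPowersDiagram a) i
  Limits.isColimitOfPreserves _ (Limits.colimit.isColimit _)

/-- The structure maps of local cohomology. -/
def locCohOf (a : Ideal R) (i : ℕ) (M : ModuleCat.{0} R) (k : ℕ) :
    powExt a M i k →ₗ[R] (locCohCocone a i M).pt :=
  ((locCohCocone a i M).ι.app (Opposite.op (Opposite.op k))).hom ∘ₗ
    ((resol a k).derivedExtEquiv i M).symm.toLinearMap

lemma locCohOf_derivedExtEquiv (a : Ideal R) (i : ℕ) (M : ModuleCat.{0} R) (k : ℕ)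
    (y : ((Ext R (ModuleCat.{0} R) i).obj (Opposite.op (ModuleCat.of R (R ⧸ a ^ k)))).obj M) :
    locCohOf a i M k ((resol a k).derivedExtEquiv i M y) =
      ((locCohCocone a i M).ι.app (Opposite.op (Opposite.op k))).hom y :=
  congrArg ((locCohCocone a i M).ι.app (Opposite.op (Opposite.op k))).hom
    (((resol a k).derivedExtEquiv i M).symm_apply_apply y)

lemma locCohOf_res (a : Ideal R) (i : ℕ) (M : ModuleCat.{0} R) {k l : ℕ} (h : k ≤ l)
    (x : powExt a M i k) :
    locCohOf a i M l (powRes a M i k l h x) = locCohOf a i M k x := by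
  obtain ⟨y, rfl⟩ := ((resol a k).derivedExtEquiv i M).surjective x
  rw [← derived_res, locCohOf_derivedExtEquiv, locCohOf_derivedExtEquiv]
  exact LinearMap.congr_fun (congrArg ModuleCat.Hom.hom
    ((locCohCocone a i M).w (homOfLE h).op.op)) y

lemma exists_locCohOf (a : Ideal R) (i : ℕ) (M : ModuleCat.{0} R)
    (z : (locCohCocone a i M).pt) : ∃ k x, locCohOf a i M k x = z := by
  obtain ⟨k, y, hy⟩ := Limits.Concrete.isColimit_exists_rep _ (locCohCoconeIsColimit a i M) z
  refine ⟨k.unop.unop, (resol a _).derivedExtEquiv i M y, ?_⟩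
  exact (locCohOf_derivedExtEquiv a i M k.unop.unop y).trans hy

lemma exists_map_eq_zero_of_isColimit {J : Type} [SmallCategory J] [IsFiltered J]
    {F : J ⥤ ModuleCat.{0} R} {t : Limits.Cocone F} (ht : Limits.IsColimit t) {i : J} (y : F.obj i)
    (hy : (t.ι.app i).hom y = 0) : ∃ (j : J) (f : i ⟶ j), (F.map f).hom y = 0 := by
  obtain ⟨j, f, hf⟩ := (Limits.IsColimit.eq_iff' ht y 0).1
    (hy.trans (t.ι.app i).hom.map_zero.symm)
  exact ⟨j, f, hf.trans (F.map f).hom.map_zero⟩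

lemma exists_derived_eq_zero (a : Ideal R) (i : ℕ) (M : ModuleCat.{0} R) {k : ℕ}
    (y : ((Ext R (ModuleCat.{0} R) i).obj (Opposite.op (ModuleCat.of R (R ⧸ a ^ k)))).obj M)
    (hy : ((locCohCocone a i M).ι.app (Opposite.op (Opposite.op k))).hom y = 0) :
    ∃ l, ∃ h : k ≤ l, (((Ext R (ModuleCat.{0} R) i).map
      (quotMap (Ideal.pow_le_pow_right (I := a) h)).op).app M).hom y = 0 := by
  obtain ⟨l, f, hl⟩ := exists_map_eq_zero_of_isColimit (locCohCoconeIsColimit a i M)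
    (i := Opposite.op (Opposite.op k)) y hy
  exact ⟨l.unop.unop, leOfHom f.unop.unop, hl⟩

lemma locCohOf_eq_zero (a : Ideal R) (i : ℕ) (M : ModuleCat.{0} R) {k : ℕ} {x : powExt a M i k}
    (hx : locCohOf a i M k x = 0) : ∃ l, ∃ h : k ≤ l, powRes a M i k l h x = 0 := by
  obtain ⟨y, rfl⟩ := ((resol a k).derivedExtEquiv i M).surjective x
  rw [locCohOf_derivedExtEquiv] at hx
  obtain ⟨l, h, hl⟩ := exists_derived_eq_zero a i M y hx
  refine ⟨l, h, ?_⟩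
  rw [← derived_res, hl, map_zero]

/-- The direct limit of `Ext` modules computes local cohomology. -/
def locCohEquiv (a : Ideal R) (i : ℕ) (M : Type) [AddCommGroup M] [Module R M] :
    DL a i (ModuleCat.of R M) ≃ₗ[R] locCoh R a i M :=
  LinearEquiv.ofBijective (M₂ := (locCohCocone a i (ModuleCat.of R M)).pt)
    (Module.DirectLimit.lift R ℕ _ _ (locCohOf a i (ModuleCat.of R M))
      fun _ _ h x => locCohOf_res a i _ h x) <| by
    constructor
    · rw [injective_iff_map_eq_zero]
      intro z hz
      obtain ⟨k, x, rfl⟩ := exists_DLof _ _ _ z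
      rw [Module.DirectLimit.lift_of] at hz
      obtain ⟨l, h, hl⟩ := locCohOf_eq_zero _ _ _ hz
      rw [← DLof_res a i _ h, hl, map_zero]
    · intro z
      obtain ⟨k, x, rfl⟩ := exists_locCohOf _ _ _ z
      exact ⟨DLof _ _ _ k x, Module.DirectLimit.lift_of ..⟩

end LocCoh

namespace LocCoh
variable {R : Type} [CommRing R]

/-- `K` is finitely generated up to modules vanishing at all primes in `S`. -/
def AlmostFinite (S : Set (PrimeSpectrum R)) (K : Type) [AddCommGroup K] [Module R K] : Prop :=
  ∃ N : Submodule R K, N.FG ∧ ∀ p ∈ S, ∀ x : K, ∃ s ∉ p.asIdeal, s • x ∈ N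

namespace AlmostFinite
variable {S : Set (PrimeSpectrum R)} {A B C : Type} [AddCommGroup A] [Module R A]
  [AddCommGroup B] [Module R B] [AddCommGroup C] [Module R C]

lemma one_notMem_asIdeal (p : PrimeSpectrum R) : (1 : R) ∉ p.asIdeal :=
  fun h => p.2.ne_top ((Ideal.eq_top_iff_one _).2 h)

lemma of_finite [Module.Finite R A] : AlmostFinite S A :=
  ⟨⊤, Module.Finite.fg_top, fun p _ x => ⟨1, one_notMem_asIdeal p, by simp⟩⟩

lemma of_locally_zero (h : ∀ p ∈ S, ∀ x : A, ∃ s ∉ p.asIdeal, s • x = 0) : AlmostFinite S A :=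
  ⟨⊥, Submodule.fg_bot, h⟩

lemma of_surjective (f : A →ₗ[R] B) (hf : Function.Surjective f) (h : AlmostFinite S A) :
    AlmostFinite S B := by
  obtain ⟨N, hN, h⟩ := h
  refine ⟨N.map f, hN.map f, fun p hp y => ?_⟩
  obtain ⟨x, rfl⟩ := hf y
  obtain ⟨s, hs, hx⟩ := h p hp x
  exact ⟨s, hs, s • x, hx, map_smul f s x⟩

lemma fg_of_le [IsNoetherianRing R] {N N' : Submodule R A} (h : N' ≤ N) (hN : N.FG) : N'.FG := by
  have : Module.Finite R N := Module.Finite.iff_fg.2 hN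
  have := IsNoetherian.noetherian (N'.comap N.subtype)
  have h2 := this.map N.subtype
  rwa [Submodule.map_comap_subtype, inf_eq_right.2 h] at h2

lemma of_injective [IsNoetherianRing R] (f : A →ₗ[R] B) (hf : Function.Injective f)
    (h : AlmostFinite S B) : AlmostFinite S A := by
  obtain ⟨N, hN, h⟩ := h
  refine ⟨N.comap f, Submodule.fg_of_fg_map_injective f hf
    (fg_of_le (Submodule.map_comap_le f N) hN), fun p hp y => ?_⟩
  obtain ⟨s, hs, hx⟩ := h p hp (f y)
  exact ⟨s, hs, by simpa using hx⟩

lemma exists_fg_map_eq (g : B →ₗ[R] C) (N : Submodule R C) (hN : N.FG)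
    (h : N ≤ LinearMap.range g) : ∃ N' : Submodule R B, N'.FG ∧ N'.map g = N := by
  obtain ⟨T, rfl⟩ := hN
  have hT : ∀ t : T, ∃ b, g b = t := fun t => h (Submodule.subset_span t.2)
  choose φ hφ using hT
  refine ⟨Submodule.span R (Set.range φ), Submodule.fg_span (Set.finite_range φ), ?_⟩
  rw [Submodule.map_span, ← Set.range_comp]
  congr 1
  ext x
  constructor
  · rintro ⟨t, rfl⟩
    simp [hφ]
  · intro hx
    exact ⟨⟨x, hx⟩, hφ _⟩

lemma of_exact [IsNoetherianRing R] (f : A →ₗ[R] B) (g : B →ₗ[R] C)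
    (hfg : ∀ y, g y = 0 → ∃ x, f x = y) (hA : AlmostFinite S A) (hC : AlmostFinite S C) :
    AlmostFinite S B := by
  obtain ⟨NA, hNA, hA⟩ := hA
  obtain ⟨NC, hNC, hC⟩ := hC
  obtain ⟨N', hN', hN''⟩ := exists_fg_map_eq g (NC ⊓ LinearMap.range g)
    (fg_of_le inf_le_left hNC) inf_le_right
  refine ⟨NA.map f ⊔ N', (hNA.map f).sup hN', fun p hp x => ?_⟩
  obtain ⟨s, hs, hx⟩ := hC p hp (g x)
  have h1 : s • g x ∈ NC ⊓ LinearMap.range g := ⟨hx, s • x, map_smul g s x⟩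
  rw [← hN''] at h1
  obtain ⟨y, hy, hyx⟩ := h1
  obtain ⟨a, ha⟩ := hfg (s • x - y) (by rw [map_sub, map_smul, hyx, sub_self])
  obtain ⟨s', hs', hx'⟩ := hA p hp a
  refine ⟨s' * s, fun h => (p.2.mem_or_mem h).elim hs' hs, ?_⟩
  rw [mul_smul, show s • x = f a + y by rw [ha]; abel, smul_add, ← map_smul]
  exact Submodule.add_mem_sup (Submodule.mem_map_of_mem hx') (N'.smul_mem _ hy)

lemma pi {r : ℕ} (h : AlmostFinite S A) : AlmostFinite S (Fin r → A) := by
  obtain ⟨N, hN, h⟩ := h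
  refine ⟨Submodule.pi Set.univ fun _ => N, Submodule.fg_pi fun _ => hN, fun p hp x => ?_⟩
  choose s hs hx using fun i => h p hp (x i)
  refine ⟨∏ i, s i, fun hmem => ?_, fun i _ => ?_⟩
  · obtain ⟨i, _, hi⟩ := p.2.prod_mem_iff.1 hmem
    exact hs i hi
  · rw [Pi.smul_apply, ← Finset.prod_erase_mul _ _ (Finset.mem_univ i), mul_smul]
    exact N.smul_mem _ (hx i)

lemma equiv (e : A ≃ₗ[R] B) (h : AlmostFinite S A) : AlmostFinite S B :=
  of_surjective e.toLinearMap e.surjective h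

lemma of_subsingleton [Subsingleton A] : AlmostFinite S A :=
  of_locally_zero fun p _ _ => ⟨1, one_notMem_asIdeal p, Subsingleton.elim _ _⟩

open Abelian in
lemma ext [IsNoetherianRing R] {K : ModuleCat.{0} R} (hK : AlmostFinite S K) (N : ModuleCat.{0} R)
    [Module.Finite R N] (i : ℕ) : AlmostFinite S (Ext.{0} N K i) := by
  have h0 : ∀ (N : ModuleCat.{0} R) [Module.Finite R N], AlmostFinite S (Ext.{0} N K 0) := by
    intro N _
    refine equiv (Ext.linearEquiv₀ (R := R).trans ModuleCat.homLinearEquiv).symm ?_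
    obtain ⟨r, f, hf⟩ := Module.Finite.exists_fin' R N
    refine of_injective ((LinearMap.pi fun i => LinearMap.applyₗ (f (Pi.single i 1))) :
      (N →ₗ[R] K) →ₗ[R] (Fin r → K)) ?_ hK.pi
    intro φ ψ h
    rw [← LinearMap.cancel_right hf]
    ext i
    exact congrFun h i
  induction i generalizing N with
  | zero => exact h0 N
  | succ n ih =>
    obtain ⟨N, _, _, _, _, f, surjf⟩ := Module.exists_finite_presentation R N
    let exac := LinearMap.shortExact_shortComplexKer surjf
    exact of_surjective (exac.extClass.precompOfLinear R K (add_comm 1 n))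
      (precomp_extClass_surjective_of_projective_X₂ K exac n) (ih _)

lemma finite_associatedPrimes [IsNoetherianRing R] (h : AlmostFinite S A) :
    {p ∈ S | p.asIdeal ∈ associatedPrimes R A}.Finite := by
  obtain ⟨N, hN, h⟩ := h
  have : Module.Finite R N := Module.Finite.iff_fg.2 hN
  refine ((associatedPrimes.finite R N).preimage (f := PrimeSpectrum.asIdeal)
    fun _ _ _ _ h => PrimeSpectrum.ext h).subset ?_
  rintro p ⟨hp, hpA⟩
  obtain ⟨_, x, hx⟩ := (isAssociatedPrime_iff (R := R)).1 (AssociatedPrimes.mem_iff.1 hpA)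
  obtain ⟨s, hs, hsx⟩ := h p hp x
  refine AssociatedPrimes.mem_iff.2 ((isAssociatedPrime_iff (R := R)).2 ⟨p.2, ⟨s • x, hsx⟩, ?_⟩)
  have hx' : ∀ r, r ∈ p.asIdeal ↔ r • x = 0 := fun r => by
    rw [hx, Submodule.mem_colon_singleton, Submodule.mem_bot]
  ext r
  rw [Submodule.mem_colon_singleton, Submodule.mem_bot, Subtype.ext_iff]
  change _ ↔ r • s • x = 0
  rw [smul_smul, ← hx']
  exact ⟨fun h => Ideal.mul_mem_right _ _ h, fun h => (p.2.mem_or_mem h).resolve_right hs⟩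

lemma _root_.Ideal.exists_fin_generators [IsNoetherianRing R] (I : Ideal R) :
    ∃ (r : ℕ) (g : Fin r → R), (∀ i, g i ∈ I) ∧
      ∀ x : A, (∀ i, g i • x = 0) → ∀ c ∈ I, c • x = 0 := by
  obtain ⟨r, g, hg⟩ := Submodule.fg_iff_exists_fin_generating_family.1
    (IsNoetherian.noetherian I)
  refine ⟨r, g, fun i => hg ▸ Submodule.subset_span ⟨i, rfl⟩, fun x hx c hc => ?_⟩
  have : I ≤ LinearMap.ker (LinearMap.toSpanSingleton R A x) := by
    rw [← hg, Submodule.span_le]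
    rintro _ ⟨i, rfl⟩
    exact hx i
  exact this hc

lemma torsionBySet_pow [IsNoetherianRing R] (a : Ideal R)
    (h : AlmostFinite S (Submodule.torsionBySet R A (a : Set R))) (m : ℕ) :
    AlmostFinite S (Submodule.torsionBySet R A (a ^ m : Ideal R)) := by
  induction m with
  | zero =>
    have : Subsingleton (Submodule.torsionBySet R A ((a ^ 0 : Ideal R) : Set R)) :=
      ⟨fun x y => by
        have hx := (Submodule.mem_torsionBySet_iff _ _).1 x.2 ⟨1, by simp⟩
        have hy := (Submodule.mem_torsionBySet_iff _ _).1 y.2 ⟨1, by simp⟩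
        simp only [one_smul] at hx hy
        exact Subtype.ext (hx.trans hy.symm)⟩
    exact of_subsingleton
  | succ m ih =>
    obtain ⟨r, g, hg, hg'⟩ := Ideal.exists_fin_generators (A := A) a
    have le : Submodule.torsionBySet R A (a : Set R) ≤
        Submodule.torsionBySet R A ((a ^ (m + 1) : Ideal R) : Set R) :=
      Submodule.torsionBySet_le_torsionBySet_of_subset (Ideal.pow_le_self (by omega))
    have mem : ∀ (x : Submodule.torsionBySet R A ((a ^ (m + 1) : Ideal R) : Set R)) (i : Fin r),
        g i • (x : A) ∈ Submodule.torsionBySet R A ((a ^ m : Ideal R) : Set R) := fun x i => by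
      rw [Submodule.mem_torsionBySet_iff]
      rintro ⟨c, hc⟩
      change c • g i • (x : A) = 0
      rw [smul_smul]
      exact (Submodule.mem_torsionBySet_iff _ _).1 x.2
        ⟨c * g i, by rw [pow_succ]; exact Ideal.mul_mem_mul hc (hg i)⟩
    refine of_exact (Submodule.inclusion le) (LinearMap.pi fun i =>
      ((g i • LinearMap.id).comp (Submodule.subtype _)).codRestrict _ (fun x => mem x i))
      (fun y hy => ⟨⟨y, ?_⟩, rfl⟩) h (pi ih)
    rw [Submodule.mem_torsionBySet_iff]
    exact fun c => hg' y (fun i => congrArg Subtype.val (congrFun hy i)) c.1 c.2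

/-- The submodule of elements vanishing locally at all primes of `S`. -/
def locallyZero (S : Set (PrimeSpectrum R)) (A : Type) [AddCommGroup A] [Module R A] :
    Submodule R A where
  carrier := {x | ∀ p ∈ S, ∃ s ∉ p.asIdeal, s • x = 0}
  zero_mem' p _ := ⟨1, one_notMem_asIdeal p, by simp⟩
  add_mem' hx hy p hp := by
    obtain ⟨s, hs, hx⟩ := hx p hp
    obtain ⟨t, ht, hy⟩ := hy p hp
    refine ⟨s * t, fun h => (p.2.mem_or_mem h).elim hs ht, ?_⟩
    rw [smul_add, mul_smul, mul_smul, hy, smul_comm, hx]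
    simp
  smul_mem' c x hx p hp := by
    obtain ⟨s, hs, hx⟩ := hx p hp
    exact ⟨s, hs, by rw [smul_comm, hx, smul_zero]⟩

lemma associatedPrimes_torsionBySet [IsNoetherianRing R] (a : Ideal R)
    (htors : ∀ x : A, ∃ k, ∀ r ∈ a ^ k, r • x = 0) (p : PrimeSpectrum R)
    (hp : p.asIdeal ∈ associatedPrimes R A) : a ≤ p.asIdeal ∧
      p.asIdeal ∈ associatedPrimes R (Submodule.torsionBySet R A (a : Set R)) := by
  obtain ⟨_, x, hx⟩ := (isAssociatedPrime_iff (R := R)).1 (AssociatedPrimes.mem_iff.1 hp)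
  have hx' : ∀ r, r ∈ p.asIdeal ↔ r • x = 0 := fun r => by
    rw [hx, Submodule.mem_colon_singleton, Submodule.mem_bot]
  obtain ⟨k, hk⟩ := htors x
  have hap : a ≤ p.asIdeal := p.2.le_of_pow_le fun r hr => (hx' r).2 (hk r hr)
  refine ⟨hap, AssociatedPrimes.mem_iff.2
    ((isAssociatedPrime_iff (R := R)).2 ⟨p.2, ⟨x, ?_⟩, ?_⟩)⟩
  · rw [Submodule.mem_torsionBySet_iff]
    exact fun c => (hx' _).1 (hap c.2)
  · ext r
    rw [Submodule.mem_colon_singleton, Submodule.mem_bot, Subtype.ext_iff]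
    exact hx' r

/-- A torsion module with almost finite socle whose localizations have bounded torsion is
almost finite. -/
lemma of_torsionBySet [IsNoetherianRing R] (a : Ideal R)
    (hS : ∀ p ∈ S, ∀ q : PrimeSpectrum R, q ≤ p → a ≤ q.asIdeal → q ∈ S)
    (htors : ∀ x : A, ∃ k, ∀ r ∈ a ^ k, r • x = 0)
    (h : AlmostFinite S (Submodule.torsionBySet R A (a : Set R)))
    (hbd : ∀ p ∈ S, ∃ m, ∀ x : A, ∀ r ∈ a ^ m, ∃ s ∉ p.asIdeal, s • r • x = 0) :
    AlmostFinite S A := by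
  have hF : {p ∈ S | p.asIdeal ∈ associatedPrimes R A}.Finite := by
    refine h.finite_associatedPrimes.subset ?_
    rintro p ⟨hp, hpA⟩
    exact ⟨hp, (associatedPrimes_torsionBySet a htors p hpA).2⟩
  choose! m hm using hbd
  obtain ⟨B, hB⟩ := (hF.image m).bddAbove
  have hloc : ∀ (x : A), ∀ r ∈ a ^ B, r • x ∈ locallyZero S A := by
    intro x r hr p hp
    by_contra! hcon
    have hle : Submodule.colon (⊥ : Submodule R A) {r • x} ≤ p.asIdeal := fun c hc => by
      by_contra hcp
      exact hcon c hcp (by simpa [Submodule.mem_colon_singleton] using hc)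
    obtain ⟨q, hq, hqp⟩ := Ideal.exists_minimalPrimes_le hle
    have hqprime : q.IsPrime := hq.1.1
    obtain ⟨z, hz⟩ := Submodule.exists_eq_colon_of_mem_minimalPrimes hq
    obtain ⟨k, hk⟩ := htors (r • x)
    have haq : a ≤ q := hqprime.le_of_pow_le fun c hc => hq.1.2 (by
      rw [Submodule.mem_colon_singleton, Submodule.mem_bot]
      exact hk c hc)
    have hqS : (⟨q, hqprime⟩ : PrimeSpectrum R) ∈ S := hS p hp _ hqp haq
    have hqF : m ⟨q, hqprime⟩ ≤ B := hB ⟨_, ⟨hqS,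
      AssociatedPrimes.mem_iff.2 ((isAssociatedPrime_iff (R := R)).2 ⟨hqprime, z, hz⟩)⟩, rfl⟩
    obtain ⟨s, hs, hsx⟩ := hm _ hqS x r (Ideal.pow_le_pow_right hqF hr)
    exact hs (hq.1.2 (by rwa [Submodule.mem_colon_singleton, Submodule.mem_bot]))
  obtain ⟨r, g, hg, hg'⟩ := Ideal.exists_fin_generators (A := A) (a ^ B)
  refine of_exact (Submodule.subtype (Submodule.torsionBySet R A ((a ^ B : Ideal R) : Set R)))
    (LinearMap.pi fun i => (g i • LinearMap.id).codRestrict (locallyZero S A)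
      fun x => hloc x _ (hg i)) (fun y hy => ⟨⟨y, ?_⟩, rfl⟩) (h.torsionBySet_pow a B)
    (pi (of_locally_zero fun p hp x => ?_))
  · rw [Submodule.mem_torsionBySet_iff]
    exact fun c => hg' y (fun i => congrArg Subtype.val (congrFun hy i)) c.1 c.2
  · obtain ⟨s, hs, hx⟩ := x.2 p hp
    exact ⟨s, hs, Subtype.ext hx⟩

end AlmostFinite
end LocCoh

namespace LocCoh
variable {R : Type} [CommRing R]

/-- The `a`-torsion submodule `Γ_a(E)`. -/
def gamma (a : Ideal R) (E : Type) [AddCommGroup E] [Module R E] : Submodule R E where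
  carrier := {x | ∃ k, ∀ r ∈ a ^ k, r • x = 0}
  zero_mem' := ⟨0, fun r _ => smul_zero r⟩
  add_mem' := by
    rintro x y ⟨k, hk⟩ ⟨l, hl⟩
    refine ⟨max k l, fun r hr => ?_⟩
    rw [smul_add, hk r (Ideal.pow_le_pow_right (le_max_left _ _) hr),
      hl r (Ideal.pow_le_pow_right (le_max_right _ _) hr), add_zero]
  smul_mem' := by
    rintro c x ⟨k, hk⟩
    exact ⟨k, fun r hr => by rw [smul_comm, hk r hr, smul_zero]⟩

variable (a : Ideal R) (E : Type) [AddCommGroup E] [Module R E]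

lemma gamma_gamma (x : gamma a E) : x ∈ gamma a (gamma a E) := by
  obtain ⟨k, hk⟩ := x.2
  exact ⟨k, fun r hr => Subtype.ext (hk r hr)⟩

lemma exists_bound_of_fg [IsNoetherianRing R] {M : Type} [AddCommGroup M] [Module R M]
    [Module.Finite R M] (h : ∀ x : M, x ∈ gamma a M) : ∃ k, ∀ x : M, ∀ r ∈ a ^ k, r • x = 0 := by
  obtain ⟨T, hT⟩ := Module.Finite.fg_top (R := R) (M := M)
  choose k hk using h
  refine ⟨T.sup k, fun x r hr => ?_⟩
  have : (⊤ : Submodule R M) ≤ LinearMap.ker (r • (LinearMap.id : M →ₗ[R] M)) := by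
    rw [← hT, Submodule.span_le]
    exact fun t ht => hk t r (Ideal.pow_le_pow_right (Finset.le_sup ht) hr)
  exact this (x := x) trivial

lemma gamma_injective [IsNoetherianRing R] [Module.Injective R E] :
    Module.Injective R (gamma a E) := by
  refine Module.Baer.injective fun I g => ?_
  obtain ⟨c, hc⟩ := exists_bound_of_fg a (M := LinearMap.range g) (by
    rintro ⟨x, hx⟩
    obtain ⟨k, hk⟩ := gamma_gamma a E x
    exact ⟨k, fun r hr => Subtype.ext (hk r hr)⟩)
  obtain ⟨k, hk⟩ := Ideal.exists_pow_inf_eq_pow_smul a (M := R) I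
  let n := k + c
  have hn : a ^ n ⊓ I ≤ a ^ c * I := by
    have := hk n (by omega)
    simp only [Ideal.smul_eq_mul, Ideal.mul_top] at this
    rw [this, show n - k = c by omega]
    exact Ideal.mul_mono_right inf_le_right
  have hg : ∀ x : I, (x : R) ∈ a ^ n → g x = 0 := by
    have key : a ^ c * I ≤ (LinearMap.ker g).map I.subtype := by
      rw [Ideal.mul_le]
      intro r hr s hs
      refine ⟨r • ⟨s, hs⟩, ?_, rfl⟩
      change g _ = 0
      rw [map_smul]
      exact congrArg Subtype.val (hc ⟨g ⟨s, hs⟩, ⟨s, hs⟩, rfl⟩ r hr)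
    intro x hx
    obtain ⟨y, hy, hyx⟩ := key (hn ⟨hx, x.2⟩)
    rwa [← show y = x from Subtype.ext hyx]
  let K : Submodule R I := Submodule.comap I.subtype (a ^ n)
  let ι : (I ⧸ K) →ₗ[R] R ⧸ (a ^ n) := Submodule.mapQ K (a ^ n) I.subtype le_rfl
  have hι : Function.Injective ι := by
    rw [← LinearMap.ker_eq_bot, Submodule.ker_mapQ]
    exact Submodule.mkQ_map_self K
  let g' : (I ⧸ K) →ₗ[R] E := K.liftQ ((gamma a E).subtype ∘ₗ g) fun x hx => by
    change ((g x : gamma a E) : E) = 0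
    rw [hg x hx]; rfl
  obtain ⟨h, hh⟩ := Module.Injective.out ι hι g'
  refine ⟨(h ∘ₗ (a ^ n).mkQ).codRestrict _ fun x => ⟨n, fun r hr => ?_⟩, fun x hx => ?_⟩
  · change r • h _ = 0
    rw [← map_smul, ← map_smul, LinearMap.congr_arg (f := h)
      (show (a ^ n).mkQ (r • x) = 0 by
        rw [Submodule.mkQ_apply, Submodule.Quotient.mk_eq_zero]
        exact Ideal.mul_mem_right _ _ hr), map_zero]
  · exact Subtype.ext (hh (K.mkQ ⟨x, hx⟩))

lemma exists_injective_embedding (M : Type) [AddCommGroup M] [Module R M] :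
    ∃ (E : Type) (_ : AddCommGroup E) (_ : Module R E) (_ : Module.Injective R E)
      (f : M →ₗ[R] E), Function.Injective f :=
  let X : ModuleCat.{0} R := Injective.under (ModuleCat.of R M)
  let ι : ModuleCat.of R M ⟶ X := Injective.ι (ModuleCat.of R M)
  have hX : Injective (ModuleCat.of R X) :=
    inferInstanceAs (Injective (Injective.under (ModuleCat.of R M)))
  have hι : Mono ι := inferInstanceAs (Mono (Injective.ι (ModuleCat.of R M)))
  ⟨X, inferInstance, inferInstance, (Module.injective_iff_injective_object R X).2 hX,
    ι.hom, (ModuleCat.mono_iff_injective ι).1 hι⟩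

lemma exists_torsion_injective_embedding [IsNoetherianRing R] (T : Type) [AddCommGroup T]
    [Module R T] (hT : ∀ x : T, x ∈ gamma a T) :
    ∃ (D : Type) (_ : AddCommGroup D) (_ : Module R D) (_ : Module.Injective R D)
      (f : T →ₗ[R] D), Function.Injective f ∧ ∀ x : D, x ∈ gamma a D := by
  obtain ⟨E, _, _, _, f, hf⟩ := exists_injective_embedding (R := R) T
  refine ⟨gamma a E, inferInstance, inferInstance, gamma_injective a E,
    f.codRestrict _ fun x => ?_, fun x y h => hf (congrArg Subtype.val h), gamma_gamma a E⟩
  obtain ⟨k, hk⟩ := hT x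
  exact ⟨k, fun r hr => by rw [← map_smul, hk r hr, map_zero]⟩

/-- Every module maps, with torsion kernel, to a torsion-free injective module. -/
lemma exists_torsionfree_injective [IsNoetherianRing R] (M : Type) [AddCommGroup M] [Module R M] :
    ∃ (E : Type) (_ : AddCommGroup E) (_ : Module R E) (_ : Module.Injective R E)
      (f : M →ₗ[R] E), (∀ x, f x = 0 → x ∈ gamma a M) ∧
        ∀ x : E, (∀ r ∈ a, r • x = 0) → x = 0 := by
  obtain ⟨E, _, _, _, ι, hι⟩ := exists_injective_embedding (R := R) M
  have := gamma_injective a E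
  obtain ⟨ρ, hρ⟩ := Module.Injective.out (gamma a E).subtype Subtype.val_injective
    (LinearMap.id : gamma a E →ₗ[R] gamma a E)
  have hρ' : ∀ x (hx : x ∈ gamma a E), ρ x = ⟨x, hx⟩ := fun x hx => hρ ⟨x, hx⟩
  let π : E →ₗ[R] LinearMap.ker ρ :=
    (LinearMap.id - (gamma a E).subtype ∘ₗ ρ).codRestrict _ fun x => by
      rw [LinearMap.mem_ker, LinearMap.sub_apply, map_sub, sub_eq_zero]
      exact (hρ (ρ x)).symm
  have hπ : ∀ x : LinearMap.ker ρ, π x = x := fun x => Subtype.ext (by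
    change (x : E) - (ρ x : gamma a E) = x
    rw [show ρ (x : E) = 0 from x.2]; simp)
  refine ⟨LinearMap.ker ρ, inferInstance, inferInstance, ⟨fun X Y _ _ _ _ f hf g => ?_⟩,
    π ∘ₗ ι, fun x hx => ?_, fun x hx => ?_⟩
  · obtain ⟨h, hh⟩ := Module.Injective.out f hf ((LinearMap.ker ρ).subtype ∘ₗ g)
    exact ⟨π ∘ₗ h, fun x => by rw [LinearMap.comp_apply, hh]; exact hπ _⟩
  · have h0 : ι x - (ρ (ι x) : gamma a E) = 0 := congrArg Subtype.val hx
    obtain ⟨k, hk⟩ := (ρ (ι x)).2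
    refine ⟨k, fun r hr => hι ?_⟩
    rw [map_smul, sub_eq_zero.1 h0, hk r hr, map_zero]
  · have h1 := hρ' x ⟨1, fun r hr => congrArg Subtype.val (hx r (by simpa using hr))⟩
    rw [show ρ (x : E) = 0 from x.2] at h1
    exact Subtype.ext (congrArg Subtype.val h1).symm

end LocCoh

namespace LocCoh
open Abelian
variable {R : Type} [CommRing R]

section ShortExact
variable {A B C : Type} [AddCommGroup A] [Module R A] [AddCommGroup B] [Module R B]
  [AddCommGroup C] [Module R C]

/-- The short complex of modules attached to an exact pair of linear maps. -/
abbrev ses (f : A →ₗ[R] B) (g : B →ₗ[R] C) (h : Function.Exact f g) :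
    ShortComplex (ModuleCat.{0} R) :=
  ShortComplex.mk (ModuleCat.ofHom f) (ModuleCat.ofHom g)
    (by ext x; exact h.apply_apply_eq_zero x)

lemma ses_shortExact {f : A →ₗ[R] B} {g : B →ₗ[R] C} (h : Function.Exact f g)
    (hf : Function.Injective f) (hg : Function.Surjective g) : (ses f g h).ShortExact where
  exact := (ShortComplex.ShortExact.moduleCat_exact_iff_function_exact _).2 h
  mono_f := (ModuleCat.mono_iff_injective _).2 hf
  epi_g := (ModuleCat.epi_iff_surjective _).2 hg

end ShortExact

/-- Postcomposition with a morphism on `Ext`. -/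
abbrev extMap (X : ModuleCat.{0} R) {M N : ModuleCat.{0} R} (f : M ⟶ N) (i : ℕ) :
    Ext.{0} X M i →ₗ[R] Ext.{0} X N i :=
  (Ext.mk₀ f).postcompOfLinear R X (add_zero i)

lemma ext_subsingleton (X M : ModuleCat.{0} R) [Subsingleton M] (i : ℕ) :
    Subsingleton (Ext.{0} X M i) := by
  refine ⟨fun x y => ?_⟩
  have h : 𝟙 M = 0 := by ext x; exact Subsingleton.elim _ _
  rw [← Ext.comp_mk₀_id x, ← Ext.comp_mk₀_id y, h, Ext.mk₀_zero, Ext.comp_zero, Ext.comp_zero]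

lemma DL_subsingleton (a : Ideal R) (i : ℕ) (M : ModuleCat.{0} R) [Subsingleton M] :
    Subsingleton (DL a i M) := by
  refine subsingleton_of_forall_eq 0 fun z => ?_
  obtain ⟨k, x, rfl⟩ := exists_DLof a i M z
  have := ext_subsingleton (ModuleCat.of R (R ⧸ a ^ k)) M i
  rw [Subsingleton.elim x 0, map_zero]

lemma smul_ext_eq_zero (I : Ideal R) (M : ModuleCat.{0} R) (i : ℕ)
    (x : Ext.{0} (ModuleCat.of R (R ⧸ I)) M i) {r : R} (hr : r ∈ I) : r • x = 0 := by
  have h : r • 𝟙 (ModuleCat.of R (R ⧸ I)) = 0 := by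
    ext
    change Submodule.Quotient.mk (r • (1 : R)) = (0 : R ⧸ I)
    rw [Submodule.Quotient.mk_eq_zero]
    exact I.mul_mem_right _ hr
  rw [← Ext.mk₀_id_comp x, ← Ext.smul_comp, ← Ext.mk₀_smul, h, Ext.mk₀_zero, Ext.zero_comp]

lemma DL_torsion (a : Ideal R) (i : ℕ) (M : ModuleCat.{0} R) (z : DL a i M) :
    ∃ k, ∀ r ∈ a ^ k, r • z = 0 := by
  obtain ⟨k, x, rfl⟩ := exists_DLof a i M z
  exact ⟨k, fun r hr => by rw [← map_smul, smul_ext_eq_zero _ _ _ _ hr, map_zero]⟩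

/-- A morphism of direct systems which is eventually bijective induces an isomorphism. -/
def DLequiv (a : Ideal R) {i j : ℕ} {M N : ModuleCat.{0} R}
    (g : ∀ k, powExt a M i k →ₗ[R] powExt a N j k)
    (hg : ∀ k l h x, g l (powRes a M i k l h x) = powRes a N j k l h (g k x))
    (hinj : ∀ k x, g k x = 0 → ∃ l h, powRes a M i k l h x = 0)
    (hsurj : ∀ k y, ∃ l h x, g l x = powRes a N j k l h y) : DL a i M ≃ₗ[R] DL a j N :=
  LinearEquiv.ofBijective (Module.DirectLimit.map g fun k l h => LinearMap.ext (hg k l h)) <| by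
    constructor
    · rw [injective_iff_map_eq_zero]
      intro z hz
      obtain ⟨k, x, rfl⟩ := exists_DLof _ _ _ z
      rw [Module.DirectLimit.map_apply_of] at hz
      obtain ⟨l, h, hl⟩ := DLof_eq_zero _ _ _ hz
      rw [← hg] at hl
      obtain ⟨m, h', hm⟩ := hinj _ _ hl
      rw [← DLof_res a i _ h, ← DLof_res a i _ h', hm, map_zero]
    · intro z
      obtain ⟨k, y, rfl⟩ := exists_DLof _ _ _ z
      obtain ⟨l, h, x, hx⟩ := hsurj k y
      refine ⟨DLof a i M l x, ?_⟩
      rw [Module.DirectLimit.map_apply_of, hx]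
      exact DLof_res a j N h y

/-- Evaluation at `1` identifies `Hom(R ⧸ I, M)` with the `I`-torsion of `M`. -/
def ev (I : Ideal R) (M : Type) [AddCommGroup M] [Module R M] :
    Ext.{0} (ModuleCat.of R (R ⧸ I)) (ModuleCat.of R M) 0 →ₗ[R] M :=
  LinearMap.applyₗ (Submodule.Quotient.mk (1 : R) : R ⧸ I) ∘ₗ
    ((Ext.linearEquiv₀ (R := R)).trans ModuleCat.homLinearEquiv).toLinearMap

lemma ev_mk₀ (I : Ideal R) (M : Type) [AddCommGroup M] [Module R M] (f : R ⧸ I →ₗ[R] M) :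
    ev I M (Ext.mk₀ (ModuleCat.ofHom f)) = f (Submodule.Quotient.mk 1) := by
  change (Ext.linearEquiv₀ (R := R) (Ext.mk₀ (ModuleCat.ofHom f))).hom _ = _
  rw [show Ext.linearEquiv₀ (R := R) (Ext.mk₀ (ModuleCat.ofHom f)) = ModuleCat.ofHom f from
    (Ext.linearEquiv₀ (R := R)).apply_symm_apply _]
  rfl

lemma exists_mk₀ (I : Ideal R) (M : Type) [AddCommGroup M] [Module R M]
    (x : Ext.{0} (ModuleCat.of R (R ⧸ I)) (ModuleCat.of R M) 0) :
    ∃ f : R ⧸ I →ₗ[R] M, x = Ext.mk₀ (ModuleCat.ofHom f) :=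
  ⟨(Ext.linearEquiv₀ (R := R) x).hom, (Ext.mk₀_linearEquiv₀_apply (R := R) x).symm⟩

lemma ev_injective (I : Ideal R) (M : Type) [AddCommGroup M] [Module R M] :
    Function.Injective (ev I M) := by
  rw [injective_iff_map_eq_zero]
  intro x hx
  obtain ⟨f, rfl⟩ := exists_mk₀ I M x
  rw [ev_mk₀] at hx
  have : f = 0 := by
    ext
    exact hx
  rw [this, ModuleCat.ofHom_zero, Ext.mk₀_zero]

lemma smul_ev (I : Ideal R) (M : Type) [AddCommGroup M] [Module R M]
    (x : Ext.{0} (ModuleCat.of R (R ⧸ I)) (ModuleCat.of R M) 0) {r : R} (hr : r ∈ I) :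
    r • ev I M x = 0 := by
  rw [← map_smul, smul_ext_eq_zero _ _ _ _ hr, map_zero]

lemma exists_ev (I : Ideal R) (M : Type) [AddCommGroup M] [Module R M] (m : M)
    (hm : ∀ r ∈ I, r • m = 0) : ∃ x, ev I M x = m :=
  ⟨Ext.mk₀ (ModuleCat.ofHom (I.liftQ (LinearMap.toSpanSingleton R M m) hm)), by
    rw [ev_mk₀]; exact one_smul R m⟩

lemma ev_res {J I : Ideal R} (h : J ≤ I) (M : Type) [AddCommGroup M] [Module R M]
    (x : Ext.{0} (ModuleCat.of R (R ⧸ I)) (ModuleCat.of R M) 0) :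
    ev J M (res h _ 0 x) = ev I M x := by
  obtain ⟨f, rfl⟩ := exists_mk₀ I M x
  rw [res_apply, Ext.mk₀_comp_mk₀, ev_mk₀]
  exact ev_mk₀ J M _

lemma ev_extMap (I : Ideal R) {M N : Type} [AddCommGroup M] [Module R M] [AddCommGroup N]
    [Module R N] (g : M →ₗ[R] N) (x : Ext.{0} (ModuleCat.of R (R ⧸ I)) (ModuleCat.of R M) 0) :
    ev I N (x.comp (Ext.mk₀ (ModuleCat.ofHom g)) (add_zero 0)) = g (ev I M x) := by
  obtain ⟨f, rfl⟩ := exists_mk₀ I M x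
  rw [Ext.mk₀_comp_mk₀, ev_mk₀]
  exact ev_mk₀ I N _

/-- Zeroth local cohomology is the torsion submodule. -/
def DLzeroEquiv (a : Ideal R) (M : Type) [AddCommGroup M] [Module R M] :
    DL a 0 (ModuleCat.of R M) ≃ₗ[R] gamma a M :=
  LinearEquiv.ofBijective
    (Module.DirectLimit.lift R ℕ _ _
      (fun k => (ev (a ^ k) M).codRestrict (gamma a M) fun x => ⟨k, fun _ hr => smul_ev _ _ x hr⟩)
      fun _ _ h x => Subtype.ext (ev_res (Ideal.pow_le_pow_right h) M x)) <| by
    constructor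
    · rw [injective_iff_map_eq_zero]
      intro z hz
      obtain ⟨k, x, rfl⟩ := exists_DLof _ _ _ z
      rw [Module.DirectLimit.lift_of] at hz
      have : x = 0 := ev_injective _ _ ((congrArg Subtype.val hz).trans (map_zero _).symm)
      rw [this, map_zero]
    · rintro ⟨m, k, hm⟩
      obtain ⟨x, hx⟩ := exists_ev (a ^ k) M m hm
      exact ⟨DLof _ _ _ k x, (Module.DirectLimit.lift_of ..).trans (Subtype.ext hx)⟩

end LocCoh

namespace LocCoh
open Abelian
variable {R : Type} [CommRing R]

lemma injective_of (E : Type) [AddCommGroup E] [Module R E] [h : Module.Injective R E] :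
    Injective (ModuleCat.of R E) :=
  (Module.injective_iff_injective_object R E).1 h

/-- Each positive degree `Ext` class with values in a torsion module is eventually zero. -/
lemma exists_powRes_eq_zero [IsNoetherianRing R] (a : Ideal R) (j : ℕ) (T : Type)
    [AddCommGroup T] [Module R T] (hT : ∀ x : T, x ∈ gamma a T) (k : ℕ)
    (x : powExt a (ModuleCat.of R T) (j + 1) k) :
    ∃ l h, powRes a _ (j + 1) k l h x = 0 := by
  induction j generalizing T k with
  | zero =>
    obtain ⟨D, _, _, _, f, hf, hD⟩ := exists_torsion_injective_embedding a T hT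
    have hS := ses_shortExact (f.exact_map_mkQ_range) hf (Submodule.mkQ_surjective _)
    have := injective_of (R := R) D
    obtain ⟨y, rfl⟩ := Ext.covariant_sequence_exact₁ _ hS x (Ext.eq_zero_of_injective _) (zero_add 1)
    obtain ⟨d, hd⟩ := Submodule.mkQ_surjective _ (ev _ _ y)
    obtain ⟨m, hm⟩ := hD d
    refine ⟨max k m, le_max_left _ _, ?_⟩
    obtain ⟨w, hw⟩ := exists_ev (a ^ max k m) D d
      fun r hr => hm r (Ideal.pow_le_pow_right (le_max_right _ _) hr)
    have : res (Ideal.pow_le_pow_right (le_max_left k m)) _ 0 y =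
        w.comp (Ext.mk₀ (ModuleCat.ofHom (LinearMap.range f).mkQ)) (add_zero 0) := by
      apply ev_injective
      rw [ev_res, ev_extMap, hw, hd]
    rw [res_comp, this, Ext.comp_assoc_of_second_deg_zero]
    rw [show (Ext.mk₀ (ModuleCat.ofHom (LinearMap.range f).mkQ)).comp hS.extClass (zero_add 1) = 0
      from hS.comp_extClass, Ext.comp_zero]
  | succ j ih =>
    obtain ⟨D, _, _, _, f, hf, hD⟩ := exists_torsion_injective_embedding a T hT
    have hS := ses_shortExact (f.exact_map_mkQ_range) hf (Submodule.mkQ_surjective _)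
    have := injective_of (R := R) D
    obtain ⟨y, rfl⟩ := Ext.covariant_sequence_exact₁ _ hS x (Ext.eq_zero_of_injective _)
      (n₀ := j + 1) rfl
    obtain ⟨l, h, hl⟩ := ih (D ⧸ LinearMap.range f) (fun q => by
      obtain ⟨d, rfl⟩ := Submodule.mkQ_surjective _ q
      obtain ⟨m, hm⟩ := hD d
      exact ⟨m, fun r hr => by rw [← map_smul, hm r hr, map_zero]⟩) k y
    exact ⟨l, h, by rw [res_comp, show res _ _ _ y = 0 from hl, Ext.zero_comp]⟩

section
variable {A B C : Type} [AddCommGroup A] [Module R A] [AddCommGroup B] [Module R B]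
  [AddCommGroup C] [Module R C]

/-- Killing a torsion submodule does not change local cohomology in positive degrees. -/
lemma nonempty_DLequiv_of_torsion [IsNoetherianRing R] (a : Ideal R) (j : ℕ) {f : A →ₗ[R] B}
    {g : B →ₗ[R] C} (h : Function.Exact f g) (hf : Function.Injective f)
    (hg : Function.Surjective g) (hA : ∀ x : A, x ∈ gamma a A) :
    Nonempty (DL a (j + 1) (ModuleCat.of R B) ≃ₗ[R] DL a (j + 1) (ModuleCat.of R C)) := by
  have hS := ses_shortExact h hf hg
  refine ⟨DLequiv a (fun k => extMap _ (ModuleCat.ofHom g) (j + 1))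
    (fun k l h x => (res_comp _ _ _ (add_zero _)).symm) (fun k x hx => ?_) (fun k y => ?_)⟩
  · obtain ⟨w, rfl⟩ := Ext.covariant_sequence_exact₂ _ hS x hx
    obtain ⟨l, h, hl⟩ := exists_powRes_eq_zero a j A hA k w
    exact ⟨l, h, by rw [res_comp, show res _ _ _ w = 0 from hl, Ext.zero_comp]⟩
  · obtain ⟨l, h, hl⟩ := exists_powRes_eq_zero a (j + 1) A hA k (y.comp hS.extClass rfl)
    have h0 : (powRes a _ (j + 1) k l h y).comp hS.extClass rfl = 0 :=
      (res_comp _ _ _ _).symm.trans hl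
    obtain ⟨x, hx⟩ := Ext.covariant_sequence_exact₃ _ hS _ rfl h0
    exact ⟨l, h, x, hx⟩

lemma ext_eq_zero_of_torsionfree (a : Ideal R) (E : Type) [AddCommGroup E] [Module R E]
    [Module.Injective R E] (hE : ∀ x : E, (∀ r ∈ a, r • x = 0) → x = 0) (k i : ℕ)
    (x : powExt a (ModuleCat.of R E) i k) : x = 0 := by
  have := injective_of (R := R) E
  cases i with
  | succ i => exact Ext.eq_zero_of_injective x
  | zero =>
    apply ev_injective
    rw [map_zero]
    have hx := fun r (hr : r ∈ a ^ k) => smul_ev (a ^ k) E x hr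
    generalize ev (a ^ k) E x = e at hx ⊢
    clear x
    induction k generalizing e with
    | zero => simpa using hx 1 (by simp)
    | succ k ih =>
      refine hE e fun r hr => ih _ fun s hs => ?_
      rw [← mul_smul]
      exact hx _ (pow_succ a k ▸ Ideal.mul_mem_mul hs hr)

/-- Dimension shift along a torsion-free injective module. -/
lemma extClass_bijective (a : Ideal R) {f : A →ₗ[R] B} {g : B →ₗ[R] C}
    {h : Function.Exact f g} (hS : (ses f g h).ShortExact)
    [Module.Injective R B] (hB : ∀ x : B, (∀ r ∈ a, r • x = 0) → x = 0) (k j : ℕ) :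
    Function.Bijective (hS.extClass.postcompOfLinear R (ModuleCat.of R (R ⧸ a ^ k))
      (rfl : j + 1 = j + 1)) := by
  constructor
  · rw [injective_iff_map_eq_zero]
    intro x hx
    obtain ⟨w, rfl⟩ := Ext.covariant_sequence_exact₃ _ hS x rfl hx
    rw [show w = 0 from ext_eq_zero_of_torsionfree a B hB k _ w, Ext.zero_comp]
  · intro x
    exact Ext.covariant_sequence_exact₁ _ hS x (ext_eq_zero_of_torsionfree a B hB k _ _) rfl

lemma nonempty_DLequiv_of_injective (a : Ideal R) (j : ℕ) {f : A →ₗ[R] B}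
    {g : B →ₗ[R] C} (h : Function.Exact f g) (hf : Function.Injective f)
    (hg : Function.Surjective g)
    [Module.Injective R B] (hB : ∀ x : B, (∀ r ∈ a, r • x = 0) → x = 0) :
    Nonempty (DL a j (ModuleCat.of R C) ≃ₗ[R] DL a (j + 1) (ModuleCat.of R A)) := by
  have hS := ses_shortExact h hf hg
  refine ⟨DLequiv a (fun k => hS.extClass.postcompOfLinear R _ rfl)
    (fun k l h x => (res_comp _ _ _ rfl).symm) (fun k x hx => ?_) (fun k y => ?_)⟩
  · refine ⟨k, le_rfl, ?_⟩
    rw [(extClass_bijective a hS hB k j).1 (hx.trans (map_zero _).symm), map_zero]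
  · obtain ⟨x, rfl⟩ := (extClass_bijective a hS hB k j).2 y
    exact ⟨k, le_rfl, x, (res_self _ _ _ _).symm⟩

/-- Dimension shift along a map to a torsion-free injective module with torsion kernel. -/
lemma nonempty_DLequiv [IsNoetherianRing R] (a : Ideal R) (j : ℕ) (f : A →ₗ[R] B)
    (g : B →ₗ[R] C) (h : Function.Exact f g) (hg : Function.Surjective g)
    (hA : ∀ x, f x = 0 → x ∈ gamma a A)
    [Module.Injective R B] (hB : ∀ x : B, (∀ r ∈ a, r • x = 0) → x = 0) :
    Nonempty (DL a j (ModuleCat.of R C) ≃ₗ[R] DL a (j + 1) (ModuleCat.of R A)) := by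
  obtain ⟨e⟩ := nonempty_DLequiv_of_injective a j (f := (LinearMap.range f).subtype) (g := g)
    (fun y => (h y).trans (by simp)) Subtype.val_injective hg hB
  obtain ⟨e'⟩ := nonempty_DLequiv_of_torsion a j (f := (LinearMap.ker f).subtype)
    (g := f.rangeRestrict) (fun y => by simp [Subtype.ext_iff]) Subtype.val_injective
    f.surjective_rangeRestrict (fun x => by
      obtain ⟨k, hk⟩ := hA x x.2
      exact ⟨k, fun r hr => Subtype.ext (hk r hr)⟩)
  exact ⟨e.trans e'.symm⟩

end

end LocCoh

namespace LocCoh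
open Abelian
variable {R : Type} [CommRing R]

section Localization
variable (a : Ideal R) (S : Submonoid R) {M E C : Type} [AddCommGroup M] [Module R M]
  [AddCommGroup E] [Module R E] [AddCommGroup C] [Module R C]

lemma smul_eq_zero_of_mem_map (I : Ideal R) (x : LocalizedModule S M)
    (hx : ∀ r ∈ I, algebraMap R (Localization S) r • x = 0)
    (c : Localization S) (hc : c ∈ I.map (algebraMap R (Localization S))) : c • x = 0 := by
  have : I.map (algebraMap R (Localization S)) ≤
      LinearMap.ker (LinearMap.toSpanSingleton (Localization S) (LocalizedModule S M) x) :=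
    Ideal.map_le_iff_le_comap.2 hx
  exact this hc

lemma algebraMap_smul_mk (r : R) (x : M) (s : S) :
    algebraMap R (Localization S) r • LocalizedModule.mk x s = LocalizedModule.mk (r • x) s := by
  rw [algebraMap_smul, LocalizedModule.smul'_mk]

lemma mk_eq_zero_iff (x : M) (s : S) :
    LocalizedModule.mk x s = 0 ↔ ∃ u : S, u • x = 0 := by
  rw [IsLocalizedModule.mk_eq_mk', IsLocalizedModule.mk'_eq_zero']

/-- Torsion elements remain torsion after localization. -/
lemma mk_mem_gamma (x : M) (hx : ∃ u : S, u • x ∈ gamma a M) (s : S) :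
    LocalizedModule.mk x s ∈
      gamma (a.map (algebraMap R (Localization S))) (LocalizedModule S M) := by
  obtain ⟨u, k, hk⟩ := hx
  refine ⟨k, ?_⟩
  rw [← Ideal.map_pow]
  refine smul_eq_zero_of_mem_map S _ _ fun r hr => ?_
  rw [algebraMap_smul_mk, mk_eq_zero_iff]
  refine ⟨u, ?_⟩
  rw [smul_comm]
  exact hk r hr

/-- If the torsion of a localization is finitely generated, the torsion is locally bounded. -/
lemma exists_bound_of_localization [IsNoetherianRing R]
    [Module.Finite (Localization S)
      (gamma (a.map (algebraMap R (Localization S))) (LocalizedModule S M))] :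
    ∃ m, ∀ x : gamma a M, ∀ r ∈ a ^ m, ∃ s ∈ S, s • r • x = 0 := by
  have : IsNoetherianRing (Localization S) := IsLocalization.isNoetherianRing S _ inferInstance
  obtain ⟨m, hm⟩ := exists_bound_of_fg (a.map (algebraMap R (Localization S)))
    (gamma_gamma _ (LocalizedModule S M))
  refine ⟨m, fun x r hr => ?_⟩
  have h1 := mk_mem_gamma a S (x : M) ⟨1, by rw [one_smul]; exact x.2⟩ 1
  have h2 := congrArg Subtype.val (hm ⟨_, h1⟩ (algebraMap R _ r)
    (Ideal.map_pow (algebraMap R (Localization S)) a m ▸ Ideal.mem_map_of_mem _ hr))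
  change algebraMap R (Localization S) r • LocalizedModule.mk (x : M) 1 = 0 at h2
  rw [algebraMap_smul_mk, mk_eq_zero_iff] at h2
  obtain ⟨u, hu⟩ := h2
  exact ⟨u, u.2, Subtype.ext hu⟩

lemma localization_torsionfree [IsNoetherianRing R]
    (hE : ∀ x : E, (∀ r ∈ a, r • x = 0) → x = 0) (y : LocalizedModule S E)
    (hy : ∀ r ∈ a.map (algebraMap R (Localization S)), r • y = 0) : y = 0 := by
  induction y using LocalizedModule.induction_on with
  | h x s =>
  obtain ⟨n, g, hg, hga⟩ := Ideal.exists_fin_generators (A := E) a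
  have : ∀ i, ∃ u : S, u • g i • x = 0 := fun i => by
    have := hy _ (Ideal.mem_map_of_mem _ (hg i))
    rwa [algebraMap_smul_mk, mk_eq_zero_iff] at this
  choose u hu using this
  rw [mk_eq_zero_iff]
  refine ⟨∏ i, u i, hE _ (hga _ fun i => ?_)⟩
  rw [← Finset.prod_erase_mul _ _ (Finset.mem_univ i), mul_smul, smul_comm, smul_comm (g i), hu,
    smul_zero]

/-- The localized version of the dimension shift. -/
lemma nonempty_DLequiv_localization [IsNoetherianRing R] (j : ℕ) (f : M →ₗ[R] E)
    (g : E →ₗ[R] C) (h : Function.Exact f g) (hg : Function.Surjective g)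
    (hM : ∀ x, f x = 0 → x ∈ gamma a M)
    [Module.Injective R E] (hE : ∀ x : E, (∀ r ∈ a, r • x = 0) → x = 0) :
    Nonempty (DL (a.map (algebraMap R (Localization S))) j
        (ModuleCat.of (Localization S) (LocalizedModule S C)) ≃ₗ[Localization S]
      DL (a.map (algebraMap R (Localization S))) (j + 1)
        (ModuleCat.of (Localization S) (LocalizedModule S M))) := by
  have : IsNoetherianRing (Localization S) := IsLocalization.isNoetherianRing S _ inferInstance
  have : Module.Injective (Localization S) (LocalizedModule S E) :=
    Module.injective_of_isLocalizedModule S (LocalizedModule.mkLinearMap S E)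
  refine nonempty_DLequiv _ j (LocalizedModule.map S f) (LocalizedModule.map S g)
    (LocalizedModule.map_exact S f g h) (LocalizedModule.map_surjective S g hg) (fun y hy => ?_)
    (localization_torsionfree a S hE)
  induction y using LocalizedModule.induction_on with
  | h x s =>
  rw [LocalizedModule.map_mk, mk_eq_zero_iff] at hy
  obtain ⟨u, hu⟩ := hy
  exact mk_mem_gamma a S x ⟨u, hM _ ((map_smul f (u : R) x).trans hu)⟩ s

end Localization

section
variable {S : Set (PrimeSpectrum R)} {A B : Type} [AddCommGroup A] [Module R A]
  [AddCommGroup B] [Module R B]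

lemma AlmostFinite.torsionBySet_of_injective [IsNoetherianRing R] (a : Ideal R) (f : A →ₗ[R] B)
    (hf : Function.Injective f) (h : AlmostFinite S (Submodule.torsionBySet R B (a : Set R))) :
    AlmostFinite S (Submodule.torsionBySet R A (a : Set R)) := by
  refine of_injective ((f ∘ₗ Submodule.subtype _).codRestrict _ fun x => ?_)
    (fun x y hxy => Subtype.ext (hf (congrArg Subtype.val hxy))) h
  rw [Submodule.mem_torsionBySet_iff]
  intro r
  have := (Submodule.mem_torsionBySet_iff _ _).1 x.2 r
  rw [LinearMap.comp_apply, ← map_smul, Submodule.subtype_apply, this, map_zero]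

lemma AlmostFinite.torsionBySet_of_ext (a : Ideal R)
    (h : AlmostFinite S (powExt a (ModuleCat.of R A) 0 1)) :
    AlmostFinite S (Submodule.torsionBySet R A (a : Set R)) := by
  refine of_surjective ((ev (a ^ 1) A).codRestrict _ fun x => ?_) (fun x => ?_) h
  · rw [Submodule.mem_torsionBySet_iff]
    exact fun r => smul_ev _ _ x (by simp)
  · obtain ⟨y, hy⟩ := exists_ev (a ^ 1) A (x : A) fun r hr =>
      (Submodule.mem_torsionBySet_iff _ _).1 x.2 ⟨r, by simpa using hr⟩
    exact ⟨y, Subtype.ext hy⟩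

end

/-- The `a`-socle of `H^t_a(M)` is almost finite when the lower local cohomology modules are
locally finite. -/
theorem almostFinite_torsionBySet_DL [IsNoetherianRing R] (a : Ideal R)
    {S : Set (PrimeSpectrum R)}
    (hS : ∀ p ∈ S, ∀ q : PrimeSpectrum R, q ≤ p → a ≤ q.asIdeal → q ∈ S) (t : ℕ)
    (M : Type) [AddCommGroup M] [Module R M]
    (hM : ∀ j ≤ t, AlmostFinite S (powExt a (ModuleCat.of R M) j 1))
    (hfin : ∀ j < t, ∀ p ∈ S, Module.Finite (Localization p.asIdeal.primeCompl)
      (DL (a.map (algebraMap R (Localization p.asIdeal.primeCompl))) j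
        (ModuleCat.of (Localization p.asIdeal.primeCompl)
          (LocalizedModule p.asIdeal.primeCompl M)))) :
    AlmostFinite S (Submodule.torsionBySet R (DL a t (ModuleCat.of R M)) (a : Set R)) := by
  induction t generalizing M with
  | zero =>
    exact (AlmostFinite.torsionBySet_of_ext a (hM 0 le_rfl)).torsionBySet_of_injective a
      ((gamma a M).subtype ∘ₗ (DLzeroEquiv a M).toLinearMap)
      (Subtype.val_injective.comp (DLzeroEquiv a M).injective)
  | succ t ih =>
    have hΓ : AlmostFinite S (gamma a M) := by
      refine AlmostFinite.of_torsionBySet a hS (gamma_gamma a M)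
        ((AlmostFinite.torsionBySet_of_ext a (hM 0 (Nat.zero_le _))).torsionBySet_of_injective a
          (gamma a M).subtype Subtype.val_injective) fun p hp => ?_
      have := hfin 0 (Nat.succ_pos t) p hp
      have := Module.Finite.equiv (DLzeroEquiv
        (a.map (algebraMap R (Localization p.asIdeal.primeCompl)))
        (LocalizedModule p.asIdeal.primeCompl M))
      exact exists_bound_of_localization a p.asIdeal.primeCompl
    obtain ⟨E, _, _, _, f, hf, hE⟩ := exists_torsionfree_injective a M
    have hex := f.exact_map_mkQ_range
    have hsurj := Submodule.mkQ_surjective (LinearMap.range f)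
    have hK : AlmostFinite S (LinearMap.ker f) :=
      hΓ.of_injective (Submodule.inclusion fun x hx => hf x hx) (Submodule.inclusion_injective _)
    have hS₁ := ses_shortExact (f := (LinearMap.ker f).subtype) (g := f.rangeRestrict)
      (fun y => by simp [Subtype.ext_iff]) Subtype.val_injective f.surjective_rangeRestrict
    have hS₂ := ses_shortExact (f := (LinearMap.range f).subtype) (g := (LinearMap.range f).mkQ)
      (fun y => (hex y).trans (by simp)) Subtype.val_injective hsurj
    obtain ⟨e⟩ := nonempty_DLequiv a t f _ hex hsurj hf hE
    refine (ih (E ⧸ LinearMap.range f) (fun j hj => ?_) fun j hj p hp => ?_).torsionBySet_of_injective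
      a e.symm.toLinearMap e.symm.injective
    · refine AlmostFinite.of_injective _ (extClass_bijective a hS₂ hE 1 j).1 ?_
      have : Module.Finite R (R ⧸ a ^ 1) := inferInstance
      exact AlmostFinite.of_exact (extMap _ (ModuleCat.ofHom f.rangeRestrict) (j + 1))
        (hS₁.extClass.postcompOfLinear R (ModuleCat.of R (R ⧸ a ^ 1))
          (rfl : (j + 1) + 1 = (j + 1) + 1))
        (fun y hy => Ext.covariant_sequence_exact₃ _ hS₁ y rfl hy) (hM (j + 1) (by omega))
        (AlmostFinite.ext (K := ModuleCat.of R (LinearMap.ker f)) hK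
          (ModuleCat.of R (R ⧸ a ^ 1)) _)
    · obtain ⟨e'⟩ := nonempty_DLequiv_localization a p.asIdeal.primeCompl j f _ hex hsurj hf hE
      have := hfin (j + 1) (by omega) p hp
      exact Module.Finite.equiv e'.symm

end LocCoh

open LocCoh

theorem LocCoh.finite_locCoh_of_lt_finDimN (R : Type) [CommRing R]
    (a : Ideal R) (M : Type) [AddCommGroup M] [Module R M] [Module.Finite R M]
    (n j : ℕ) (hj : (j : ℕ∞) < finDimN R a n M) (p : PrimeSpectrum R) (hap : a ≤ p.asIdeal)
    (hp : (n : WithBot ℕ∞) ≤ ringKrullDim (R ⧸ p.asIdeal)) :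
    Module.Finite (Localization p.asIdeal.primeCompl)
      (DL (a.map (algebraMap R (Localization p.asIdeal.primeCompl))) j
        (ModuleCat.of (Localization p.asIdeal.primeCompl)
          (LocalizedModule p.asIdeal.primeCompl M))) := by
  by_cases hM : p ∈ Module.support R M
  · have hp' : p ∈ Module.support R (M ⧸ (a • ⊤ : Submodule R M)) := by
      rw [Module.support_quotient]
      exact ⟨hM, hap⟩
    have hlt : (j : ℕ∞) < finDim (Localization p.asIdeal.primeCompl)
        (a.map (algebraMap R (Localization p.asIdeal.primeCompl)))
        (LocalizedModule p.asIdeal.primeCompl M) :=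
      hj.trans_le (sInf_le ⟨p, hp', hp, rfl⟩)
    have : Module.Finite (Localization p.asIdeal.primeCompl)
        (locCoh (Localization p.asIdeal.primeCompl)
          (a.map (algebraMap R (Localization p.asIdeal.primeCompl))) j
          (LocalizedModule p.asIdeal.primeCompl M)) := by
      by_contra hcon
      exact (hlt.trans_le (sInf_le (Set.mem_image_of_mem _ hcon))).false
    exact Module.Finite.equiv (locCohEquiv _ j (LocalizedModule p.asIdeal.primeCompl M)).symm
  · have := Module.notMem_support_iff.1 hM
    have := DL_subsingleton (a.map (algebraMap R (Localization p.asIdeal.primeCompl))) j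
      (ModuleCat.of _ (LocalizedModule p.asIdeal.primeCompl M))
    infer_instance

/-- If `t = f_a^n(M)` is finite, then the set
`(Ass_R H^t_a(M))_{≥ n} = {p ∈ Ass_R H^t_a(M) | dim R/p ≥ n}` is finite. -/
theorem finite_assPrimes_locCoh_finDimN (R : Type) [CommRing R] [IsNoetherianRing R]
    (a : Ideal R) (M : Type) [AddCommGroup M] [Module R M] [Module.Finite R M]
    (n t : ℕ) (ht : finDimN R a n M = (t : ℕ∞)) :
    {p ∈ associatedPrimes R ↥(locCoh R a t M) |
      (n : WithBot ℕ∞) ≤ ringKrullDim (R ⧸ p)}.Finite := by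
  let S : Set (PrimeSpectrum R) :=
    {p | (n : WithBot ℕ∞) ≤ ringKrullDim (R ⧸ p.asIdeal) ∧ a ≤ p.asIdeal}
  have hS : ∀ p ∈ S, ∀ q : PrimeSpectrum R, q ≤ p → a ≤ q.asIdeal → q ∈ S := by
    intro p hp q hqp haq
    exact ⟨hp.1.trans (ringKrullDim_le_of_surjective (Ideal.Quotient.factor hqp)
      (Ideal.Quotient.factor_surjective hqp)), haq⟩
  have hfin := (almostFinite_torsionBySet_DL a hS t M
    (fun j _ => by
      have : Module.Finite R (R ⧸ a ^ 1) := inferInstance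
      have : AlmostFinite S (ModuleCat.of R M) := AlmostFinite.of_finite (A := M)
      exact AlmostFinite.ext this (ModuleCat.of R (R ⧸ a ^ 1)) j)
    (fun j hj p hp => finite_locCoh_of_lt_finDimN R a M n j
      (by rw [ht]; exact_mod_cast hj) p hp.2 hp.1)).finite_associatedPrimes
  refine (hfin.image PrimeSpectrum.asIdeal).subset ?_
  rintro p ⟨hp, hn⟩
  rw [← LinearEquiv.AssociatedPrimes.eq (locCohEquiv a t M)] at hp
  let P : PrimeSpectrum R := ⟨p, IsAssociatedPrime.isPrime hp⟩
  obtain ⟨hap, hP⟩ := AlmostFinite.associatedPrimes_torsionBySet a (DL_torsion a t _) P hp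
  exact ⟨P, ⟨⟨hn, hap⟩, hP⟩, rfl⟩
end
end
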